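/- Let H be a graph with k edges and δ(H) ≥ 1. There exist a positive integer C₀ and constants α, β ∈ (0,1) such that every graph G on n ≥ C₀k vertices with minimum degree δ(G) ≥ n/2 + k is arbitrary Hamiltonian H-linked with parameters α, β. -/

import Mathlib

open scoped Classical

/-- `p` is a path between `u` and `v` in the graph `G`, recorded as its list of vertices
(traversed from `u` to `v`). -/
def IsPathBetween {V : Type*} (G : SimpleGraph V) (u v : V) (p : List V) : Prop :=
  p.Chain' G.Adj ∧ p.Nodup ∧ p.head? = some u ∧ p.getLast? = some v

/-- The internal vertices of a path recorded as a list of vertices. -/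
def listInterior {V : Type*} (p : List V) : List V := p.tail.dropLast

/-- `g` is a Hamiltonian `(N H)`-subdivision in the graph `G` for the family of edges `e`
(already mapped into `V`): the `i`-th edge `e i = (u, v)` is assigned a path between `u`
and `v` of length `N i` (so with `N i + 1` vertices), the paths of distinct edges are
internally vertex-disjoint, and together the paths cover all of `V`. -/
def IsHamSubdivisionGraph {V : Type*} (G : SimpleGraph V) {k : ℕ}
    (e : Fin k → V × V) (N : Fin k → ℕ) (g : Fin k → List V) : Prop :=
  (∀ i, IsPathBetween G (e i).1 (e i).2 (g i) ∧ (g i).length = N i + 1) ∧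
  (∀ i j, i ≠ j → ∀ x ∈ listInterior (g i), x ∉ g j) ∧
  (∀ x : V, ∃ i, x ∈ g i)

/-- A graph `G` is arbitrary Hamiltonian `H`-linked with parameters `α, β`, where `H`
is the graph with vertex set `W` and edges `e i` (each edge given by its two ends). -/
def ArbHamHLinkedGraph {V W : Type*} [Fintype V] [Fintype W] (G : SimpleGraph V)
    {k : ℕ} (e : Fin k → W × W) (α β : ℝ) : Prop :=
  ∀ f : W → V, Function.Injective f →
    ∀ N : Fin k → ℕ,
      (∀ i, 4 ≤ N i) →
      (∑ i, if (N i : ℝ) < β * Fintype.card V then (N i : ℝ) else 0) ≤ α * Fintype.card V →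
      (∑ i, (N i - 1)) + Fintype.card W = Fintype.card V →
      ∃ g : Fin k → List V, IsHamSubdivisionGraph G (fun i => (f (e i).1, f (e i).2)) N g

namespace HL
variable {V : Type} 

def link (c : V → V → ℕ) (l1 l2 : List V) : ℕ :=
  match l1.getLast?, l2.head? with
  | some a, some b => c a b
  | _, _ => 0

def cost (c : V → V → ℕ) : List V → ℕ
  | [] => 0
  | a :: l => link c [a] l + cost c l

def cyc (c : V → V → ℕ) (l : List V) : ℕ := cost c l + link c l l

lemma link_some {c : V → V → ℕ} {l1 l2 : List V} {a b : V} (h1 : l1.getLast? = some a)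
    (h2 : l2.head? = some b) : link c l1 l2 = c a b := by
  simp [link, h1, h2]

lemma cost_append (c : V → V → ℕ) (l1 l2 : List V) :
    cost c (l1 ++ l2) = cost c l1 + link c l1 l2 + cost c l2 := by
  induction l1 with
  | nil => simp [cost, link]
  | cons a l ih =>
    cases l with
    | nil => simp [cost, link]
    | cons b l =>
      simp only [List.cons_append, cost] at ih ⊢
      have h1 : link c [a] (b :: (l ++ l2)) = link c [a] (b :: l) := by simp [link]
      have h2 : link c (a :: b :: l) l2 = link c (b :: l) l2 := by
        simp [link, List.getLast?_cons_cons]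
      rw [h1, h2, ih]; ring

lemma link_reverse {c : V → V → ℕ} (hc : ∀ a b, c a b = c b a) (l1 l2 : List V) :
    link c l1.reverse l2.reverse = link c l2 l1 := by
  simp only [link, List.getLast?_reverse, List.head?_reverse]
  cases l1.head? <;> cases l2.getLast? <;> simp [hc]

lemma cost_reverse {c : V → V → ℕ} (hc : ∀ a b, c a b = c b a) (l : List V) :
    cost c l.reverse = cost c l := by
  induction l with
  | nil => rfl
  | cons a l ih =>
    rw [List.reverse_cons, cost_append, ih]
    have := link_reverse hc l [a]
    simp only [List.reverse_singleton] at this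
    rw [this]
    simp [cost, link]; ring

lemma cyc_reverse {c : V → V → ℕ} (hc : ∀ a b, c a b = c b a) (l : List V) :
    cyc c l.reverse = cyc c l := by
  rw [cyc, cyc, cost_reverse hc, link_reverse hc]

lemma cyc_append_comm (c : V → V → ℕ) (l1 l2 : List V) : cyc c (l1 ++ l2) = cyc c (l2 ++ l1) := by
  rcases List.eq_nil_or_concat l1 with rfl | ⟨a1, b1, rfl⟩
  · simp
  rcases List.eq_nil_or_concat l2 with rfl | ⟨a2, b2, rfl⟩
  · simp
  rw [cyc, cyc, cost_append, cost_append]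
  have h1 : link c ((a1 ++ [b1]) ++ (a2 ++ [b2])) ((a1 ++ [b1]) ++ (a2 ++ [b2])) 
    = link c (a2 ++ [b2]) (a1 ++ [b1]) := by
    cases a1 <;> simp [link, List.getLast?_cons, List.getLastD_eq_getLast?]
  have h2 : link c ((a2 ++ [b2]) ++ (a1 ++ [b1])) ((a2 ++ [b2]) ++ (a1 ++ [b1])) 
    = link c (a1 ++ [b1]) (a2 ++ [b2]) := by
    cases a2 <;> simp [link, List.getLast?_cons, List.getLastD_eq_getLast?]
  simp only [List.concat_eq_append] at *
  rw [h1, h2]; ring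

def MinL (c : V → V → ℕ) (S : Finset V) (L : List V) : Prop :=
  L.Nodup ∧ L.toFinset = S ∧ ∀ L' : List V, L'.Nodup → L'.toFinset = S → cyc c L ≤ cyc c L'

lemma MinL.of_perm {c : V → V → ℕ} {S : Finset V} {L L' : List V} (h : MinL c S L)
    (hp : L'.Perm L) (hc : cyc c L' ≤ cyc c L) : MinL c S L' := by
  refine ⟨hp.nodup_iff.2 h.1, ?_, fun L'' h1 h2 => hc.trans (h.2.2 L'' h1 h2)⟩
  rw [List.toFinset_eq_of_perm _ _ hp, h.2.1]

lemma MinL.le_perm {c : V → V → ℕ} {S : Finset V} {L L' : List V} (h : MinL c S L)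
    (hp : L'.Perm L) : cyc c L ≤ cyc c L' := by
  refine h.2.2 _ (hp.nodup_iff.2 h.1) ?_
  rw [List.toFinset_eq_of_perm _ _ hp, h.2.1]

lemma exists_minL (c : V → V → ℕ) (S : Finset V) : ∃ L, MinL c S L := by
  have hne : ∃ m, ∃ L : List V, L.Nodup ∧ L.toFinset = S ∧ cyc c L = m :=
    ⟨_, S.toList, S.nodup_toList, by simp, rfl⟩
  obtain ⟨L, h1, h2, h3⟩ := Nat.find_spec hne
  refine ⟨L, h1, h2, fun L' h1' h2' => ?_⟩
  rw [h3]
  exact Nat.find_min' hne ⟨L', h1', h2', rfl⟩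

/-- the cost used -/
noncomputable def cst (G : SimpleGraph V) (u v : V) (M : ℕ) (a b : V) : ℕ :=
  if (a = u ∧ b = v) ∨ (a = v ∧ b = u) then 0 else if G.Adj a b then M else M + 1

section
variable {G : SimpleGraph V} {u v : V} {M : ℕ}

lemma cst_symm (a b : V) : cst G u v M a b = cst G u v M b a := by
  have : G.Adj a b ↔ G.Adj b a := G.adj_comm a b
  unfold cst; simp only [this]; congr 1; simp; tauto

lemma cst_le (a b : V) : cst G u v M a b ≤ M + 1 := by unfold cst; split_ifs <;> omega

lemma cst_adj {a b : V} (h : G.Adj a b) : cst G u v M a b ≤ M := by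
  unfold cst; split_ifs <;> omega

lemma cst_ge {a b : V} (h : ¬ ((a = u ∧ b = v) ∨ (a = v ∧ b = u))) : M ≤ cst G u v M a b := by
  unfold cst; split_ifs <;> omega

lemma cst_ge' {a b : V} (h : ¬ (a = u ∨ a = v)) : M ≤ cst G u v M a b := by
  apply cst_ge; tauto

lemma cst_ge'' {a b : V} (h : ¬ (b = u ∨ b = v)) : M ≤ cst G u v M a b := by
  apply cst_ge; tauto

lemma cst_bad {a b : V} (h : M + 1 ≤ cst G u v M a b) : ¬ G.Adj a b :=
  fun h' => by have := cst_adj (u := u) (v := v) (M := M) h'; omega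

/-- bad pairs -/
def BP (G : SimpleGraph V) (u v : V) (M : ℕ) (S : Finset V) (a b : V) : Prop :=
  M + 1 ≤ cst G u v M a b ∧
  ∃ L, MinL (cst G u v M) S L ∧ L.head? = some a ∧ L.getLast? = some b

lemma BP.symm {S : Finset V} {a b : V} (h : BP G u v M S a b) : BP G u v M S b a := by
  obtain ⟨h1, L, h2, h3, h4⟩ := h
  refine ⟨by rwa [cst_symm], L.reverse, h2.of_perm L.reverse_perm ?_, by simpa, by simpa⟩
  rw [cyc_reverse cst_symm]

lemma BP.not_adj {S : Finset V} {a b : V} (h : BP G u v M S a b) : ¬ G.Adj a b := cst_bad h.1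

lemma BP.mem_left {S : Finset V} {a b : V} (h : BP G u v M S a b) : a ∈ S := by
  obtain ⟨h1, L, h2, h3, h4⟩ := h
  rw [← h2.2.1, List.mem_toFinset]; exact List.mem_of_mem_head? h3

lemma move_O {S : Finset V} {P Q : List V} {y p q x : V}
    (hL : MinL (cst G u v M) S (P ++ Q))
    (hP : P.head? = some y) (hP' : P.getLast? = some p)
    (hQ : Q.head? = some q) (hQ' : Q.getLast? = some x)
    (hb : M + 1 ≤ cst G u v M y x) (hpx : G.Adj p x) (hqy : G.Adj q y)
    (hnf : ¬ ((p = u ∧ q = v) ∨ (p = v ∧ q = u))) : False := by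
  have h := hL.le_perm (L' := P ++ Q.reverse) ((List.reverse_perm Q).append_left P)
  rw [cyc, cyc, cost_append, cost_append, cost_reverse cst_symm,
    link_some hP' hQ, link_some hP' (b := x) (by simpa),
    link_some (a := x) (b := y) (by simp [hQ']) (by simp [hP]),
    link_some (a := q) (b := y) (by simp [hQ]) (by simp [hP])] at h
  have h1 := cst_adj (u := u) (v := v) (M := M) hpx
  have h2 := cst_adj (u := u) (v := v) (M := M) hqy
  have h3 := cst_ge (G := G) (M := M) hnf
  rw [cst_symm y x] at hb
  omega

lemma move_a {S : Finset V} {P Q R : List V} {y p q q' r x : V}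
    (hL : MinL (cst G u v M) S (P ++ (Q ++ R)))
    (hP : P.head? = some y) (hP' : P.getLast? = some p)
    (hQ : Q.head? = some q) (hQ' : Q.getLast? = some q')
    (hR : R.head? = some r) (hR' : R.getLast? = some x)
    (hb : M + 1 ≤ cst G u v M y x) (hpx : G.Adj p x) (hqy : G.Adj q' y)
    (hp : ¬ (p = u ∨ p = v)) (hq : ¬ (q' = u ∨ q' = v)) : BP G u v M S q r := by
  have hperm : (Q ++ (P ++ R.reverse)).Perm (P ++ (Q ++ R)) := by
    rw [← List.append_assoc, ← List.append_assoc]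
    exact (List.perm_append_comm).append (List.reverse_perm R)
  have h := hL.le_perm hperm
  have e1 : cyc (cst G u v M) (Q ++ (P ++ R.reverse)) = cost (cst G u v M) Q + cost (cst G u v M) P
    + cost (cst G u v M) R + cst G u v M q' y + cst G u v M p x + cst G u v M q r := by
    rw [cyc, cost_append, cost_append, cost_reverse cst_symm,
     link_some hQ' (b := y) (by simp [hP]), link_some hP' (b := x) (by simpa),
     link_some (a := r) (b := q) (by simp [hR]) (by simp [hQ]), cst_symm r q]
    ring
  have e2 : cyc (cst G u v M) (P ++ (Q ++ R)) = cost (cst G u v M) Q + cost (cst G u v M) P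
    + cost (cst G u v M) R + cst G u v M p q + cst G u v M q' r + cst G u v M y x := by
    rw [cyc, cost_append, cost_append, 
     link_some hP' (b := q) (by simp [hQ]), link_some hQ' (b := r) (by simpa),
     link_some (a := x) (b := y) (by simp [hR']) (by simp [hP]), cst_symm x y]
    ring
  have h1 := cst_adj (u := u) (v := v) (M := M) hpx
  have h2 := cst_adj (u := u) (v := v) (M := M) hqy
  have h3 := cst_ge' (G := G) (M := M) (b := q) hp
  have h4 := cst_ge' (G := G) (M := M) (b := r) hq
  have h5 := cst_le (G := G) (u := u) (v := v) (M := M) q r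
  have h6 := cst_le (G := G) (u := u) (v := v) (M := M) y x
  exact ⟨by omega, _, hL.of_perm hperm (by omega), by simp [hQ], by simp [hR]⟩

lemma move_b {S : Finset V} {P Q R : List V} {y p q q' r x : V}
    (hL : MinL (cst G u v M) S (P ++ (Q ++ R)))
    (hP : P.head? = some y) (hP' : P.getLast? = some p)
    (hQ : Q.head? = some q) (hQ' : Q.getLast? = some q')
    (hR : R.head? = some r) (hR' : R.getLast? = some x)
    (hb : M + 1 ≤ cst G u v M y x) (hqx : G.Adj q' x) (hqy : G.Adj q y)
    (hq : ¬ (q = u ∨ q = v)) (hq' : ¬ (q' = u ∨ q' = v)) : BP G u v M S r p := by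
  have hperm : (R ++ (Q.reverse ++ P)).Perm (P ++ (Q ++ R)) := by
    refine List.perm_append_comm.trans ?_
    rw [← List.append_assoc]
    exact List.Perm.append_right _ (List.perm_append_comm.trans ((List.reverse_perm Q).append_left _))
  have h := hL.le_perm hperm
  have e1 : cyc (cst G u v M) (R ++ (Q.reverse ++ P)) = cost (cst G u v M) Q + cost (cst G u v M) P
    + cost (cst G u v M) R + cst G u v M q y + cst G u v M q' x + cst G u v M p r := by
    rw [cyc, cost_append, cost_append, cost_reverse cst_symm,
     link_some hR' (b := q') (by simp [hQ']), link_some (a := q) (b := y) (by simpa) (by simpa),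
     link_some (a := p) (b := r) (by simp [hP']) (by simp [hR]), cst_symm x q']
    ring
  have e2 : cyc (cst G u v M) (P ++ (Q ++ R)) = cost (cst G u v M) Q + cost (cst G u v M) P
    + cost (cst G u v M) R + cst G u v M p q + cst G u v M q' r + cst G u v M y x := by
    rw [cyc, cost_append, cost_append, 
     link_some hP' (b := q) (by simp [hQ]), link_some hQ' (b := r) (by simpa),
     link_some (a := x) (b := y) (by simp [hR']) (by simp [hP]), cst_symm x y]
    ring
  have h1 := cst_adj (u := u) (v := v) (M := M) hqx
  have h2 := cst_adj (u := u) (v := v) (M := M) hqy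
  have h3 := cst_ge' (G := G) (M := M) (b := r) hq'
  have h4 := cst_ge'' (G := G) (M := M) (a := p) hq
  have h5 := cst_le (G := G) (u := u) (v := v) (M := M) p r
  have h6 := cst_le (G := G) (u := u) (v := v) (M := M) y x
  exact ⟨by rw [cst_symm]; omega, _, hL.of_perm hperm (by omega), by simp [hR], by simp [hP']⟩

end
end HL

namespace HL
variable {V : Type} {G : SimpleGraph V} {u v : V} {M : ℕ}

lemma take_facts (L : List V) (d : V) (i : ℕ) (hi : i < L.length) :
    (L.take (i+1)).getLast? = some (L.getD i d) ∧ (L.drop i).head? = some (L.getD i d) := by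
  constructor
  · rw [List.getLast?_take]; simp [hi]
  · simp [List.head?_drop, hi]

lemma idx {S : Finset V} {y x : V} (h : BP G u v M S y x) (hS : 2 ≤ S.card) : ∃ w : ℕ → V,
    w 0 = y ∧ w (S.card - 1) = x ∧
    (∀ i < S.card, w i ∈ S) ∧ (∀ i < S.card, ∀ j < S.card, w i = w j → i = j) ∧
    (Finset.range S.card).image w = S ∧
    (∀ i, i + 1 < S.card → G.Adj (w i) x → G.Adj (w (i+1)) y →
      ((w i = u ∧ w (i+1) = v) ∨ (w i = v ∧ w (i+1) = u))) ∧
    (∀ i j, i < j → j + 1 < S.card → G.Adj (w i) x → G.Adj (w j) y →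
      ¬ (w i = u ∨ w i = v) → ¬ (w j = u ∨ w j = v) → BP G u v M S (w (i+1)) (w (j+1))) ∧
    (∀ i j, j ≤ i → 1 ≤ j → i + 1 < S.card → G.Adj (w i) x → G.Adj (w j) y →
      ¬ (w i = u ∨ w i = v) → ¬ (w j = u ∨ w j = v) → BP G u v M S (w (i+1)) (w (j-1))) := by
  have h0 := h
  obtain ⟨hb, L, hL, hy, hx⟩ := h
  have hcard : S.card = L.length := by rw [← hL.2.1, List.toFinset_card_of_nodup hL.1]
  have hpos : 0 < L.length := by
    cases L with
    | nil => simp at hy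
    | cons a l => simp
  rw [hcard] at hS
  rw [hcard]
  have w0 : ∀ i (hi : i < L.length), L.getD i u = L[i] := by
    intro i hi; simp [hi]
  have e0 : L.getD 0 u = y := by
    have := (take_facts L u 0 hpos).2
    simp only [List.drop_zero] at this
    rw [hy] at this; simpa using this.symm
  have e1 : L.getD (L.length - 1) u = x := by
    have := (take_facts L u (L.length - 1) (by omega)).1
    rw [show L.length - 1 + 1 = L.length by omega, List.take_length, hx] at this
    simpa using this.symm
  have ht : ∀ i, (L.take (i+1)).head? = some y := by
    intro i; rw [List.head?_take]; simp [hy]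
  have hd : ∀ i, i < L.length → (L.drop i).getLast? = some x := by
    intro i hi; rw [List.getLast?_drop, if_neg (by omega), hx]
  have hmem : ∀ i < L.length, L.getD i u ∈ S := by
    intro i hi
    rw [w0 i hi, ← hL.2.1, List.mem_toFinset]; exact List.getElem_mem hi
  have hsplit : ∀ i j, i ≤ j → L = L.take i ++ ((L.drop i).take (j - i) ++ L.drop j) := by
    intro i j hij
    have : L.drop j = (L.drop i).drop (j - i) := by rw [List.drop_drop]; congr 1; omega
    rw [this, List.take_append_drop, List.take_append_drop]
  have mid : ∀ i j, i < j → j ≤ L.length → 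
      ((L.drop i).take (j - i)).head? = some (L.getD i u) ∧
      ((L.drop i).take (j - i)).getLast? = some (L.getD (j-1) u) := by
    intro i j hij hj
    constructor
    · rw [List.head?_take, if_neg (by omega)]; exact (take_facts L u i (by omega)).2
    · rw [List.getLast?_take, if_neg (by omega), List.getElem?_drop,
        show i + (j - i - 1) = j - 1 by omega]
      simp [show j - 1 < L.length by omega]
  refine ⟨fun i => L.getD i u, e0, e1, hmem, ?_, ?_, ?_, ?_, ?_⟩
  · intro i hi j hj hij
    simp only [w0 i hi, w0 j hj] at hij
    exact (hL.1.getElem_inj_iff).1 hij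
  · ext a
    rw [← hL.2.1]
    simp only [Finset.mem_image, Finset.mem_range, List.mem_toFinset]
    constructor
    · rintro ⟨i, hi, rfl⟩
      rw [w0 i hi]; exact List.getElem_mem hi
    · intro ha
      obtain ⟨i, hi, rfl⟩ := List.getElem_of_mem ha
      exact ⟨i, hi, w0 i hi⟩
  · intro i hi h1 h2
    by_contra hf
    rw [← List.take_append_drop (i+1) L] at hL
    exact move_O hL (ht i) (take_facts L u i (by omega)).1 (take_facts L u (i+1) hi).2
      (hd _ hi) hb h1 h2 hf
  · intro i j hij hj h1 h2 h3 h4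
    rw [hsplit (i+1) (j+1) (by omega)] at hL
    have := mid (i+1) (j+1) (by omega) (by omega)
    exact move_a hL (ht i) (take_facts L u i (by omega)).1 this.1 this.2
      (take_facts L u (j+1) hj).2 (hd _ hj) hb h1 h2 h3 h4
  · intro i j hij hj hi h1 h2 h3 h4
    rw [hsplit j (i+1) (by omega)] at hL
    have := mid j (i+1) (by omega) (by omega)
    have hj1 : j - 1 + 1 = j := by omega
    have t1 := ht (j-1)
    have t2 := (take_facts L u (j-1) (by omega)).1
    rw [hj1] at t1 t2
    exact move_b hL t1 t2 this.1 this.2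
      (take_facts L u (i+1) hi).2 (hd _ hi) hb h1 h2 h4 h3

lemma cost_ge_or (L : List V) : (L.length - 1) * M ≤ cost (cst G u v M) L ∨
    ∃ P Q a b, L = P ++ Q ∧ P.getLast? = some a ∧ Q.head? = some b ∧
      ((a = u ∧ b = v) ∨ (a = v ∧ b = u)) := by
  induction L with
  | nil => left; simp
  | cons a l ih =>
    rcases ih with ih | ⟨P, Q, a', b, rfl, h2, h3, h4⟩
    · cases l with
      | nil => left; simp
      | cons b l =>
        by_cases hf : ((a = u ∧ b = v) ∨ (a = v ∧ b = u))
        · right; exact ⟨[a], b :: l, a, b, rfl, by simp, by simp, hf⟩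
        · left
          have := cst_ge (G := G) (M := M) hf
          rw [cost, link_some (a := a) (b := b) (by simp) (by simp)]
          simp only [List.length_cons, Nat.add_sub_cancel] at ih ⊢
          linarith [add_mul l.length 1 M]
    · right; refine ⟨a :: P, Q, a', b, rfl, ?_, h3, h4⟩
      rw [List.getLast?_cons, h2]; rfl

lemma cost_le (L : List V) : cost (cst G u v M) L ≤ (L.length - 1) * (M + 1) := by
  induction L with
  | nil => simp [cost]
  | cons a l ih =>
    cases l with
    | nil => simp [cost, link]
    | cons b l =>
      have := cst_le (G := G) (u := u) (v := v) (M := M) a b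
      rw [cost, link_some (a := a) (b := b) (by simp) (by simp)]
      simp only [List.length_cons, Nat.add_sub_cancel] at ih ⊢
      linarith [add_mul l.length 1 (M+1)]

lemma chain_or (R : V → V → Prop) (L : List V) : L.IsChain R ∨
    ∃ P Q a b, L = P ++ Q ∧ P.getLast? = some a ∧ Q.head? = some b ∧ ¬ R a b := by
  induction L with
  | nil => left; simp
  | cons a l ih =>
    rcases ih with ih | ⟨P, Q, a', b, rfl, h2, h3, h4⟩
    · cases l with
      | nil => left; simp
      | cons b l =>
        by_cases hf : R a b
        · left; exact List.isChain_cons_cons.2 ⟨hf, ih⟩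
        · right; exact ⟨[a], b :: l, a, b, rfl, by simp, by simp, hf⟩
    · right; refine ⟨a :: P, Q, a', b, rfl, ?_, h3, h4⟩
      rw [List.getLast?_cons, h2]; rfl

def HamP (G : SimpleGraph V) (S : Finset V) (u v : V) : Prop :=
  ∃ L : List V, L.Nodup ∧ L.toFinset = S ∧ L.head? = some u ∧ L.getLast? = some v ∧ L.IsChain G.Adj

lemma min_fixed {S : Finset V} (hu : u ∈ S) (hv : v ∈ S) (huv : u ≠ v) :
    ∃ L, MinL (cst G u v (S.card + 1)) S L ∧ L.head? = some u ∧ L.getLast? = some v := by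
  obtain ⟨L, hL⟩ := exists_minL (cst G u v (S.card + 1)) S
  have hcard : S.card = L.length := by rw [← hL.2.1, List.toFinset_card_of_nodup hL.1]
  set M := S.card + 1 with hM
  have h2 : 2 ≤ S.card := by
    have : ({u, v} : Finset V) ⊆ S := by
      intro x; simp; rintro (rfl | rfl) <;> assumption
    have := Finset.card_le_card this
    rwa [Finset.card_pair huv] at this
  have key : ∃ P Q a b, (P ++ Q).Perm L ∧ cyc (cst G u v M) (P ++ Q) ≤ cyc (cst G u v M) L ∧
      (P ++ Q).getLast? = some a ∧ (P ++ Q).head? = some b ∧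
      ((a = u ∧ b = v) ∨ (a = v ∧ b = u)) := by
    rcases cost_ge_or (G := G) (u := u) (v := v) (M := M) L with h | ⟨P, Q, a, b, rfl, ha, hb, hab⟩
    · obtain ⟨a, ha⟩ : ∃ a, L.getLast? = some a := by
        cases h : L.getLast? with
        | none => rw [List.getLast?_eq_none_iff] at h; rw [h] at hcard; simp only [List.length_nil] at hcard; omega
        | some a => exact ⟨a, rfl⟩
      obtain ⟨b, hb⟩ : ∃ a, L.head? = some a := by
        cases h : L.head? with
        | none => rw [List.head?_eq_none_iff] at h; rw [h] at hcard; simp only [List.length_nil] at hcard; omega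
        | some a => exact ⟨a, rfl⟩
      refine ⟨L, [], a, b, by simp, by simp, by simpa, by simpa, ?_⟩
      by_contra hf
      have h3 := cst_ge (G := G) (M := M) hf
      set r := (S.erase u).erase v with hr
      have hrc : r.card + 2 = S.card := by
        rw [hr, Finset.card_erase_of_mem (by simp [huv.symm, hv]), Finset.card_erase_of_mem hu]
        omega
      have h4 := hL.2.2 (u :: v :: r.toList) (by simp [hr, Finset.nodup_toList, huv]) (by
        simp [hr, Finset.insert_erase, huv.symm, hu, hv])
      have e1 : cyc (cst G u v M) (u :: v :: r.toList) ≤ (S.card - 1) * (M + 1) := by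
        obtain ⟨z, hz⟩ : ∃ a, (u :: v :: r.toList).getLast? = some a := by
          simp [List.getLast?_cons]
        rw [cyc, cost, link_some (a := u) (b := v) (by simp) (by simp),
          link_some (a := z) (b := u) hz (by simp)]
        have h5 := cost_le (G := G) (u := u) (v := v) (M := M) (v :: r.toList)
        have h6 := cst_le (G := G) (u := u) (v := v) (M := M) z u
        have h7 : cst G u v M u v = 0 := by simp [cst]
        simp only [List.length_cons, Finset.length_toList, Nat.add_sub_cancel] at h5
        rw [h7, show S.card - 1 = r.card + 1 by omega]
        linarith [add_mul r.card 1 (M+1)]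
      rw [cyc, link_some ha hb] at h4
      rw [← hcard] at h
      have h8 : (S.card - 1) * (M+1) < (S.card - 1) * M + M := by
        rw [mul_add]; omega
      omega
    · refine ⟨Q, P, a, b, List.perm_append_comm, (cyc_append_comm _ _ _).le, ?_, ?_, hab⟩
      · rw [List.getLast?_append, ha]; rfl
      · rw [List.head?_append, hb]; rfl
  obtain ⟨P, Q, a, b, h1, h2, h3, h4, h5 | h5⟩ := key
  · refine ⟨(P ++ Q).reverse, hL.of_perm ((List.reverse_perm _).trans h1) ?_, ?_, ?_⟩
    · rwa [cyc_reverse cst_symm]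
    · rw [List.head?_reverse, h3, h5.1]
    · rw [List.getLast?_reverse, h4, h5.2]
  · exact ⟨P ++ Q, hL.of_perm h1 h2, by rw [h4, h5.2], by rw [h3, h5.1]⟩

lemma head_eq_last {P : List V} (hP : P.Nodup) {a : V} (h1 : P.head? = some a)
    (h2 : P.getLast? = some a) : P.length = 1 := by
  rcases P with _ | ⟨b, _ | ⟨c, l⟩⟩
  · simp at h1
  · simp
  · simp at h1
    subst h1
    have : b ∈ c :: l := by
      rw [List.getLast?_cons_cons] at h2
      exact List.mem_of_getLast? h2
    simp only [List.nodup_cons] at hP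
    exact absurd this hP.1

lemma ham_or {S : Finset V} (hu : u ∈ S) (hv : v ∈ S) (huv : u ≠ v) (h3 : 3 ≤ S.card) :
    HamP G S u v ∨ ∃ y x, BP G u v (S.card + 1) S y x := by
  obtain ⟨L, hL, h1, h2⟩ := min_fixed (G := G) hu hv huv
  have hcard : S.card = L.length := by rw [← hL.2.1, List.toFinset_card_of_nodup hL.1]
  rcases chain_or G.Adj L with h | ⟨P, Q, p, q, rfl, hp, hq, hpq⟩
  · exact Or.inl ⟨L, hL.1, hL.2.1, h1, h2, h⟩
  · right
    have hnd := List.nodup_append.1 hL.1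
    have hP : P.head? = some u := by
      cases P with
      | nil => simp at hp
      | cons a l => simpa using h1
    have hQ : Q.getLast? = some v := by
      rcases List.eq_nil_or_concat Q with rfl | ⟨l, a, rfl⟩
      · simp at hq
      · simpa using h2
    refine ⟨q, p, ?_, Q ++ P, hL.of_perm List.perm_append_comm (cyc_append_comm _ _ _).le, ?_, ?_⟩
    · have hqp : ¬ G.Adj q p := fun h => hpq h.symm
      rw [cst, if_neg, if_neg hqp]
      rintro (⟨rfl, rfl⟩ | ⟨rfl, rfl⟩)
      · exact hnd.2.2 _ (List.mem_of_mem_head? hP) _ (List.mem_of_mem_head? hq) rfl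
      · have := head_eq_last hnd.1 hP hp
        have := head_eq_last hnd.2.1 hq hQ
        rw [hcard, List.length_append] at h3
        omega
    · rw [List.head?_append, hq]; rfl
    · rw [List.getLast?_append, hp]; rfl

end HL

namespace HL
variable {V : Type} {G : SimpleGraph V} {u v : V} {M : ℕ}

noncomputable def dg (G : SimpleGraph V) (x : V) (S : Finset V) : ℕ := (S.filter (G.Adj x)).card

lemma card_idx {S : Finset V} {w : ℕ → V}
    (hinj : ∀ i < S.card, ∀ j < S.card, w i = w j → i = j)
    (him : (Finset.range S.card).image w = S) (p : V → Prop) :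
    ((Finset.range S.card).filter (fun i => p (w i))).card = (S.filter p).card := by
  rw [← Finset.card_image_of_injOn (f := w)]
  · congr 1
    ext a
    simp only [Finset.mem_image, Finset.mem_filter, Finset.mem_range]
    constructor
    · rintro ⟨i, ⟨hi, hp⟩, rfl⟩
      refine ⟨?_, hp⟩
      rw [← him]; exact Finset.mem_image_of_mem _ (Finset.mem_range.2 hi)
    · rintro ⟨ha, hp⟩
      rw [← him] at ha
      obtain ⟨i, hi, rfl⟩ := Finset.mem_image.1 ha
      exact ⟨i, ⟨Finset.mem_range.1 hi, hp⟩, rfl⟩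
  · intro i hi j hj hij
    simp only [Finset.coe_filter, Finset.mem_range, Set.mem_ofPred_eq] at hi hj
    exact hinj i hi.1 j hj.1 hij

lemma bp_deg {S : Finset V} {y x : V} (h : BP G u v M S y x) (hS : 2 ≤ S.card) :
    dg G y S + dg G x S ≤ S.card := by
  obtain ⟨w, w0, w1, hmem, hinj, him, hO, -, -⟩ := idx h hS
  have hxy := h.not_adj
  rw [dg, dg, ← card_idx hinj him, ← card_idx hinj him]
  set n := S.card
  set A := (Finset.range n).filter (fun i => G.Adj x (w i)) with hA
  set B := (Finset.range n).filter (fun i => G.Adj y (w i)) with hB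
  have hAi : (A.image (· + 1)).card = A.card := Finset.card_image_of_injective _ (fun a b => by simp)
  have hsub : A.image (· + 1) ∪ B ⊆ Finset.Ico 1 n := by
    intro i hi
    simp only [Finset.mem_union, Finset.mem_image, hA, hB, Finset.mem_filter, Finset.mem_range] at hi
    rw [Finset.mem_Ico]
    rcases hi with ⟨j, ⟨hj, hj'⟩, rfl⟩ | ⟨hj, hj'⟩
    · refine ⟨by omega, ?_⟩
      by_contra hc
      rw [show j = n - 1 by omega, w1] at hj'
      exact G.irrefl hj'
    · refine ⟨?_, hj⟩
      by_contra hc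
      rw [show i = 0 by omega, w0] at hj'
      exact G.irrefl hj'
  have hcap : (A.image (· + 1) ∩ B).card ≤ 1 := by
    rw [Finset.card_le_one]
    have hfix : ∀ i ∈ A.image (· + 1) ∩ B, 1 ≤ i ∧ i < n ∧ ((w (i-1) = u ∧ w i = v) ∨ (w (i-1) = v ∧ w i = u)) := by
      intro i hi
      simp only [Finset.mem_inter, Finset.mem_image, hA, hB, Finset.mem_filter, Finset.mem_range] at hi
      obtain ⟨⟨j, ⟨hj, hj'⟩, rfl⟩, hi1, hi2⟩ := hi
      exact ⟨by omega, hi1, hO j hi1 hj'.symm hi2.symm⟩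
    intro i hi j hj
    obtain ⟨i1, i2, i3⟩ := hfix i hi
    obtain ⟨j1, j2, j3⟩ := hfix j hj
    rcases i3 with ⟨a, b⟩ | ⟨a, b⟩ <;> rcases j3 with ⟨c, d⟩ | ⟨c, d⟩
    · exact hinj _ i2 _ j2 (b.trans d.symm)
    · have := hinj (i-1) (by omega) j (by omega) (a.trans d.symm)
      have := hinj i (by omega) (j-1) (by omega) (b.trans c.symm)
      omega
    · have := hinj (i-1) (by omega) j (by omega) (a.trans d.symm)
      have := hinj i (by omega) (j-1) (by omega) (b.trans c.symm)
      omega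
    · exact hinj _ i2 _ j2 (b.trans d.symm)
  have h1 := Finset.card_le_card hsub
  have h2 := Finset.card_union_add_card_inter (A.image (· + 1)) B
  simp only [Nat.card_Ico] at h1
  omega

section comb
variable {n ε e : ℕ} {A B : Finset ℕ} {R : ℕ → ℕ → Prop}

def FF (B : Finset ℕ) (a : ℕ) : Finset ℕ :=
  (B.filter (fun b => a < b)).image (· + 1) ∪ (B.filter (fun b => b ≤ a)).image (· - 1)

lemma FF_card (hB : ∀ b ∈ B, 1 ≤ b) (a : ℕ) : (FF B a).card = B.card := by
  rw [FF, Finset.card_union_of_disjoint, Finset.card_image_of_injective _ (fun a b => by simp),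
    Finset.card_image_of_injOn]
  · rw [← Finset.card_filter_add_card_filter_not (s := B) (fun b => a < b)]
    simp
  · intro i hi j hj
    simp only [Finset.coe_filter, Set.mem_ofPred_eq] at hi hj
    have := hB i hi.1
    have := hB j hj.1
    simp only
    omega
  · rw [Finset.disjoint_left]
    intro i hi hj
    simp only [Finset.mem_image, Finset.mem_filter] at hi hj
    obtain ⟨b, ⟨hb1, hb2⟩, rfl⟩ := hi
    obtain ⟨c, ⟨hc1, hc2⟩, hc3⟩ := hj
    omega

lemma miss_FF (hA : ∀ a ∈ A, 1 ≤ a ∧ a + 1 < n) (hB : ∀ b ∈ B, 1 ≤ b ∧ b + 1 < n)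
    (ha : ∀ i ∈ A, ∀ j ∈ B, i < j → ¬ R (i+1) (j+1))
    (hb : ∀ i ∈ A, ∀ j ∈ B, j ≤ i → ¬ R (i+1) (j-1))
    (hdeg : ∀ i < n, n ≤ 2 * ((Finset.range n).filter (R i)).card + ε)
    (hBc : n ≤ 2 * B.card + ε) {a : ℕ} (haA : a ∈ A) :
    ((Finset.range n).filter (fun t => t ∉ FF B a ∧ ¬ R (a+1) t)).card ≤ ε := by
  have h1 := FF_card (fun b hb => (hB b hb).1) a
  have h2 := hdeg (a+1) (hA a haA).2
  set N := (Finset.range n).filter (R (a+1))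
  set K := (Finset.range n).filter (fun t => t ∉ FF B a ∧ ¬ R (a+1) t)
  have d1 : Disjoint (FF B a) N := by
    rw [Finset.disjoint_left]
    intro t ht htN
    simp only [FF, Finset.mem_union, Finset.mem_image, Finset.mem_filter] at ht
    have htN := (Finset.mem_filter.1 htN).2
    rcases ht with ⟨b, ⟨h3, h4⟩, rfl⟩ | ⟨b, ⟨h3, h4⟩, rfl⟩
    · exact ha a haA b h3 h4 htN
    · exact hb a haA b h3 h4 htN
  have d2 : Disjoint (FF B a ∪ N) K := by
    rw [Finset.disjoint_left]
    intro t ht htN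
    have htN := (Finset.mem_filter.1 htN).2
    rcases Finset.mem_union.1 ht with h | h
    · exact htN.1 h
    · exact htN.2 (Finset.mem_filter.1 h).2
  have hsub : (FF B a ∪ N) ∪ K ⊆ Finset.range n := by
    refine Finset.union_subset (Finset.union_subset ?_ (Finset.filter_subset _ _)) (Finset.filter_subset _ _)
    intro t ht
    simp only [FF, Finset.mem_union, Finset.mem_image, Finset.mem_filter] at ht
    rw [Finset.mem_range]
    rcases ht with ⟨b, ⟨h3, h4⟩, rfl⟩ | ⟨b, ⟨h3, h4⟩, rfl⟩
    · exact (hB b h3).2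
    · have := (hB b h3).2; omega
  have h5 := Finset.card_le_card hsub
  rw [Finset.card_union_of_disjoint d2, Finset.card_union_of_disjoint d1, Finset.card_range] at h5
  omega

lemma E_card (hA : ∀ a ∈ A, 1 ≤ a ∧ a + 1 < n) (hB : ∀ b ∈ B, 1 ≤ b ∧ b + 1 < n)
    (h0 : ∀ i ∈ A, i + 1 ∉ B) (hAc : n ≤ 2 * A.card + ε) (hBc : n ≤ 2 * B.card + ε) :
    ((Finset.range n).filter (fun t => (∀ a ∈ A, a + 1 ≠ t) ∧ t ∉ B)).card ≤ ε := by
  set E := (Finset.range n).filter (fun t => (∀ a ∈ A, a + 1 ≠ t) ∧ t ∉ B)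
  have hAi : (A.image (· + 1)).card = A.card := Finset.card_image_of_injective _ (fun a b => by simp)
  have d1 : Disjoint (A.image (· + 1)) B := by
    rw [Finset.disjoint_left]
    intro t ht
    obtain ⟨a, ha, rfl⟩ := Finset.mem_image.1 ht
    exact h0 a ha
  have d2 : Disjoint (A.image (· + 1) ∪ B) E := by
    rw [Finset.disjoint_left]
    intro t ht htN
    have htN := (Finset.mem_filter.1 htN).2
    rcases Finset.mem_union.1 ht with h | h
    · obtain ⟨a, ha, rfl⟩ := Finset.mem_image.1 h
      exact htN.1 a ha rfl
    · exact htN.2 h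
  have hsub : (A.image (· + 1) ∪ B) ∪ E ⊆ Finset.range n := by
    refine Finset.union_subset (Finset.union_subset ?_ ?_) (Finset.filter_subset _ _)
    · intro t ht
      obtain ⟨a, ha, rfl⟩ := Finset.mem_image.1 ht
      exact Finset.mem_range.2 (hA a ha).2
    · intro t ht
      have := hB t ht
      exact Finset.mem_range.2 (by omega)
  have h5 := Finset.card_le_card hsub
  rw [Finset.card_union_of_disjoint d2, Finset.card_union_of_disjoint d1, Finset.card_range] at h5
  omega

lemma card_le_of_map {s t : Finset ℕ} {b : ℕ} (f : ℕ → ℕ) (ht : t.card ≤ b)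
    (h1 : ∀ i ∈ s, f i ∈ t) (h2 : ∀ i ∈ s, ∀ j ∈ s, f i = f j → i = j) : s.card ≤ b :=
  (Finset.card_le_card_of_injOn f h1 (fun i hi j hj => h2 i hi j hj)).trans ht

lemma comb1 (hA : ∀ a ∈ A, 1 ≤ a ∧ a + 1 < n) (hB : ∀ b ∈ B, 1 ≤ b ∧ b + 1 < n)
    (h0 : ∀ i ∈ A, i + 1 ∉ B) (hAc : n ≤ 2 * A.card + ε) (hBc : n ≤ 2 * B.card + ε)
    (hR : ∀ i j, R i j → R j i)
    (ha : ∀ i ∈ A, ∀ j ∈ B, i < j → ¬ R (i+1) (j+1))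
    (hb : ∀ i ∈ A, ∀ j ∈ B, j ≤ i → ¬ R (i+1) (j-1))
    (hdeg : ∀ i < n, n ≤ 2 * ((Finset.range n).filter (R i)).card + ε) :
    (A ∩ B).card ≤ ε + 1 ∨ (A \ B).card ≤ 3 * ε + 1 := by
  have step1 : ∀ j ∈ A ∩ B, (A.filter (fun i => i < j ∧ i + 2 ∉ B)).card ≤ ε := by
    intro j hj
    rw [Finset.mem_inter] at hj
    refine card_le_of_map (· + 1) (miss_FF hA hB ha hb hdeg hBc hj.1) ?_ (by simp)
    intro i hi
    simp only [Finset.mem_filter] at hi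
    obtain ⟨hi1, hi2, hi3⟩ := hi
    simp only [Finset.mem_filter, Finset.mem_range]
    refine ⟨(hA i hi1).2, ?_, fun h => ha i hi1 j hj.2 hi2 (hR _ _ h)⟩
    simp only [FF, Finset.mem_union, Finset.mem_image, Finset.mem_filter]
    rintro (⟨b, ⟨h3, h4⟩, h5⟩ | ⟨b, ⟨h3, h4⟩, h5⟩)
    · omega
    · rw [show b = i + 2 by omega] at h3; exact hi3 h3
  by_contra hcon
  push Not at hcon
  obtain ⟨hc1, hc2⟩ := hcon
  have hne : (A ∩ B).Nonempty := Finset.card_pos.1 (by omega)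
  set m := (A ∩ B).max' hne
  have hm := (A ∩ B).max'_mem hne
  obtain ⟨j0, hj0, hj02⟩ : ∃ j0 ∈ A ∩ B, j0 + 2 ∈ B := by
    by_contra hno
    push Not at hno
    have h1 := step1 m hm
    have h2 : (A ∩ B).erase m ⊆ A.filter (fun i => i < m ∧ i + 2 ∉ B) := by
      intro i hi
      rw [Finset.mem_erase] at hi
      rw [Finset.mem_filter]
      refine ⟨(Finset.mem_inter.1 hi.2).1, ?_, hno i hi.2⟩
      exact lt_of_le_of_ne ((A ∩ B).le_max' i hi.2) hi.1
    have h3 := Finset.card_le_card h2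
    rw [Finset.card_erase_of_mem hm] at h3
    omega
  have hj0A := (Finset.mem_inter.1 hj0).1
  have hj0B := (Finset.mem_inter.1 hj0).2
  have p1 : ((A \ B).filter (fun i => j0 + 2 ≤ i)).card ≤ ε := by
    refine card_le_of_map (· + 1) (miss_FF hA hB ha hb hdeg hBc hj0A) ?_ (by simp)
    intro i hi
    simp only [Finset.mem_filter, Finset.mem_sdiff] at hi
    obtain ⟨⟨hi1, hi2⟩, hi3⟩ := hi
    simp only [Finset.mem_filter, Finset.mem_range]
    refine ⟨(hA i hi1).2, ?_, fun h => hb i hi1 (j0+2) hj02 hi3 (hR _ _ ?_)⟩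
    · simp only [FF, Finset.mem_union, Finset.mem_image, Finset.mem_filter]
      rintro (⟨b, ⟨h3, h4⟩, h5⟩ | ⟨b, ⟨h3, h4⟩, h5⟩)
      · rw [show b = i by omega] at h3; exact hi2 h3
      · omega
    · simpa using h
  have p2 : ((A \ B).filter (fun i => i < j0 ∧ i - 1 ∈ A)).card ≤ ε := by
    refine card_le_of_map (· - 1) (step1 j0 hj0) ?_ ?_
    · intro i hi
      simp only [Finset.mem_filter, Finset.mem_sdiff] at hi ⊢
      obtain ⟨⟨hi1, hi2⟩, hi3, hi4⟩ := hi
      have := hA i hi1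
      refine ⟨hi4, by omega, ?_⟩
      rw [show i - 1 + 2 = i + 1 by omega]; exact h0 i hi1
    · intro i hi j hj
      simp only [Finset.mem_filter, Finset.mem_sdiff] at hi hj ⊢
      have := hA i hi.1.1
      have := hA j hj.1.1
      omega
  have p3 : ((A \ B).filter (fun i => i < j0 ∧ i - 1 ∉ A)).card ≤ ε := by
    refine card_le_of_map id (E_card hA hB h0 hAc hBc) ?_ (by simp)
    intro i hi
    simp only [Finset.mem_filter, Finset.mem_sdiff, Finset.mem_range, id] at hi ⊢
    obtain ⟨⟨hi1, hi2⟩, hi3, hi4⟩ := hi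
    have := hA i hi1
    refine ⟨by omega, ?_, hi2⟩
    rintro a haA rfl
    exact hi4 (by simpa using haA)
  have hsub : A \ B ⊆ ((A \ B).filter (fun i => j0 + 2 ≤ i)) ∪ (((A \ B).filter (fun i => i < j0 ∧ i - 1 ∈ A)) ∪
     (((A \ B).filter (fun i => i < j0 ∧ i - 1 ∉ A)) ∪ {j0 + 1})) := by
    intro i hi
    simp only [Finset.mem_union, Finset.mem_filter, hi, true_and, Finset.mem_singleton]
    have : i ≠ j0 := by
      rintro rfl
      exact (Finset.mem_sdiff.1 hi).2 hj0B
    by_cases h1 : i - 1 ∈ A <;> simp [h1] <;> omega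
  have h1 := Finset.card_le_card hsub
  have h2 := Finset.card_union_le ((A \ B).filter (fun i => j0 + 2 ≤ i)) (((A \ B).filter (fun i => i < j0 ∧ i - 1 ∈ A)) ∪
     (((A \ B).filter (fun i => i < j0 ∧ i - 1 ∉ A)) ∪ {j0 + 1}))
  have h3 := Finset.card_union_le (((A \ B).filter (fun i => i < j0 ∧ i - 1 ∈ A))) 
     (((A \ B).filter (fun i => i < j0 ∧ i - 1 ∉ A)) ∪ {j0 + 1})
  have h4 := Finset.card_union_le (((A \ B).filter (fun i => i < j0 ∧ i - 1 ∉ A))) {j0 + 1}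
  rw [Finset.card_singleton] at h4
  omega

lemma comb2 (hA : ∀ a ∈ A, 1 ≤ a ∧ a + 1 < n) (hB : ∀ b ∈ B, 1 ≤ b ∧ b + 1 < n)
    (h0 : ∀ i ∈ A, i + 1 ∉ B) (hAc : n ≤ 2 * A.card + ε) (hBc : n ≤ 2 * B.card + ε)
    (ha : ∀ i ∈ A, ∀ j ∈ B, i < j → ¬ R (i+1) (j+1))
    (hb : ∀ i ∈ A, ∀ j ∈ B, j ≤ i → ¬ R (i+1) (j-1)) (hs : (A ∩ B).card ≤ ε + 1) :
    ∀ a ∈ A, (B.filter (R (a+1))).card ≤ 4 * ε + 4 := by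
  intro a haA
  have q1 : (B.filter (fun b => b + 1 ∉ B)).card ≤ 2 * ε + 1 := by
    have h1 : (B.filter (fun b => b + 1 ∉ B ∧ b ∉ A)).card ≤ ε := by
      refine card_le_of_map (· + 1) (E_card hA hB h0 hAc hBc) ?_ (by simp)
      intro i hi
      simp only [Finset.mem_filter, Finset.mem_range] at hi ⊢
      obtain ⟨hi1, hi2, hi3⟩ := hi
      refine ⟨(hB i hi1).2, ?_, hi2⟩
      intro c hc hci
      rw [show c = i by omega] at hc; exact hi3 hc
    have h2 : B.filter (fun b => b + 1 ∉ B) ⊆ (B.filter (fun b => b + 1 ∉ B ∧ b ∉ A)) ∪ (A ∩ B) := by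
      intro i hi
      simp only [Finset.mem_filter, Finset.mem_union, Finset.mem_inter] at hi ⊢
      tauto
    have h3 := Finset.card_le_card h2
    have h4 := Finset.card_union_le (B.filter (fun b => b + 1 ∉ B ∧ b ∉ A)) (A ∩ B)
    omega
  have q2 : (B.filter (fun b => b - 1 ∉ B)).card ≤ 2 * ε + 1 := by
    have h1 := Finset.card_filter_add_card_filter_not (s := B) (fun b => b + 1 ∈ B)
    have h2 := Finset.card_filter_add_card_filter_not (s := B) (fun b => b - 1 ∈ B)
    have h3 : (B.filter (fun b => b + 1 ∈ B)).card ≤ (B.filter (fun b => b - 1 ∈ B)).card := by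
      refine card_le_of_map (· + 1) le_rfl ?_ (by simp)
      intro i hi
      simp only [Finset.mem_filter] at hi ⊢
      exact ⟨hi.2, by simpa using hi.1⟩
    omega
  have hsub : B.filter (R (a+1)) ⊆ (B.filter (fun b => b + 1 ∉ B)) ∪ ((B.filter (fun b => b - 1 ∉ B)) ∪ {a, a+1}) := by
    intro t ht
    simp only [Finset.mem_filter] at ht
    obtain ⟨ht, htR⟩ := ht
    simp only [Finset.mem_union, Finset.mem_filter, ht, true_and, Finset.mem_insert, Finset.mem_singleton]
    have := (hB t ht).1
    by_contra hc
    push Not at hc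
    obtain ⟨c1, c2, c3, c4⟩ := hc
    rcases Nat.lt_or_ge t a with h | h
    · have := hb a haA (t+1) c1 (by omega)
      exact this (by simpa using htR)
    · have := ha a haA (t-1) c2 (by omega)
      rw [show t - 1 + 1 = t by omega] at this
      exact this htR
  have h1 := Finset.card_le_card hsub
  have h2 := Finset.card_union_le (B.filter (fun b => b + 1 ∉ B)) ((B.filter (fun b => b - 1 ∉ B)) ∪ {a, a+1})
  have h3 := Finset.card_union_le (B.filter (fun b => b - 1 ∉ B)) {a, a+1}
  have h4 : ({a, a+1} : Finset ℕ).card ≤ 2 := Finset.card_le_two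
  omega
end comb

end HL

namespace HL
variable {V : Type} {G : SimpleGraph V} {u v : V} {M : ℕ}

noncomputable def nb (G : SimpleGraph V) (u v : V) (n : ℕ) (w : ℕ → V) (x : V) : Finset ℕ :=
  (Finset.range n).filter (fun i => G.Adj x (w i) ∧ ¬ (w i = u ∨ w i = v))

lemma nb_card {S : Finset V} {w : ℕ → V}
    (hinj : ∀ i < S.card, ∀ j < S.card, w i = w j → i = j)
    (him : (Finset.range S.card).image w = S) (x : V) :
    dg G x S ≤ (nb G u v S.card w x).card + 2 := by
  have h0 : (nb G u v S.card w x).card = (S.filter (fun z => G.Adj x z ∧ ¬ (z = u ∨ z = v))).card := by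
    rw [nb]; convert card_idx hinj him (fun z => G.Adj x z ∧ ¬ (z = u ∨ z = v))
  rw [h0, dg]
  have : S.filter (G.Adj x) ⊆ (S.filter (fun z => G.Adj x z ∧ ¬ (z = u ∨ z = v))) ∪ {u, v} := by
    intro z hz
    simp only [Finset.mem_filter, Finset.mem_union, Finset.mem_insert, Finset.mem_singleton] at hz ⊢
    tauto
  have h1 := Finset.card_le_card this
  have h2 := Finset.card_union_le (S.filter (fun z => G.Adj x z ∧ ¬ (z = u ∨ z = v))) {u, v}
  have h3 : ({u, v} : Finset V).card ≤ 2 := Finset.card_le_two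
  omega

lemma idx2 {S : Finset V} {y x : V} (h : BP G u v M S y x) (hS : 2 ≤ S.card) : ∃ w : ℕ → V,
    (∀ i < S.card, w i ∈ S) ∧ (∀ i < S.card, ∀ j < S.card, w i = w j → i = j) ∧
    (Finset.range S.card).image w = S ∧
    (∀ a ∈ nb G u v S.card w x, 1 ≤ a ∧ a + 1 < S.card) ∧
    (∀ a ∈ nb G u v S.card w y, 1 ≤ a ∧ a + 1 < S.card) ∧
    (∀ i ∈ nb G u v S.card w x, i + 1 ∉ nb G u v S.card w y) ∧
    (∀ i ∈ nb G u v S.card w x, ∀ j ∈ nb G u v S.card w y, i < j →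
      BP G u v M S (w (i+1)) (w (j+1))) ∧
    (∀ i ∈ nb G u v S.card w x, ∀ j ∈ nb G u v S.card w y, j ≤ i →
      BP G u v M S (w (i+1)) (w (j-1))) := by
  obtain ⟨w, w0, w1, hmem, hinj, him, hO, h1, h2⟩ := idx h hS
  have hyx := h.not_adj
  have pA : ∀ a ∈ nb G u v S.card w x, 1 ≤ a ∧ a + 1 < S.card := by
    intro a ha
    simp only [nb, Finset.mem_filter, Finset.mem_range] at ha
    constructor
    · by_contra hc
      rw [show a = 0 by omega, w0] at ha
      exact hyx ha.2.1.symm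
    · by_contra hc
      rw [show a = S.card - 1 by omega, w1] at ha
      exact G.irrefl ha.2.1
  have pB : ∀ a ∈ nb G u v S.card w y, 1 ≤ a ∧ a + 1 < S.card := by
    intro a ha
    simp only [nb, Finset.mem_filter, Finset.mem_range] at ha
    constructor
    · by_contra hc
      rw [show a = 0 by omega, w0] at ha
      exact G.irrefl ha.2.1
    · by_contra hc
      rw [show a = S.card - 1 by omega, w1] at ha
      exact hyx ha.2.1
  refine ⟨w, hmem, hinj, him, pA, pB, ?_, ?_, ?_⟩
  · intro i hi hj
    have := pA i hi
    simp only [nb, Finset.mem_filter, Finset.mem_range] at hi hj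
    have := hO i this.2 hi.2.1.symm hj.2.1.symm
    tauto
  · intro i hi j hj hij
    have := pB j hj
    simp only [nb, Finset.mem_filter, Finset.mem_range] at hi hj
    exact h1 i j hij this.2 hi.2.1.symm hj.2.1.symm hi.2.2 hj.2.2
  · intro i hi j hj hij
    have := pB j hj
    have := pA i hi
    simp only [nb, Finset.mem_filter, Finset.mem_range] at hi hj
    exact h2 i j hij (by omega) this.2 hi.2.1.symm hj.2.1.symm hi.2.2 hj.2.2

/-- near cliques are Hamilton-connected -/
lemma near_clique {S X : Finset V} {m : ℕ} (hu : u ∈ S) (hv : v ∈ S) (huv : u ≠ v) (hX : X ⊆ S)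
    (hdeg : ∀ a ∈ X, ∀ b ∈ X, S.card < dg G a S + dg G b S) (hm : (S \ X).card ≤ m)
    (hmin : ∀ x ∈ S, 2 * m + 3 ≤ dg G x S) : HamP G S u v := by
  have hS : 3 ≤ S.card := by
    have := hmin u hu
    have h2 : dg G u S ≤ S.card := Finset.card_filter_le _ _
    omega
  rcases ham_or (G := G) hu hv huv hS with h | ⟨y, x, hbp⟩
  · exact h
  exfalso
  obtain ⟨w, hmem, hinj, him, hA, hB, h0, ha, hb⟩ := idx2 hbp (by omega)
  have cA := nb_card (G := G) (u := u) (v := v) hinj him x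
  have cB := nb_card (G := G) (u := u) (v := v) hinj him y
  have dA := hmin x hbp.symm.mem_left
  have dB := hmin y hbp.mem_left
  set A := nb G u v S.card w x
  set B := nb G u v S.card w y
  have bad : ((Finset.range S.card).filter (fun i => w i ∉ X)).card ≤ m := by
    rw [Finset.sdiff_eq_filter] at hm
    refine le_trans (le_of_eq ?_) hm
    convert card_idx hinj him (fun z => z ∉ X)
  obtain ⟨i, hi, hiX⟩ : ∃ i ∈ A, w (i+1) ∈ X := by
    by_contra hc
    push Not at hc
    have := card_le_of_map (s := A) (· + 1) bad (fun i hi => by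
      simp only [Finset.mem_filter, Finset.mem_range]
      exact ⟨(hA i hi).2, hc i hi⟩) (by simp)
    omega
  obtain ⟨j, hj, hjX, hjX'⟩ : ∃ i ∈ B, w (i+1) ∈ X ∧ w (i-1) ∈ X := by
    by_contra hc
    push Not at hc
    have h1 := card_le_of_map (s := B.filter (fun i => w (i+1) ∉ X)) (· + 1) bad (fun i hi => by
      simp only [Finset.mem_filter, Finset.mem_range] at hi ⊢
      exact ⟨(hB i hi.1).2, hi.2⟩) (by simp)
    have h2 := card_le_of_map (s := B.filter (fun i => ¬ w (i+1) ∉ X)) (· - 1) bad (fun i hi => by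
      simp only [Finset.mem_filter, Finset.mem_range, not_not] at hi ⊢
      have := (hB i hi.1)
      exact ⟨by omega, hc i hi.1 hi.2⟩) (fun i hi j hj hij => by
        simp only [Finset.mem_filter] at hi hj hij
        have := hB i hi.1
        have := hB j hj.1
        omega)
    have h3 := Finset.card_filter_add_card_filter_not (s := B) (fun i => w (i+1) ∉ X)
    omega
  rcases Nat.lt_or_ge i j with h | h
  · have h1 := bp_deg (ha i hi j hj h) (by omega)
    have := hdeg _ hiX _ hjX
    omega
  · have h1 := bp_deg (hb i hi j hj h) (by omega)
    have := hdeg _ hiX _ hjX'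
    omega

theorem HAM {S : Finset V} {e : ℕ} (hu : u ∈ S) (hv : v ∈ S) (huv : u ≠ v) (hS : 3 ≤ S.card)
    (hdeg : ∀ x ∈ S, S.card ≤ 2 * dg G x S + e) :
    HamP G S u v ∨
    (∃ X Y : Finset V, X ⊆ S ∧ Y ⊆ S ∧ Disjoint X Y ∧ S.card ≤ 2 * X.card + (e + 4) ∧
      S.card ≤ 2 * Y.card + (e + 4) ∧ ∀ x ∈ X, dg G x Y ≤ 4 * e + 20) ∨
    (∃ I : Finset V, I ⊆ S ∧ S.card ≤ 2 * I.card + (7 * e + 30) ∧ ∀ a ∈ I, ∀ b ∈ I, a ≠ b →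
      ¬ G.Adj a b ∧ dg G a S + dg G b S ≤ S.card) := by
  rcases ham_or (G := G) hu hv huv hS with h | ⟨y, x, hbp⟩
  · exact Or.inl h
  right
  obtain ⟨w, hmem, hinj, him, hA, hB, h0, ha, hb⟩ := idx2 hbp (by omega)
  have cA := nb_card (G := G) (u := u) (v := v) hinj him x
  have cB := nb_card (G := G) (u := u) (v := v) hinj him y
  have dA := hdeg x hbp.symm.mem_left
  have dB := hdeg y hbp.mem_left
  set A := nb G u v S.card w x
  set B := nb G u v S.card w y
  have hdeg' : ∀ i < S.card, S.card ≤ 2 * ((Finset.range S.card).filter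
      ((fun i j => G.Adj (w i) (w j)) i)).card + (e + 4) := by
    intro i hi
    have := hdeg (w i) (hmem i hi)
    rw [dg, ← card_idx hinj him] at this
    show _ ≤ 2 * ((Finset.range S.card).filter (fun j => G.Adj (w i) (w j))).card + (e + 4)
    omega
  have ha' : ∀ i ∈ A, ∀ j ∈ B, i < j → ¬ (fun i j => G.Adj (w i) (w j)) (i+1) (j+1) :=
    fun i hi j hj hij => (ha i hi j hj hij).not_adj
  have hb' : ∀ i ∈ A, ∀ j ∈ B, j ≤ i → ¬ (fun i j => G.Adj (w i) (w j)) (i+1) (j-1) :=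
    fun i hi j hj hij => (hb i hi j hj hij).not_adj
  rcases comb1 (ε := e + 4) (R := fun i j => G.Adj (w i) (w j)) hA hB h0 (by omega) (by omega)
    (fun i j h => h.symm) ha' hb' hdeg' with hs | hs
  · left
    have h2 := comb2 (ε := e + 4) (R := fun i j => G.Adj (w i) (w j)) hA hB h0 (by omega) (by omega)
      ha' hb' hs
    have inj : ∀ T : Finset ℕ, (∀ t ∈ T, t < S.card) → (T.image w).card = T.card := by
      intro T hT
      exact Finset.card_image_of_injOn (fun i hi j hj hij => hinj i (hT i hi) j (hT j hj) hij)
    have hBl : ∀ t ∈ B, t < S.card := fun t ht => by have := hB t ht; omega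
    have hAl : ∀ t ∈ A.image (· + 1), t < S.card := fun t ht => by
      obtain ⟨a, ha, rfl⟩ := Finset.mem_image.1 ht
      exact (hA a ha).2
    have hAi : (A.image (· + 1)).card = A.card := Finset.card_image_of_injective _ (fun a b => by simp)
    refine ⟨(A.image (· + 1)).image w, B.image w, ?_, ?_, ?_, ?_, ?_, ?_⟩
    · intro z hz
      obtain ⟨t, ht, rfl⟩ := Finset.mem_image.1 hz
      exact hmem t (hAl t ht)
    · intro z hz
      obtain ⟨t, ht, rfl⟩ := Finset.mem_image.1 hz
      exact hmem t (hBl t ht)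
    · rw [Finset.disjoint_left]
      intro z hz hz'
      obtain ⟨t, ht, rfl⟩ := Finset.mem_image.1 hz
      obtain ⟨t', ht', hh⟩ := Finset.mem_image.1 hz'
      have := hinj _ (hBl t' ht') _ (hAl t ht) hh
      subst this
      obtain ⟨a, ha, rfl⟩ := Finset.mem_image.1 ht
      exact h0 a ha ht'
    · rw [inj _ hAl, hAi]; omega
    · rw [inj _ hBl]; omega
    · intro z hz
      obtain ⟨t, ht, rfl⟩ := Finset.mem_image.1 hz
      obtain ⟨a, haA, rfl⟩ := Finset.mem_image.1 ht
      have h3 := h2 a haA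
      have h4 : (B.image w).filter (G.Adj (w (a+1))) ⊆ (B.filter (fun j => G.Adj (w (a+1)) (w j))).image w := by
        intro z hz
        rw [Finset.mem_filter] at hz
        obtain ⟨t, ht, rfl⟩ := Finset.mem_image.1 hz.1
        exact Finset.mem_image_of_mem _ (Finset.mem_filter.2 ⟨ht, hz.2⟩)
      have h5 := (Finset.card_le_card h4).trans Finset.card_image_le
      rw [dg]
      refine h5.trans (h3.trans ?_)
      omega
  · right
    have hl : ∀ t ∈ A ∩ B, t + 1 < S.card := fun t ht => (hA t (Finset.mem_inter.1 ht).1).2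
    refine ⟨(A ∩ B).image (fun t => w (t+1)), ?_, ?_, ?_⟩
    · intro z hz
      obtain ⟨t, ht, rfl⟩ := Finset.mem_image.1 hz
      exact hmem _ (hl t ht)
    · rw [Finset.card_image_of_injOn]
      · have := Finset.card_inter_add_card_sdiff A B
        omega
      · intro i hi j hj hij
        have := hinj _ (hl i hi) _ (hl j hj) hij
        omega
    · have main : ∀ i ∈ A ∩ B, ∀ j ∈ A ∩ B, i < j → BP G u v (S.card+1) S (w (i+1)) (w (j+1)) := by
        intro i hi j hj hij
        exact ha i (Finset.mem_inter.1 hi).1 j (Finset.mem_inter.1 hj).2 hij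
      have main2 : ∀ i ∈ A ∩ B, ∀ j ∈ A ∩ B, i ≠ j → BP G u v (S.card+1) S (w (i+1)) (w (j+1)) := by
        intro i hi j hj hij
        rcases lt_or_gt_of_ne hij with h | h
        · exact main i hi j hj h
        · exact (main j hj i hi h).symm
      intro a ha b hb hab
      obtain ⟨i, hi, rfl⟩ := Finset.mem_image.1 ha
      obtain ⟨j, hj, rfl⟩ := Finset.mem_image.1 hb
      have := main2 i hi j hj (by rintro rfl; exact hab rfl)
      exact ⟨this.not_adj, bp_deg this (by omega)⟩

end HL

namespace HL
variable {V : Type} {G : SimpleGraph V}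

lemma dg_le_card (x : V) (S : Finset V) : dg G x S ≤ S.card := Finset.card_filter_le _ _

lemma dg_mono (x : V) {S S' : Finset V} (h : S ⊆ S') : dg G x S ≤ dg G x S' :=
  Finset.card_le_card (Finset.filter_subset_filter _ h)

lemma dg_sdiff (x : V) (S F : Finset V) : dg G x S ≤ dg G x (S \ F) + F.card := by
  have : S.filter (G.Adj x) ⊆ (S \ F).filter (G.Adj x) ∪ F := by
    intro z hz
    simp only [Finset.mem_filter, Finset.mem_union, Finset.mem_sdiff] at hz ⊢
    tauto
  exact (Finset.card_le_card this).trans (Finset.card_union_le _ _)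

lemma dg_sdiff' (x : V) (S S' : Finset V) : dg G x S ≤ dg G x S' + (S \ S').card := by
  have : S.filter (G.Adj x) ⊆ S'.filter (G.Adj x) ∪ (S \ S') := by
    intro z hz
    simp only [Finset.mem_filter, Finset.mem_union, Finset.mem_sdiff] at hz ⊢
    tauto
  exact (Finset.card_le_card this).trans (Finset.card_union_le _ _)

lemma dg_disj {x : V} {S : Finset V} (h : ∀ z ∈ S, ¬ G.Adj x z) : dg G x S = 0 := by
  rw [dg, Finset.card_eq_zero, Finset.filter_eq_empty_iff]
  exact fun z hz => h z hz

lemma dg_union (x : V) (S S' : Finset V) : dg G x (S ∪ S') ≤ dg G x S + dg G x S' := by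
  rw [dg, Finset.filter_union]; exact Finset.card_union_le _ _

lemma ex_notMem {S F : Finset V} (h : F.card < S.card) : ∃ x ∈ S, x ∉ F :=
  Finset.exists_mem_notMem_of_card_lt_card h

lemma ex_nbr {p : V} {C F : Finset V} (h : F.card < dg G p C) : ∃ c ∈ C, c ∉ F ∧ G.Adj p c := by
  obtain ⟨c, hc, hF⟩ := ex_notMem h
  rw [Finset.mem_filter] at hc
  exact ⟨c, hc.1, hF, hc.2⟩

lemma ex_common {p q : V} {C F : Finset V} (h : C.card + F.card < dg G p C + dg G q C) :
    ∃ c ∈ C, c ∉ F ∧ G.Adj p c ∧ G.Adj q c := by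
  have h1 := Finset.card_union_add_card_inter (C.filter (G.Adj p)) (C.filter (G.Adj q))
  have h2 : (C.filter (G.Adj p) ∪ C.filter (G.Adj q)).card ≤ C.card :=
    Finset.card_le_card (Finset.union_subset (Finset.filter_subset _ _) (Finset.filter_subset _ _))
  rw [dg, dg] at h
  obtain ⟨c, hc, hF⟩ := ex_notMem (S := C.filter (G.Adj p) ∩ C.filter (G.Adj q)) (F := F) (by omega)
  simp only [Finset.mem_inter, Finset.mem_filter] at hc
  exact ⟨c, hc.1.1, hF, hc.1.2, hc.2.2⟩

lemma dbl {B X : Finset V} {a b : ℕ} (h1 : ∀ y ∈ B, a ≤ dg G y X) (h2 : ∀ x ∈ X, dg G x B ≤ b) :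
    B.card * a ≤ X.card * b := by
  refine Finset.card_mul_le_card_mul G.Adj ?_ ?_
  · intro y hy; exact h1 y hy
  · intro x hx
    have := h2 x hx
    rw [dg] at this
    refine le_trans (le_of_eq ?_) this
    congr 1; ext z; simp [Finset.bipartiteBelow, G.adj_comm]

/-- greedy choice of pairwise disjoint objects -/
lemma greedy {ι α : Type} [Inhabited α] (F : Finset ι) (sup : ι → α → Finset V) (Q : ι → α → Prop)
    (U0 : Finset V) (P : Finset ι → Finset V → Prop) (h0 : P ∅ U0)
    (step : ∀ i ∈ F, ∀ J ⊆ F, i ∉ J → ∀ U, U0 ⊆ U → P J U →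
      ∃ d, Q i d ∧ Disjoint (sup i d) U ∧ P (insert i J) (U ∪ sup i d)) :
    ∃ d : ι → α, (∀ i ∈ F, Q i (d i) ∧ Disjoint (sup i (d i)) U0) ∧
      ∀ i ∈ F, ∀ j ∈ F, i ≠ j → Disjoint (sup i (d i)) (sup j (d j)) := by
  have main : ∀ J : Finset ι, J ⊆ F → ∃ d : ι → α, ∃ U, U0 ⊆ U ∧ P J U ∧
      (∀ i ∈ J, Q i (d i) ∧ Disjoint (sup i (d i)) U0 ∧ sup i (d i) ⊆ U) ∧
      ∀ i ∈ J, ∀ j ∈ J, i ≠ j → Disjoint (sup i (d i)) (sup j (d j)) := by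
    intro J
    induction J using Finset.induction_on with
    | empty => intro _; exact ⟨fun _ => default, U0, subset_rfl, h0, by simp, by simp⟩
    | insert a J haJ ih =>
      intro hJ
      obtain ⟨d, U, hU, hP, h1, h2⟩ := ih (fun x hx => hJ (Finset.mem_insert_of_mem hx))
      obtain ⟨da, hda, hdis, hP'⟩ := step a (hJ (Finset.mem_insert_self _ _)) J
        (fun x hx => hJ (Finset.mem_insert_of_mem hx)) haJ U hU hP
      have e1 : ∀ i ∈ J, Function.update d a da i = d i := by
        intro i hi
        rw [Function.update_of_ne]; rintro rfl; exact haJ hi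
      have e2 : Function.update d a da a = da := Function.update_self _ _ _
      refine ⟨Function.update d a da, U ∪ sup a da, hU.trans Finset.subset_union_left, hP', ?_, ?_⟩
      · intro i hi
        rcases Finset.mem_insert.1 hi with rfl | hi
        · rw [e2]; exact ⟨hda, hdis.mono_right hU, Finset.subset_union_right⟩
        · rw [e1 i hi]
          exact ⟨(h1 i hi).1, (h1 i hi).2.1, (h1 i hi).2.2.trans Finset.subset_union_left⟩
      · intro i hi j hj hij
        rcases Finset.mem_insert.1 hi with hia | hi2 <;> rcases Finset.mem_insert.1 hj with hja | hj2
        · exact absurd (hia.trans hja.symm) hij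
        · rw [hia, e2, e1 j hj2]; exact hdis.mono_right (h1 j hj2).2.2
        · rw [hja, e2, e1 i hi2]; exact (hdis.mono_right (h1 i hi2).2.2).symm
        · rw [e1 i hi2, e1 j hj2]; exact h2 i hi2 j hj2 hij
  obtain ⟨d, U, -, -, h1, h2⟩ := main F subset_rfl
  exact ⟨d, fun i hi => ⟨(h1 i hi).1, (h1 i hi).2.1⟩, h2⟩

/-- interior of a path -/
def PI (G : SimpleGraph V) (s t : V) (l : List V) : Prop :=
  l.Nodup ∧ (s :: (l ++ [t])).IsChain G.Adj

lemma PI.reverse {s t : V} {l : List V} (h : PI G s t l) : PI G t s l.reverse := by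
  refine ⟨List.nodup_reverse.2 h.1, ?_⟩
  have h2 : (t :: (l.reverse ++ [s])) = (s :: (l ++ [t])).reverse := by simp
  rw [h2, List.isChain_reverse]
  exact h.2.imp (fun a b hab => hab.symm)

lemma PI.cons {s c t : V} {l : List V} (h : PI G c t l) (hs : G.Adj s c) (hc : c ∉ l) :
    PI G s t (c :: l) :=
  ⟨List.nodup_cons.2 ⟨hc, h.1⟩, List.isChain_cons_cons.2 ⟨hs, h.2⟩⟩

lemma PI.single {s c t : V} (hs : G.Adj s c) (ht : G.Adj c t) : PI G s t [c] :=
  ⟨by simp, by simp [hs, ht]⟩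

lemma altfill {h : ℕ} (hh : 1 ≤ h) : ∀ (m : ℕ) (C D : Finset V) (p q : V) (F : Finset V),
    (∀ c ∈ C, D.card ≤ dg G c D + 6 * h) → (∀ d ∈ D, C.card ≤ dg G d C + 6 * h) →
    26 * h ≤ C.card → 26 * h ≤ D.card → F.card + m ≤ 3 * h →
    (if m = 0 then C.card + 4 * h ≤ dg G p C + dg G q C else
      20 * h ≤ dg G p C ∧ 20 * h ≤ dg G q (if m % 2 = 0 then C else D)) →
    ∃ l : List V, ∃ E1 E2 : Finset V, PI G p q l ∧ l.length = m + 1 ∧ l.toFinset = E1 ∪ E2 ∧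
      E1 ⊆ C ∧ E2 ⊆ D ∧ E1.card = (m + 2) / 2 ∧ E2.card = (m + 1) / 2 ∧ Disjoint l.toFinset F := by
  intro m
  induction m with
  | zero =>
    intro C D p q F hC hD hC' hD' hF hc
    rw [if_pos rfl] at hc
    obtain ⟨c, hc1, hc2, hc3, hc4⟩ := ex_common (G := G) (p := p) (q := q) (C := C) (F := F) (by omega)
    exact ⟨[c], {c}, ∅, PI.single hc3 hc4.symm, rfl, by simp, by simpa, by simp, by simp, by simp, by simpa⟩
  | succ m ih =>
    intro C D p q F hC hD hC' hD' hF hc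
    rw [if_neg (by omega)] at hc
    obtain ⟨c, hc1, hc2, hc3⟩ := ex_nbr (G := G) (p := p) (C := C) (F := F) (by omega)
    have hcD := hC c hc1
    have hq : 20 * h ≤ dg G q (if m % 2 = 0 then D else C) := by
      have := hc.2
      rcases Nat.mod_two_eq_zero_or_one m with h0 | h0
      · rw [if_pos h0]; rwa [if_neg (by omega)] at this
      · rw [if_neg (by omega)]; rwa [if_pos (by omega)] at this
    obtain ⟨l, E1, E2, h1, h2, h3, h4, h5, h6, h7, h8⟩ := ih D C c q (insert c F) hD hC hD' hC' (by
      have := Finset.card_insert_le c F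
      omega) (by
      by_cases h0 : m = 0
      · subst h0
        rw [if_pos rfl]
        simp only [Nat.zero_mod, if_true] at hq
        omega
      · rw [if_neg h0]; exact ⟨by omega, hq⟩)
    rw [Finset.disjoint_insert_right] at h8
    have hcl : c ∉ l := by simpa using h8.1
    refine ⟨c :: l, insert c E2, E1, h1.cons hc3 hcl, by simp [h2], ?_, ?_, h4, ?_, by omega, ?_⟩
    · rw [List.toFinset_cons, h3, Finset.insert_union, Finset.union_comm]
    · exact Finset.insert_subset hc1 h5
    · rw [Finset.card_insert_of_notMem, h7]
      · omega
      · intro hc; apply h8.1; rw [h3]; exact Finset.mem_union_right _ hc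
    · rw [List.toFinset_cons, Finset.disjoint_insert_left]; exact ⟨hc2, h8.2⟩

end HL

namespace HL
variable {V : Type} {G : SimpleGraph V} {ι : Type}

lemma fillFam {F : Finset ι} {W U0 : Finset V} {gad : ι → Finset V} {m : ι → ℕ} {B : ℕ}
    (Q : ι → List V → Prop) (hW : W ⊆ U0) (hg : ∀ i ∈ F, gad i ⊆ U0 ∧ Disjoint (gad i) W)
    (hgd : ∀ i ∈ F, ∀ j ∈ F, i ≠ j → Disjoint (gad i) (gad j))
    (hB : U0.card + ∑ i ∈ F, m i ≤ B)
    (step : ∀ i ∈ F, ∀ U, U0 ⊆ U → U.card + m i ≤ B → ∃ l : List V, Q i l ∧ l.length = m i ∧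
      Disjoint (l.toFinset \ gad i) U) :
    ∃ l : ι → List V, (∀ i ∈ F, Q i (l i) ∧ (l i).length = m i ∧ Disjoint (l i).toFinset W) ∧
      ∀ i ∈ F, ∀ j ∈ F, i ≠ j → Disjoint (l i).toFinset (l j).toFinset := by
  obtain ⟨l, h1, h2⟩ := greedy F (fun i (l : List V) => l.toFinset \ gad i)
    (fun i l => Q i l ∧ l.length = m i) U0
    (fun J U => U.card ≤ U0.card + ∑ i ∈ J, m i) (by simp) (by
      intro i hi J hJ hiJ U hU hP
      have hs : ∑ j ∈ insert i J, m j ≤ ∑ j ∈ F, m j :=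
        Finset.sum_le_sum_of_subset (Finset.insert_subset hi hJ)
      rw [Finset.sum_insert hiJ] at hs
      obtain ⟨l, hl1, hl2, hl3⟩ := step i hi U hU (by omega)
      refine ⟨l, ⟨hl1, hl2⟩, hl3, ?_⟩
      rw [Finset.sum_insert hiJ]
      have a1 := Finset.card_union_le U (l.toFinset \ gad i)
      have a2 : (l.toFinset \ gad i).card ≤ l.toFinset.card := Finset.card_le_card Finset.sdiff_subset
      have a3 := List.toFinset_card_le l
      omega)
  have hsub : ∀ i, (l i).toFinset ⊆ ((l i).toFinset \ gad i) ∪ gad i := by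
    intro i x hx; simp at hx ⊢; tauto
  refine ⟨l, fun i hi => ⟨(h1 i hi).1.1, (h1 i hi).1.2, ?_⟩, ?_⟩
  · refine Disjoint.mono_left (hsub i) ?_
    rw [Finset.disjoint_union_left]
    exact ⟨(h1 i hi).2.mono_right hW, (hg i hi).2⟩
  · intro i hi j hj hij
    refine Disjoint.mono (hsub i) (hsub j) ?_
    rw [Finset.disjoint_union_left, Finset.disjoint_union_right, Finset.disjoint_union_right]
    exact ⟨⟨h2 i hi j hj hij, (h1 i hi).2.mono_right (hg j hj).1⟩,
      ((h1 j hj).2.mono_right (hg i hi).1).symm, hgd i hi j hj hij⟩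

variable [Fintype V] [Fintype ι]

def TwoCl (G : SimpleGraph V) (g : ℕ) : Prop :=
  ∃ X Y : Finset V, Disjoint X Y ∧ Fintype.card V ≤ 2 * X.card + g ∧
    Fintype.card V ≤ 2 * Y.card + g ∧ ∀ x ∈ X, dg G x Y ≤ g

def Ind (G : SimpleGraph V) (g : ℕ) (P : Finset V) : Prop :=
  (∀ a ∈ P, ∀ b ∈ P, ¬ G.Adj a b) ∧ Fintype.card V ≤ 2 * P.card + g

structure Ctx (G : SimpleGraph V) (s t : ι → V) (m : ι → ℕ) (i0 : ι) (k e0 h : ℕ) : Prop where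
  hk : Fintype.card ι = k
  hst : ∀ i, s i ≠ t i
  hm : ∀ i, i ≠ i0 → 3 ≤ m i
  hsum : 2 * k + ∑ i ∈ Finset.univ.erase i0, m i ≤ e0
  he : 100 * e0 ≤ h
  hg : 50 * e0 * Fintype.card V ≤ h * h
  hn : 10000 * (k * h) ≤ Fintype.card V
  hdeg : ∀ x, Fintype.card V + 2 * k ≤ 2 * dg G x Finset.univ

noncomputable def TT (s t : ι → V) : Finset V := Finset.univ.image s ∪ Finset.univ.image t

noncomputable def RR (s t : ι → V) (i0 : ι) (l : ι → List V) : Finset V :=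
  (Finset.univ.erase i0).biUnion (fun i => (l i).toFinset) ∪ (TT s t \ {s i0, t i0})

def Fam (G : SimpleGraph V) (s t : ι → V) (m : ι → ℕ) (i0 : ι) (l : ι → List V) : Prop :=
  (∀ i, i ≠ i0 → PI G (s i) (t i) (l i) ∧ (l i).length = m i ∧ Disjoint (l i).toFinset (TT s t)) ∧
  ∀ i j, i ≠ i0 → j ≠ i0 → i ≠ j → Disjoint (l i).toFinset (l j).toFinset

def Goal (G : SimpleGraph V) (s t : ι → V) (m : ι → ℕ) (i0 : ι) : Prop :=
  ∃ l, Fam G s t m i0 l ∧ HamP G (Finset.univ \ RR s t i0 l) (s i0) (t i0)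

section
variable {s t : ι → V} {m : ι → ℕ} {i0 : ι} {k e0 h : ℕ}

lemma s_mem (i : ι) : s i ∈ TT s t := by simp [TT]
lemma t_mem (i : ι) : t i ∈ TT s t := by simp [TT]

lemma Ctx.hk1 (c : Ctx G s t m i0 k e0 h) : 1 ≤ k := by
  rw [← c.hk]; exact Fintype.card_pos_iff.2 ⟨i0⟩

lemma Ctx.T_card (c : Ctx G s t m i0 k e0 h) : (TT s t).card ≤ 2 * k := by
  have h1 := Finset.card_union_le (Finset.univ.image s) (Finset.univ.image t)
  have h2 : (Finset.univ.image s).card ≤ k := Finset.card_image_le.trans (by simp [c.hk])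
  have h3 : (Finset.univ.image t).card ≤ k := Finset.card_image_le.trans (by simp [c.hk])
  rw [TT]; omega

lemma Fam.R_card {l : ι → List V} (f : Fam G s t m i0 l) :
    (RR s t i0 l).card = ∑ i ∈ Finset.univ.erase i0, m i + (TT s t \ {s i0, t i0}).card := by
  rw [RR, Finset.card_union_of_disjoint, Finset.card_biUnion]
  · congr 1
    refine Finset.sum_congr rfl fun i hi => ?_
    have := f.1 i (Finset.ne_of_mem_erase hi)
    rw [List.toFinset_card_of_nodup this.1.1, this.2.1]
  · intro i hi j hj hij
    exact f.2 i j (Finset.ne_of_mem_erase hi) (Finset.ne_of_mem_erase hj) hij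
  · rw [Finset.disjoint_biUnion_left]
    intro i hi
    exact (f.1 i (Finset.ne_of_mem_erase hi)).2.2.mono_right Finset.sdiff_subset

lemma Fam.R_le {l : ι → List V} (c : Ctx G s t m i0 k e0 h) (f : Fam G s t m i0 l) :
    (RR s t i0 l).card ≤ e0 := by
  have h1 := f.R_card
  have h2 := c.T_card
  have h3 := c.hsum
  have h4 : (TT s t \ {s i0, t i0}).card ≤ (TT s t).card := Finset.card_le_card Finset.sdiff_subset
  omega

lemma Fam.notMem {l : ι → List V} (f : Fam G s t m i0 l) {x : V} (hx : x = s i0 ∨ x = t i0) :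
    x ∉ RR s t i0 l := by
  have hxT : x ∈ TT s t := by rcases hx with rfl | rfl; exact s_mem _; exact t_mem _
  simp only [RR, Finset.mem_union, Finset.mem_biUnion, not_or, Finset.mem_sdiff]
  constructor
  · rintro ⟨i, hi, hxi⟩
    exact Finset.disjoint_left.1 (f.1 i (Finset.ne_of_mem_erase hi)).2.2 hxi hxT
  · simp; tauto

lemma Ctx.ham_S (c : Ctx G s t m i0 k e0 h) {l : ι → List V} (f : Fam G s t m i0 l) :
    HamP G (Finset.univ \ RR s t i0 l) (s i0) (t i0) ∨ TwoCl G (50 * e0) ∨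
    ∃ I : Finset V, I ⊆ Finset.univ \ RR s t i0 l ∧ Ind G (50 * e0) I ∧
      ∀ a ∈ I, ∀ b ∈ I, a ≠ b → dg G a (Finset.univ \ RR s t i0 l) + dg G b (Finset.univ \ RR s t i0 l)
        ≤ (Finset.univ \ RR s t i0 l).card := by
  have hR := f.R_le c
  set R := RR s t i0 l with hRdef
  have hk := c.hk1
  have hn := c.hn
  have he := c.he
  have hsum := c.hsum
  have hkh : h ≤ k * h := Nat.le_mul_of_pos_left h hk
  have hScard : (Finset.univ \ R).card + R.card = Fintype.card V := by
    rw [Finset.card_sdiff_add_card, Finset.union_eq_left.2 (Finset.subset_univ _), Finset.card_univ]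
  rcases HAM (G := G) (S := Finset.univ \ R) (e := 2 * e0) (u := s i0) (v := t i0)
    (by simp only [Finset.mem_sdiff, Finset.mem_univ, true_and]; exact f.notMem (Or.inl rfl))
    (by simp only [Finset.mem_sdiff, Finset.mem_univ, true_and]; exact f.notMem (Or.inr rfl))
    (c.hst i0) (by omega) (by
      intro x hx
      have h1 := c.hdeg x
      have h2 := dg_sdiff (G := G) x Finset.univ R
      omega) with h1 | ⟨X, Y, hX, hY, hd, hX2, hY2, h1⟩ | ⟨I, hI, hI2, h1⟩
  · exact Or.inl h1
  · right; left
    exact ⟨X, Y, hd, by omega, by omega, fun x hx => (h1 x hx).trans (by omega)⟩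
  · right; right
    refine ⟨I, hI, ⟨?_, by omega⟩, fun a ha b hb hab => (h1 a ha b hb hab).2⟩
    intro a ha b hb hadj
    exact (h1 a ha b hb hadj.ne).1 hadj

lemma genfill {g N : ℕ} (hdeg : ∀ x, Fintype.card V + 2 * k ≤ 2 * dg G x Finset.univ)
    (h2 : ¬ TwoCl G g) (hI : ¬ ∃ P, Ind G g P) (hN : 8 * N ≤ g) (hn : 8 * N < Fintype.card V) :
    ∀ (m : ℕ) (p q : V) (F : Finset V), F.card + m + 2 ≤ N →
    ∃ l : List V, PI G p q l ∧ l.length = m + 2 ∧ Disjoint l.toFinset F := by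
  intro m
  induction m with
  | zero =>
    intro p q F hF
    set X := (Finset.univ \ F).filter (G.Adj p) with hX
    set Y := (Finset.univ \ F).filter (G.Adj q) with hY
    have cX : Fintype.card V ≤ 2 * X.card + 2 * N := by
      have h1 := hdeg p
      have h2 := dg_sdiff (G := G) p Finset.univ F
      have : X.card = dg G p (Finset.univ \ F) := rfl
      omega
    have cY : Fintype.card V ≤ 2 * Y.card + 2 * N := by
      have h1 := hdeg q
      have h2 := dg_sdiff (G := G) q Finset.univ F
      have : Y.card = dg G q (Finset.univ \ F) := rfl
      omega
    by_cases hE : ∃ x ∈ X, ∃ y ∈ Y, G.Adj x y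
    · obtain ⟨x, hx, y, hy, hxy⟩ := hE
      simp only [hX, hY, Finset.mem_filter, Finset.mem_sdiff, Finset.mem_univ, true_and] at hx hy
      refine ⟨[x, y], (PI.single hxy hy.2.symm).cons hx.2 (by simpa using hxy.ne), rfl, ?_⟩
      simp [hx.1, hy.1]
    · push Not at hE
      exfalso
      by_cases hd : Disjoint X Y
      · apply h2
        refine ⟨X, Y, hd, by omega, by omega, fun x hx => ?_⟩
        rw [dg_disj (hE x hx)]; omega
      · obtain ⟨z, hzX, hzY⟩ := Finset.not_disjoint_iff.1 hd
        apply hI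
        refine ⟨X ∩ Y, ?_, ?_⟩
        · intro a ha b hb
          exact hE a (Finset.mem_inter.1 ha).1 b (Finset.mem_inter.1 hb).2
        · have h1 := Finset.card_union_add_card_inter X Y
          have h3 : dg G z (X ∪ Y) = 0 := by
            apply dg_disj
            intro w hw
            rcases Finset.mem_union.1 hw with hw | hw
            · exact fun hh => hE w hw z hzY hh.symm
            · exact hE z hzX w hw
          have h4 := dg_sdiff' (G := G) z Finset.univ (X ∪ Y)
          have h5 := hdeg z
          have h6 : (Finset.univ \ (X ∪ Y)).card + (X ∪ Y).card = Fintype.card V := by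
            rw [Finset.card_sdiff_add_card, Finset.union_eq_left.2 (Finset.subset_univ _), Finset.card_univ]
          omega
  | succ m ih =>
    intro p q F hF
    obtain ⟨c, -, hcF, hc⟩ := ex_nbr (G := G) (p := p) (C := Finset.univ) (F := F) (by
      have := hdeg p
      omega)
    obtain ⟨l, h1, h2, h3⟩ := ih c q (insert c F) (by
      have := Finset.card_insert_le c F
      omega)
    rw [Finset.disjoint_insert_right] at h3
    refine ⟨c :: l, h1.cons hc (by simpa using h3.1), by simp [h2], ?_⟩
    rw [List.toFinset_cons, Finset.disjoint_insert_left]; exact ⟨hcF, h3.2⟩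

theorem generic (c : Ctx G s t m i0 k e0 h) (h2 : ¬ TwoCl G (50 * e0))
    (hI : ¬ ∃ P, Ind G (50 * e0) P) : Goal G s t m i0 := by
  have hk := c.hk1
  have hn := c.hn
  have he := c.he
  have hsum := c.hsum
  have hkh : h ≤ k * h := Nat.le_mul_of_pos_left h hk
  obtain ⟨l, h3, h4⟩ := fillFam (F := Finset.univ.erase i0) (W := TT s t) (U0 := TT s t)
    (gad := fun _ => ∅) (m := m) (B := e0) (fun i l => PI G (s i) (t i) l) subset_rfl (by simp) (by simp)
    (by have := c.T_card; omega) (by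
      intro i hi U hU hUc
      have hm := c.hm i (Finset.ne_of_mem_erase hi)
      obtain ⟨l, h1, h2, h3⟩ := genfill (N := e0) c.hdeg h2 hI (by omega) (by omega) (m i - 2) (s i) (t i) U
        (by omega)
      exact ⟨l, h1, by omega, by simpa using h3⟩)
  have f : Fam G s t m i0 l := ⟨fun i hi => h3 i (by simp [hi]),
    fun i j hi hj => h4 i (by simp [hi]) j (by simp [hj])⟩
  refine ⟨l, f, ?_⟩
  rcases c.ham_S f with h | h | ⟨I, -, h, -⟩
  · exact h
  · exact absurd h h2
  · exact absurd ⟨I, h⟩ hI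
end

end HL

namespace HL
variable {V : Type} {G : SimpleGraph V} {ι : Type}

/-- threshold for terminals / non-terminals -/
noncomputable def th (T : Finset V) (h : ℕ) (x : V) : ℕ := if x ∈ T then 20 * h else 40 * h

lemma th_le {T : Finset V} {h : ℕ} (x : V) : th T h x ≤ 40 * h := by
  rw [th]; split_ifs <;> omega

def Gad (G : SimpleGraph V) (F : Finset ι) (S : ι → Finset V) (C U0 : Finset V) (h : ℕ) : Prop :=
  ∃ p z : ι → V, (∀ i ∈ F, p i ∈ S i ∧ G.Adj (p i) (z i) ∧ p i ∉ U0 ∧ z i ∉ U0 ∧ 40 * h ≤ dg G (z i) C) ∧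
    ∀ i ∈ F, ∀ j ∈ F, i ≠ j → Disjoint ({p i, z i} : Finset V) {p j, z j}

variable [Fintype V]

structure Frame (G : SimpleGraph V) (C1 C2 T : Finset V) (k h : ℕ) : Prop where
  hd : Disjoint C1 C2
  h1 : Fintype.card V ≤ 2 * C1.card + 3 * h
  h2 : Fintype.card V ≤ 2 * C2.card + 3 * h
  hk : 1 ≤ k
  hkh : 100 * k ≤ h
  hn : 10000 * (k * h) ≤ Fintype.card V
  hdeg : ∀ x, Fintype.card V + 2 * k ≤ 2 * dg G x Finset.univ

namespace Frame
variable {C1 C2 T : Finset V} {k h : ℕ}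

lemma symm (f : Frame G C1 C2 T k h) : Frame G C2 C1 T k h :=
  ⟨f.hd.symm, f.h2, f.h1, f.hk, f.hkh, f.hn, f.hdeg⟩

lemma kh (f : Frame G C1 C2 T k h) : h ≤ k * h := Nat.le_mul_of_pos_left h f.hk

lemma cards (f : Frame G C1 C2 T k h) : C1.card + C2.card ≤ Fintype.card V := by
  rw [← Finset.card_union_of_disjoint f.hd]; exact Finset.card_le_univ _

lemma dsum (f : Frame G C1 C2 T k h) (x : V) :
    Fintype.card V + 2 * k ≤ 2 * (dg G x C1 + dg G x C2) + 6 * h := by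
  have h1 := f.hdeg x
  have h2 := dg_sdiff' (G := G) x Finset.univ (C1 ∪ C2)
  have h3 := dg_union (G := G) x C1 C2
  have h4 : (Finset.univ \ (C1 ∪ C2)).card + (C1.card + C2.card) = Fintype.card V := by
    rw [← Finset.card_union_of_disjoint f.hd, Finset.card_sdiff_add_card,
      Finset.union_eq_left.2 (Finset.subset_univ _), Finset.card_univ]
  have := f.h1
  have := f.h2
  omega

/-- a vertex of degree less than 20 h to `C2` misses at most 25 h of `C1` -/
lemma near (f : Frame G C1 C2 T k h) {x : V} (hx : dg G x C2 < 20 * h) :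
    C1.card ≤ dg G x C1 + 25 * h := by
  have := f.dsum x
  have := f.cards
  have := f.h1
  have := f.h2
  omega

lemma high (f : Frame G C1 C2 T k h) {x : V} (hx : dg G x C2 < 40 * h) :
    40 * h ≤ dg G x C1 := by
  have := f.dsum x
  have := f.hn
  have := f.kh
  omega

noncomputable def L (G : SimpleGraph V) (C T : Finset V) (h : ℕ) : Finset V :=
  Finset.univ.filter (fun x => dg G x C < th T h x)

lemma mem_L {C T : Finset V} {h : ℕ} {x : V} : x ∈ L G C T h ↔ dg G x C < th T h x := by
  simp [L]

lemma Ldisj (f : Frame G C1 C2 T k h) : Disjoint (L G C1 T h) (L G C2 T h) := by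
  rw [Finset.disjoint_left]
  intro x hx hx2
  simp only [mem_L] at hx hx2
  have := th_le (T := T) (h := h) x
  have := f.high (x := x) (by omega)
  omega

lemma gadA (f : Frame G C1 C2 T k h) {F : Finset ι} {S : ι → Finset V} {U0 : Finset V} {κ : ℕ}
    (hS : ∀ i ∈ F, S i ⊆ C1 ∧ C1.card ≤ (S i).card + 25 * h)
    (hU : U0.card + 2 * F.card ≤ 16 * k)
    (hκ : κ = 0 ∨ (κ = 1 ∧ ∀ p ∈ C1, p ∉ L G C1 T h))
    (hX : 2 * (Finset.univ \ L G C1 T h).card < Fintype.card V + 2 * k + 2 * κ) :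
    Gad G F S C2 U0 h := by
  have hk := f.hk
  have hkh := f.hkh
  have hn := f.hn
  have kh := f.kh
  have h1 := f.h1
  rcases F.eq_empty_or_nonempty with rfl | ⟨i1, hi1⟩
  · by_cases hV : Nonempty V
    · exact ⟨fun _ => hV.some, fun _ => hV.some, by simp, by simp⟩
    · exfalso
      have : Fintype.card V = 0 := by
        rw [Fintype.card_eq_zero_iff]; exact not_nonempty_iff.1 hV
      omega
  have hne : Nonempty V := by
    by_contra hV
    have : Fintype.card V = 0 := by
        rw [Fintype.card_eq_zero_iff]; exact not_nonempty_iff.1 hV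
    omega
  haveI : Inhabited (V × V) := ⟨(hne.some, hne.some)⟩
  obtain ⟨d, hd1, hd2⟩ := greedy F (fun _ (d : V × V) => {d.1, d.2})
    (fun i d => d.1 ∈ S i ∧ G.Adj d.1 d.2 ∧ 40 * h ≤ dg G d.2 C2) U0
    (fun J U => U.card ≤ U0.card + 2 * J.card) (by simp) (by
      intro i hi J hJ hiJ U hU1 hP
      have hJF : J.card ≤ F.card := Finset.card_le_card hJ
      obtain ⟨hS1, hS2⟩ := hS i hi
      set Bd := U ∪ (U ∩ L G C1 T h).biUnion (fun z => C1.filter (G.Adj z)) with hBd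
      have hb : Bd.card ≤ U.card + U.card * (40 * h) := by
        refine (Finset.card_union_le _ _).trans (Nat.add_le_add_left ?_ _)
        refine (Finset.card_biUnion_le_card_mul _ _ (40 * h) ?_).trans
          (Nat.mul_le_mul_right _ (Finset.card_le_card Finset.inter_subset_left))
        intro z hz
        have hz2 := (Finset.mem_inter.1 hz).2
        simp only [mem_L] at hz2
        have := th_le (T := T) (h := h) z
        have h9 : (C1.filter (G.Adj z)).card = dg G z C1 := rfl
        omega
      have hb2 : U.card * (40 * h) ≤ (16 * k) * (40 * h) := Nat.mul_le_mul_right _ (by omega)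
      have hb3 : (16 * k) * (40 * h) = 640 * (k * h) := by ring
      obtain ⟨p, hp1, hp2⟩ := ex_notMem (S := S i) (F := Bd) (by omega)
      have hdeg := f.hdeg p
      have q1 := dg_sdiff (G := G) p Finset.univ (L G C1 T h)
      have q2 : dg G p (Finset.univ \ L G C1 T h) + κ ≤ (Finset.univ \ L G C1 T h).card := by
        rcases hκ with rfl | ⟨rfl, hκ⟩
        · exact dg_le_card _ _
        · have hpm : p ∈ Finset.univ \ L G C1 T h := by simp [hκ p (hS1 hp1)]
          refine Nat.succ_le_of_lt (Finset.card_lt_card ?_)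
          refine Finset.filter_ssubset.2 ⟨p, hpm, by simp⟩
      have q3 := dg_sdiff' (G := G) p Finset.univ (Finset.univ \ L G C1 T h)
      have q4 : 0 < dg G p (L G C1 T h) := by
        have q5 : dg G p Finset.univ ≤ dg G p (L G C1 T h) + dg G p (Finset.univ \ L G C1 T h) := by
          refine le_trans (dg_mono p ?_) (dg_union p _ _)
          intro x _; simp
        omega
      obtain ⟨z, hz1, -, hz3⟩ := ex_nbr (G := G) (F := ∅) (by simpa using q4)
      have hpU : p ∉ U := fun hh => hp2 (Finset.mem_union_left _ hh)
      have hzU : z ∉ U := by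
        intro hh
        refine hp2 (Finset.mem_union_right _ (Finset.mem_biUnion.2 ⟨z, Finset.mem_inter.2 ⟨hh, hz1⟩, ?_⟩))
        exact Finset.mem_filter.2 ⟨hS1 hp1, hz3.symm⟩
      refine ⟨(p, z), ⟨hp1, hz3, ?_⟩, ?_, ?_⟩
      · simp only [mem_L] at hz1
        have := th_le (T := T) (h := h) z
        exact f.symm.high (x := z) (by omega)
      · simp [hpU, hzU]
      · rw [Finset.card_insert_of_notMem hiJ]
        have := Finset.card_union_le U {p, z}
        have := Finset.card_le_two (a := p) (b := z)
        show (U ∪ {p, z}).card ≤ _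
        omega)
  refine ⟨fun i => (d i).1, fun i => (d i).2, fun i hi => ?_, fun i hi j hj hij => hd2 i hi j hj hij⟩
  obtain ⟨⟨a1, a2, a3⟩, a4⟩ := hd1 i hi
  simp only [Finset.disjoint_insert_left, Finset.disjoint_singleton_left] at a4
  exact ⟨a1, a2, a4.1, a4.2, a3⟩

lemma gadX (f : Frame G C1 C2 T k h) {F : Finset ι} {S : ι → Finset V} {U0 : Finset V} {κ : ℕ}
    (hS : ∀ i ∈ F, S i ⊆ C1 ∧ C1.card ≤ (S i).card + 25 * h) (hT : T ⊆ U0)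
    (hU : U0.card + 2 * F.card ≤ 16 * k)
    (hlow : ∀ p ∈ C1, dg G p C1 < 40 * h ∨ dg G p C2 < 40 * h)
    (hX : 2 * k + 2 * κ ≤ (Finset.univ \ (L G C1 T h ∪ L G C2 T h)).card)
    (hF : (U0 ∩ (Finset.univ \ (L G C1 T h ∪ L G C2 T h))).card + F.card ≤ 2 * k + 2 * κ) :
    Gad G F S C2 U0 h := by
  have hk := f.hk
  have hkh := f.hkh
  have hn := f.hn
  have kh := f.kh
  have h1 := f.h1
  have hne : Nonempty V := by
    by_contra hV
    have : Fintype.card V = 0 := by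
        rw [Fintype.card_eq_zero_iff]; exact not_nonempty_iff.1 hV
    omega
  haveI : Inhabited (V × V) := ⟨(hne.some, hne.some)⟩
  set X := Finset.univ \ (L G C1 T h ∪ L G C2 T h) with hXdef
  obtain ⟨d, hd1, hd2⟩ := greedy F (fun _ (d : V × V) => {d.1, d.2})
    (fun i d => d.1 ∈ S i ∧ G.Adj d.1 d.2 ∧ 40 * h ≤ dg G d.2 C2) U0
    (fun J U => U.card ≤ U0.card + 2 * J.card ∧ (U ∩ X).card ≤ (U0 ∩ X).card + J.card) (by simp) (by
      rintro i hi J hJ hiJ U hU1 ⟨hP, hP2⟩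
      have hJF : (insert i J).card ≤ F.card := Finset.card_le_card (Finset.insert_subset hi hJ)
      rw [Finset.card_insert_of_notMem hiJ] at hJF
      obtain ⟨hS1, hS2⟩ := hS i hi
      obtain ⟨z, hz1, hz2⟩ := ex_notMem (S := X) (F := U ∩ X) (by omega)
      have hzU : z ∉ U := fun hh => hz2 (Finset.mem_inter.2 ⟨hh, hz1⟩)
      have hzT : z ∉ T := fun hh => hzU (hU1 (hT hh))
      have hz3 := hz1
      simp only [hXdef, mem_L, Finset.mem_sdiff, Finset.mem_union, Finset.mem_univ,
        true_and, th, if_neg hzT, not_or, not_lt] at hz3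
      have e1 := dg_sdiff' (G := G) z C1 (S i)
      have e2 : (C1 \ S i).card = C1.card - (S i).card := Finset.card_sdiff_of_subset hS1
      obtain ⟨p, hp1, hp2, hp3⟩ := ex_nbr (G := G) (p := z) (C := S i) (F := U) (by omega)
      have hpT : p ∉ T := fun hh => hp2 (hU1 (hT hh))
      have hpX : p ∉ X := by
        simp only [hXdef, mem_L, Finset.mem_sdiff, Finset.mem_union, Finset.mem_univ,
          true_and, th, if_neg hpT, not_not]
        exact hlow p (hS1 hp1)
      refine ⟨(p, z), ⟨hp1, hp3.symm, hz3.2⟩, by simp [hp2, hzU], ?_⟩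
      rw [Finset.card_insert_of_notMem hiJ]
      have := Finset.card_union_le U {p, z}
      have := Finset.card_le_two (a := p) (b := z)
      refine ⟨show (U ∪ {p, z}).card ≤ _ by omega, ?_⟩
      have hss : (U ∪ {p, z}) ∩ X ⊆ insert z (U ∩ X) := by
        intro x hx
        simp only [Finset.mem_inter, Finset.mem_union, Finset.mem_insert, Finset.mem_singleton] at hx ⊢
        rcases hx with ⟨h1 | h1 | h1, h2⟩
        · exact Or.inr ⟨h1, h2⟩
        · exact absurd (h1 ▸ h2) hpX
        · exact Or.inl h1
      have := Finset.card_le_card hss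
      have := Finset.card_insert_le z (U ∩ X)
      show ((U ∪ {p, z}) ∩ X).card ≤ _
      omega)
  refine ⟨fun i => (d i).1, fun i => (d i).2, fun i hi => ?_, fun i hi j hj hij => hd2 i hi j hj hij⟩
  obtain ⟨⟨a1, a2, a3⟩, a4⟩ := hd1 i hi
  simp only [Finset.disjoint_insert_left, Finset.disjoint_singleton_left] at a4
  exact ⟨a1, a2, a4.1, a4.2, a3⟩

lemma gadget (f : Frame G C1 C2 T k h) {F : Finset ι} {S1 S2 : ι → Finset V} {U0 : Finset V} {κ : ℕ}
    (hS1 : ∀ i ∈ F, S1 i ⊆ C1 ∧ C1.card ≤ (S1 i).card + 25 * h)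
    (hS2 : ∀ i ∈ F, S2 i ⊆ C2 ∧ C2.card ≤ (S2 i).card + 25 * h) (hT : T ⊆ U0)
    (hU : U0.card + 2 * F.card ≤ 16 * k)
    (hlow : ∀ p ∈ C1, dg G p C1 < 40 * h ∨ dg G p C2 < 40 * h)
    (hκ : κ = 0 ∨ (κ = 1 ∧ (∀ p ∈ C1, p ∉ L G C1 T h) ∧ (∀ p ∈ C2, p ∉ L G C2 T h)))
    (hF : (U0 ∩ (Finset.univ \ (L G C1 T h ∪ L G C2 T h))).card + F.card ≤ 2 * k + 2 * κ) :
    Gad G F S1 C2 U0 h ∨ Gad G F S2 C1 U0 h := by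
  by_cases hA : 2 * (Finset.univ \ L G C1 T h).card < Fintype.card V + 2 * k + 2 * κ
  · exact Or.inl (f.gadA hS1 hU (hκ.imp id fun h => ⟨h.1, h.2.1⟩) hA)
  by_cases hB : 2 * (Finset.univ \ L G C2 T h).card < Fintype.card V + 2 * k + 2 * κ
  · exact Or.inr (f.symm.gadA hS2 hU (hκ.imp id fun h => ⟨h.1, h.2.2⟩) hB)
  left
  refine f.gadX hS1 hT hU hlow ?_ hF
  have a1 := Finset.card_sdiff_add_card_inter Finset.univ (L G C1 T h)
  have a2 := Finset.card_sdiff_add_card_inter Finset.univ (L G C2 T h)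
  have a3 := Finset.card_sdiff_add_card_inter Finset.univ (L G C1 T h ∪ L G C2 T h)
  rw [Finset.univ_inter, Finset.card_univ] at a1 a2 a3
  rw [Finset.card_union_of_disjoint f.Ldisj] at a3
  omega

end Frame
end HL

namespace HL
variable {V : Type} {G : SimpleGraph V} {ι : Type}

lemma HamP.symm {S : Finset V} {u v : V} (h : HamP G S u v) : HamP G S v u := by
  obtain ⟨L, h1, h2, h3, h4, h5⟩ := h
  refine ⟨L.reverse, List.nodup_reverse.2 h1, by simpa using h2, by simpa using h4, by simpa using h3, ?_⟩
  rw [List.isChain_reverse]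
  exact h5.imp (fun a b hab => hab.symm)

lemma HamP.append {A B : Finset V} {u a b v : V} (h1 : HamP G A u a) (h2 : HamP G B b v)
    (hab : G.Adj a b) (hd : Disjoint A B) : HamP G (A ∪ B) u v := by
  obtain ⟨L, l1, l2, l3, l4, l5⟩ := h1
  obtain ⟨M, m1, m2, m3, m4, m5⟩ := h2
  refine ⟨L ++ M, ?_, ?_, ?_, ?_, ?_⟩
  · refine List.nodup_append'.2 ⟨l1, m1, ?_⟩
    intro x hx hx2
    rw [← l2, ← m2] at hd
    exact Finset.disjoint_left.1 hd (List.mem_toFinset.2 hx) (List.mem_toFinset.2 hx2)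
  · rw [List.toFinset_append, l2, m2]
  · rw [List.head?_append, l3]; rfl
  · rw [List.getLast?_append, m4]; rfl
  · rw [List.isChain_append]
    refine ⟨l5, m5, ?_⟩
    intro x hx y hy
    rw [l4] at hx; rw [m3] at hy
    simp at hx hy
    subst hx; subst hy
    exact hab

lemma PI.ham {u a : V} {l : List V} (h : PI G u a l) (hu : u ∉ l) (ha : a ∉ l) (hua : u ≠ a) :
    HamP G (insert u (insert a l.toFinset)) u a := by
  refine ⟨u :: (l ++ [a]), ?_, ?_, rfl, ?_, h.2⟩
  · rw [List.nodup_cons, List.nodup_append']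
    refine ⟨by simp [hu, hua], h.1, by simp, ?_⟩
    intro x hx hx2
    simp at hx2
    exact ha (hx2 ▸ hx)
  · ext x; simp
  · simp [List.getLast?_cons]

structure SideOK (G : SimpleGraph V) (C A : Finset V) (h q : ℕ) : Prop where
  hA : ∀ x ∈ A, 20 * h ≤ dg G x C
  hC : ∀ x ∈ C, C.card ≤ dg G x C + 6 * h
  h1 : (A \ C).card ≤ 4 * h
  h2 : (C \ A).card ≤ q * h
  h3 : 40 * h ≤ C.card
  h4 : 5 ≤ h

lemma SideOK.ham {C A : Finset V} {h : ℕ} (o : SideOK G C A h 3) {u v : V} (hu : u ∈ A) (hv : v ∈ A)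
    (huv : u ≠ v) : HamP G A u v := by
  obtain ⟨hA, hC, h1, h2, h3, h4⟩ := o
  refine near_clique (X := A ∩ C) (m := 4 * h) hu hv huv Finset.inter_subset_left ?_ ?_ ?_
  · intro a ha b hb
    have a1 := dg_sdiff' (G := G) a C A
    have a2 := dg_sdiff' (G := G) b C A
    have a3 := hC a (Finset.mem_inter.1 ha).2
    have a4 := hC b (Finset.mem_inter.1 hb).2
    have a5 : A.card ≤ C.card + (A \ C).card := by
      have := Finset.card_sdiff_add_card_inter A C
      have : (A ∩ C).card ≤ C.card := Finset.card_le_card Finset.inter_subset_right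
      omega
    omega
  · rw [Finset.sdiff_inter_self_left]; exact h1
  · intro x hx
    have a1 := dg_sdiff' (G := G) x C A
    have a3 := hA x hx
    omega

lemma SideOK.mono {C A : Finset V} {h : ℕ} (o : SideOK G C A h 2) : SideOK G C A h 3 :=
  ⟨o.hA, o.hC, o.h1, o.h2.trans (by omega), o.h3, o.h4⟩

lemma longSide {C D A B : Finset V} {h : ℕ} (o1 : SideOK G C A h 2) (o2 : SideOK G D B h 2)
    (hd : Disjoint A B) {u v a1 a2 b1 b2 : V} (hu : u ∈ A) (hv : v ∈ A) (ha1 : a1 ∈ A) (ha2 : a2 ∈ A)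
    (hb1 : b1 ∈ B) (hb2 : b2 ∈ B) (hua1 : u ≠ a1) (hua2 : u ≠ a2) (hva1 : v ≠ a1) (hva2 : v ≠ a2)
    (huv : u ≠ v) (haa : a1 ≠ a2) (hbb : b1 ≠ b2) (h1 : G.Adj a1 b1) (h2 : G.Adj a2 b2) :
    HamP G (A ∪ B) u v := by
  have hh := o1.h4
  have hc1 := o1.h2
  have hc3 := o1.h3
  obtain ⟨l, E1, E2, l1, l2, l3, l4, l5, -, -, l6⟩ := altfill (G := G) (h := h) (by omega) 1 C C u a1
    ({u, v, a1, a2} ∪ (C \ A)) o1.hC o1.hC (by omega) (by omega) (by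
      have := Finset.card_union_le {u, v, a1, a2} (C \ A)
      have := Finset.card_le_four (a := u) (b := v) (c := a1) (d := a2)
      omega) (by
      rw [if_neg (by omega)]
      have := o1.hA u hu
      have := o1.hA a1 ha1
      simp; omega)
  have hlC : ∀ x ∈ l, x ∈ C := by
    intro x hx
    have : x ∈ l.toFinset := by simpa using hx
    rw [l3, Finset.mem_union] at this
    exact this.elim (fun h => l4 h) (fun h => l5 h)
  have hlF : ∀ x ∈ l, x ∉ ({u, v, a1, a2} ∪ (C \ A) : Finset V) := by
    intro x hx
    exact Finset.disjoint_left.1 l6 (by simpa using hx)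
  have hlA : ∀ x ∈ l, x ∈ A ∧ x ≠ u ∧ x ≠ v ∧ x ≠ a1 ∧ x ≠ a2 := by
    intro x hx
    have q1 := hlF x hx
    have q2 := hlC x hx
    simp only [Finset.mem_union, Finset.mem_insert, Finset.mem_singleton, Finset.mem_sdiff, not_or] at q1
    tauto
  set Dd := insert u (insert a1 l.toFinset) with hDd
  have hDA : Dd ⊆ A := by
    intro x hx
    simp only [hDd, Finset.mem_insert, List.mem_toFinset] at hx
    rcases hx with hx | hx | hx
    · rw [hx]; exact hu
    · rw [hx]; exact ha1
    · exact (hlA x hx).1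
  have hDc : Dd.card ≤ 4 := by
    have e1 := Finset.card_insert_le u (insert a1 l.toFinset)
    have e2 := Finset.card_insert_le a1 l.toFinset
    have := List.toFinset_card_le l
    rw [← hDd] at e1
    omega
  have H1 : HamP G Dd u a1 := l1.ham (fun hx => (hlA u hx).2.1 rfl) (fun hx => (hlA a1 hx).2.2.2.1 rfl) hua1
  have H2 : HamP G B b1 b2 := o2.mono.ham hb1 hb2 hbb
  have H3 : HamP G (A \ Dd) a2 v := by
    refine SideOK.ham (C := C) (h := h) ⟨fun x hx => o1.hA x (Finset.mem_sdiff.1 hx).1, o1.hC, ?_, ?_, o1.h3, o1.h4⟩ ?_ ?_ hva2.symm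
    · refine le_trans (Finset.card_le_card ?_) o1.h1
      intro x; simp; tauto
    · have : C \ (A \ Dd) ⊆ (C \ A) ∪ Dd := by
        intro x; simp only [Finset.mem_sdiff, Finset.mem_union]; tauto
      have e1 := Finset.card_le_card this
      have e2 := Finset.card_union_le (C \ A) Dd
      omega
    · simp only [hDd, Finset.mem_sdiff, Finset.mem_insert, List.mem_toFinset, not_or]
      exact ⟨ha2, hua2.symm, haa.symm, fun hx => (hlA a2 hx).2.2.2.2 rfl⟩
    · simp only [hDd, Finset.mem_sdiff, Finset.mem_insert, List.mem_toFinset, not_or]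
      exact ⟨hv, huv.symm, hva1, fun hx => (hlA v hx).2.2.1 rfl⟩
  have H4 := (H1.append H2 h1 (hd.mono_left hDA)).append H3 h2.symm (by
    rw [Finset.disjoint_union_left]
    exact ⟨Finset.disjoint_sdiff, (hd.mono_left Finset.sdiff_subset).symm⟩)
  convert H4 using 1
  ext x
  simp only [Finset.mem_union, Finset.mem_sdiff]
  have := @hDA x
  tauto

variable [Fintype V] [Fintype ι]

structure CA (G : SimpleGraph V) (C1 C2 T : Finset V) (k h : ℕ) : Prop where
  f : Frame G C1 C2 T k h
  own1 : ∀ x ∈ C1, C1.card ≤ dg G x C1 + 6 * h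
  own2 : ∀ x ∈ C2, C2.card ≤ dg G x C2 + 6 * h
  cr1 : ∀ x ∈ C1, dg G x C2 ≤ h
  cr2 : ∀ x ∈ C2, dg G x C1 ≤ h

lemma CA.symm {C1 C2 T : Finset V} {k h : ℕ} (c : CA G C1 C2 T k h) : CA G C2 C1 T k h :=
  ⟨c.f.symm, c.own2, c.own1, c.cr2, c.cr1⟩

lemma longA {C1 C2 T S : Finset V} {k h : ℕ} (c : CA G C1 C2 T k h) (hS : (Finset.univ \ S).card ≤ h)
    {u v a1 a2 b1 b2 : V} (hu : u ∈ S) (hv : v ∈ S) (huv : u ≠ v) (ha1 : a1 ∈ S) (ha2 : a2 ∈ S)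
    (hb1 : b1 ∈ S) (hb2 : b2 ∈ S) (ua1 : u ≠ a1) (ua2 : u ≠ a2) (ub1 : u ≠ b1) (ub2 : u ≠ b2)
    (va1 : v ≠ a1) (va2 : v ≠ a2) (vb1 : v ≠ b1) (vb2 : v ≠ b2) (haa : a1 ≠ a2) (hbb : b1 ≠ b2)
    (a1b1 : a1 ≠ b1) (a1b2 : a1 ≠ b2) (a2b1 : a2 ≠ b1) (a2b2 : a2 ≠ b2) (e1 : G.Adj a1 b1) (e2 : G.Adj a2 b2)
    (da1 : 20 * h ≤ dg G a1 C1) (da2 : 20 * h ≤ dg G a2 C1) (db1 : 20 * h ≤ dg G b1 C2)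
    (db2 : 20 * h ≤ dg G b2 C2) : HamP G S u v := by
  have hk := c.f.hk
  have hkh := c.f.hkh
  have hn := c.f.hn
  have kh := c.f.kh
  have f1 := c.f.h1
  have f2 := c.f.h2
  have fc := c.f.cards
  have hrest : (Finset.univ \ (C1 ∪ C2)).card ≤ 3 * h := by
    have : (Finset.univ \ (C1 ∪ C2)).card + (C1.card + C2.card) = Fintype.card V := by
      rw [← Finset.card_union_of_disjoint c.f.hd, Finset.card_sdiff_add_card,
        Finset.union_eq_left.2 (Finset.subset_univ _), Finset.card_univ]
    omega
  set A := S.filter (fun x => x = a1 ∨ x = a2 ∨ (x ≠ b1 ∧ x ≠ b2 ∧ 20 * h ≤ dg G x C1)) with hAdef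
  have memA : ∀ x, x ∈ A ↔ x ∈ S ∧ (x = a1 ∨ x = a2 ∨ (x ≠ b1 ∧ x ≠ b2 ∧ 20 * h ≤ dg G x C1)) := by
    intro x; rw [hAdef, Finset.mem_filter]
  set B := S \ A with hBdef
  have memB : ∀ x, x ∈ B ↔ x ∈ S ∧ x ∉ A := by intro x; rw [hBdef, Finset.mem_sdiff]
  have hdAB : Disjoint A B := Finset.disjoint_sdiff
  have hAB : A ∪ B = S := Finset.union_sdiff_of_subset (Finset.filter_subset _ _)
  have mA1 : a1 ∈ A := (memA _).2 ⟨ha1, Or.inl rfl⟩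
  have mA2 : a2 ∈ A := (memA _).2 ⟨ha2, Or.inr (Or.inl rfl)⟩
  have mB1 : b1 ∈ B := (memB _).2 ⟨hb1, fun hh => by have := (memA _).1 hh; tauto⟩
  have mB2 : b2 ∈ B := (memB _).2 ⟨hb2, fun hh => by have := (memA _).1 hh; tauto⟩
  have hAhi : ∀ x ∈ A, 20 * h ≤ dg G x C1 := by
    intro x hx
    rcases ((memA x).1 hx).2 with h | h | h
    · rw [h]; exact da1
    · rw [h]; exact da2
    · exact h.2.2
  have hBcase : ∀ x ∈ B, x = b1 ∨ x = b2 ∨ dg G x C1 < 20 * h := by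
    intro x hx
    have q := (memB x).1 hx
    rw [memA] at q
    have : ¬ (20 * h ≤ dg G x C1) ↔ dg G x C1 < 20 * h := not_le
    tauto
  have hBhi : ∀ x ∈ B, 20 * h ≤ dg G x C2 := by
    intro x hx
    rcases hBcase x hx with h | h | h
    · rw [h]; exact db1
    · rw [h]; exact db2
    · have := c.f.symm.high (x := x) (by omega); omega
  have cov : ∀ (P Q Z : Finset V) (x y : V), (∀ w ∈ P, w ∈ Q ∨ w = x ∨ w = y) → Q.card ≤ Z.card →
      P.card ≤ Z.card + 2 := by
    intro P Q Z x y hP hQ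
    have : P ⊆ Q ∪ {x, y} := by
      intro w hw; have := hP w hw; simp only [Finset.mem_union, Finset.mem_insert, Finset.mem_singleton]; tauto
    have e1 := Finset.card_le_card this
    have e2 := Finset.card_union_le Q {x, y}
    have e3 := Finset.card_le_two (a := x) (b := y)
    omega
  have oA : SideOK G C1 A h 2 := by
    refine ⟨hAhi, c.own1, ?_, ?_, by omega, by omega⟩
    · have := cov (A \ C1) (Finset.univ \ (C1 ∪ C2)) _ a1 a2 (by
        intro w hw
        rw [Finset.mem_sdiff] at hw
        by_cases hw2 : w ∈ C2
        · have q := hAhi w hw.1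
          have := c.cr2 w hw2
          omega
        · left; simp [hw.2, hw2]) le_rfl
      omega
    · have := cov (C1 \ A) (Finset.univ \ S) _ b1 b2 (by
        intro w hw
        rw [Finset.mem_sdiff] at hw
        by_cases hwS : w ∈ S
        · rcases hBcase w ((memB w).2 ⟨hwS, hw.2⟩) with h1 | h1 | h1
          · tauto
          · tauto
          · have := c.own1 w hw.1; omega
        · left; simp [hwS]) le_rfl
      omega
  have oB : SideOK G C2 B h 2 := by
    refine ⟨hBhi, c.own2, ?_, ?_, by omega, by omega⟩
    · have := cov (B \ C2) (Finset.univ \ (C1 ∪ C2)) _ b1 b2 (by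
        intro w hw
        rw [Finset.mem_sdiff] at hw
        by_cases hw2 : w ∈ C1
        · rcases hBcase w hw.1 with h1 | h1 | h1
          · tauto
          · tauto
          · have := c.own1 w hw2; omega
        · left; simp [hw.2, hw2]) le_rfl
      omega
    · have := cov (C2 \ B) (Finset.univ \ S) _ a1 a2 (by
        intro w hw
        rw [Finset.mem_sdiff] at hw
        by_cases hwS : w ∈ S
        · have hwA : w ∈ A := by
            by_contra hwA; exact hw.2 ((memB w).2 ⟨hwS, hwA⟩)
          have := hAhi w hwA
          have := c.cr2 w hw.1
          omega
        · left; simp [hwS]) le_rfl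
      omega
  by_cases huA : u ∈ A
  · by_cases hvA : v ∈ A
    · have := longSide oA oB hdAB huA hvA mA1 mA2 mB1 mB2 ua1 ua2 va1 va2 huv haa hbb e1 e2
      rwa [hAB] at this
    · have hvB : v ∈ B := (memB v).2 ⟨hv, hvA⟩
      have := (oA.mono.ham huA mA1 ua1).append (oB.mono.ham mB1 hvB vb1.symm) e1 hdAB
      rwa [hAB] at this
  · have huB : u ∈ B := (memB u).2 ⟨hu, huA⟩
    by_cases hvA : v ∈ A
    · have := (oA.mono.ham hvA mA1 va1).append (oB.mono.ham mB1 huB ub1.symm) e1 hdAB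
      rw [hAB] at this
      exact this.symm
    · have hvB : v ∈ B := (memB v).2 ⟨hv, hvA⟩
      have := longSide oB oA hdAB.symm huB hvB mB1 mB2 mA1 mA2 ub1 ub2 vb1 vb2 huv hbb haa e1.symm e2.symm
      rwa [Finset.union_comm, hAB] at this

end HL

namespace HL
variable {V : Type} {G : SimpleGraph V} {ι : Type} [Fintype V] [Fintype ι]

section
variable {s t : ι → V} {m : ι → ℕ} {i0 : ι} {k e0 h : ℕ}

/-- gadget path: `σ ~ p ~ z`, then a filler inside `C` ending in `τ` -/
lemma gadFill {C : Finset V} {σ τ p z : V} {U : Finset V} {M : ℕ} (hh : 1 ≤ h)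
    (hC : ∀ x ∈ C, C.card ≤ dg G x C + 6 * h) (hC2 : 45 * h ≤ C.card)
    (h1 : G.Adj σ p) (h2 : G.Adj p z) (hz : 40 * h ≤ dg G z C) (hτ : C.card ≤ dg G τ C + 25 * h)
    (hp : p ∈ U) (hzU : z ∈ U) (hM : 3 ≤ M) (hU : U.card + M ≤ 3 * h) :
    ∃ l : List V, PI G σ τ l ∧ l.length = M ∧ Disjoint (l.toFinset \ {p, z}) U := by
  obtain ⟨l, E1, E2, l1, l2, l3, l4, l5, -, -, l6⟩ := altfill (G := G) (h := h) hh (M - 3) C C z τ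
    U hC hC (by omega) (by omega) (by omega) (by
      split_ifs
      · omega
      · omega
      · omega)
  have hl : ∀ x ∈ l, x ∉ U := fun x hx => Finset.disjoint_left.1 l6 (by simpa using hx)
  have a1 : PI G p τ (z :: l) := l1.cons h2 (fun hx => hl z hx hzU)
  have a2 : PI G σ τ (p :: z :: l) := a1.cons h1 (by
    intro hx
    rcases List.mem_cons.1 hx with hx | hx
    · exact h2.ne hx
    · exact hl p hx hp)
  refine ⟨_, a2, by simp; omega, ?_⟩
  rw [Finset.disjoint_left]
  intro x hx
  simp only [List.toFinset_cons, Finset.mem_sdiff, Finset.mem_insert, List.mem_toFinset,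
    Finset.mem_singleton, not_or] at hx
  exact hl x (by tauto)

lemma ownFill {C : Finset V} {σ τ : V} {U : Finset V} {M : ℕ} (hh : 1 ≤ h)
    (hC : ∀ x ∈ C, C.card ≤ dg G x C + 6 * h) (hC2 : 45 * h ≤ C.card)
    (hσ : 20 * h ≤ dg G σ C) (hτ : 20 * h ≤ dg G τ C)
    (hM : 3 ≤ M) (hU : U.card + M ≤ 3 * h) :
    ∃ l : List V, PI G σ τ l ∧ l.length = M ∧ Disjoint (l.toFinset \ ∅) U := by
  obtain ⟨l, E1, E2, l1, l2, l3, l4, l5, -, -, l6⟩ := altfill (G := G) (h := h) hh (M - 1) C C σ τ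
    U hC hC (by omega) (by omega) (by omega) (by
      rw [if_neg (by omega)]
      split_ifs
      · exact ⟨hσ, hτ⟩
      · exact ⟨hσ, hτ⟩)
  exact ⟨l, l1, by omega, by simpa using l6⟩

lemma afterA (c : Ctx G s t m i0 k e0 h) {C1 C2 : Finset V} (ca : CA G C1 C2 (TT s t) k h)
    {cr : Finset ι} (hcr : ∀ i ∈ cr, i ≠ i0)
    (hnc : ∀ i, i ≠ i0 → i ∉ cr → (20 * h ≤ dg G (s i) C1 ∧ 20 * h ≤ dg G (t i) C1) ∨
      (20 * h ≤ dg G (s i) C2 ∧ 20 * h ≤ dg G (t i) C2))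
    {p z : ι ⊕ Bool → V}
    (H : ∀ i ∈ cr.disjSum (Finset.univ : Finset Bool), p i ∈ C1 ∧ G.Adj (p i) (z i) ∧ p i ∉ TT s t ∧
      z i ∉ TT s t ∧ 40 * h ≤ dg G (z i) C2)
    (Hσ : ∀ i ∈ cr, (G.Adj (s i) (p (Sum.inl i)) ∧ dg G (t i) C1 < 20 * h) ∨
      (G.Adj (t i) (p (Sum.inl i)) ∧ dg G (s i) C1 < 20 * h))
    (Hd : ∀ i ∈ cr.disjSum (Finset.univ : Finset Bool), ∀ j ∈ cr.disjSum (Finset.univ : Finset Bool),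
      i ≠ j → Disjoint ({p i, z i} : Finset V) {p j, z j}) :
    Goal G s t m i0 := by
  have hk := ca.f.hk
  have hkh := ca.f.hkh
  have hn := ca.f.hn
  have kh := ca.f.kh
  have f1 := ca.f.h1
  have f2 := ca.f.h2
  have hTc := c.T_card
  have hsum := c.hsum
  have he := c.he
  set F := cr.disjSum (Finset.univ : Finset Bool) with hF
  have hFc : F.card ≤ k + 2 := by
    rw [hF, Finset.card_disjSum]
    have : cr.card ≤ k := by rw [← c.hk]; exact Finset.card_le_univ _
    simp; omega
  set U0 := TT s t ∪ F.biUnion (fun i => {p i, z i}) with hU0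
  have hU0c : U0.card ≤ 8 * k := by
    have e1 := Finset.card_union_le (TT s t) (F.biUnion (fun i => {p i, z i}))
    have e2 := Finset.card_biUnion_le_card_mul F (fun i => ({p i, z i} : Finset V)) 2
      (fun i _ => Finset.card_le_two)
    rw [← hU0] at e1
    omega
  set W := TT s t ∪ (Finset.univ : Finset Bool).biUnion (fun b => {p (Sum.inr b), z (Sum.inr b)}) with hW
  have inrF : ∀ b : Bool, (Sum.inr b : ι ⊕ Bool) ∈ F := by intro b; simp [hF]
  have inlF : ∀ i ∈ cr, (Sum.inl i : ι ⊕ Bool) ∈ F := by intro b; simp [hF]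
  have gU : ∀ i ∈ F, ({p i, z i} : Finset V) ⊆ U0 := fun i hi =>
    (Finset.subset_biUnion_of_mem (fun i => ({p i, z i} : Finset V)) hi).trans Finset.subset_union_right
  have hWU : W ⊆ U0 := by
    rw [hW]
    refine Finset.union_subset Finset.subset_union_left ?_
    rw [Finset.biUnion_subset]
    intro b _
    exact gU _ (inrF b)
  obtain ⟨l, hl1, hl2⟩ := fillFam (F := Finset.univ.erase i0) (W := W) (U0 := U0)
    (gad := fun i => if i ∈ cr then {p (Sum.inl i), z (Sum.inl i)} else ∅) (m := m) (B := 3 * h)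
    (fun i l => PI G (s i) (t i) l) hWU (by
      intro i hi
      split_ifs with hic
      · refine ⟨gU _ (inlF i hic), ?_⟩
        rw [hW, Finset.disjoint_union_right]
        constructor
        · obtain ⟨-, -, q1, q2, -⟩ := H _ (inlF i hic)
          simp [q1, q2]
        · rw [Finset.disjoint_biUnion_right]
          intro b _
          exact Hd _ (inlF i hic) _ (inrF b) (by simp)
      · simp) (by
      intro i hi j hj hij
      split_ifs with h1 h2
      · exact Hd _ (inlF i h1) _ (inlF j h2) (by simpa using hij)
      · simp
      · simp
      · simp) (by omega) (by
      intro i hi U hU hUc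
      have hi0 : i ≠ i0 := Finset.ne_of_mem_erase hi
      have hm := c.hm i hi0
      split_ifs with hic
      · obtain ⟨q1, q2, -, -, q3⟩ := H _ (inlF i hic)
        have pU := hU (gU _ (inlF i hic) (Finset.mem_insert_self _ _))
        have zU := hU (gU _ (inlF i hic) (Finset.mem_insert_of_mem (Finset.mem_singleton_self _)))
        rcases Hσ i hic with ⟨w1, w2⟩ | ⟨w1, w2⟩
        · exact gadFill (by omega) ca.own2 (by omega) w1 q2 q3 (ca.f.symm.near w2) pU zU hm hUc
        · obtain ⟨l, y1, y2, y3⟩ := gadFill (by omega) ca.own2 (by omega) w1 q2 q3 (ca.f.symm.near w2) pU zU hm hUc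
          exact ⟨l.reverse, y1.reverse, by simpa using y2, by simpa using y3⟩
      · rcases hnc i hi0 hic with ⟨w1, w2⟩ | ⟨w1, w2⟩
        · exact ownFill (by omega) ca.own1 (by omega) w1 w2 hm hUc
        · exact ownFill (by omega) ca.own2 (by omega) w1 w2 hm hUc)
  have fam : Fam G s t m i0 l := by
    refine ⟨fun i hi => ?_, fun i j hi hj hij => ?_⟩
    · obtain ⟨q1, q2, q3⟩ := hl1 i (by simp [hi])
      exact ⟨q1, q2, q3.mono_right Finset.subset_union_left⟩
    · exact hl2 i (by simp [hi]) j (by simp [hj]) hij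
  refine ⟨l, fam, ?_⟩
  have hRW : ∀ b : Bool, ∀ x ∈ ({p (Sum.inr b), z (Sum.inr b)} : Finset V), x ∉ RR s t i0 l := by
    intro b x hx
    simp only [RR, Finset.mem_union, Finset.mem_biUnion, not_or, Finset.mem_sdiff]
    constructor
    · rintro ⟨i, hi, hxi⟩
      refine Finset.disjoint_left.1 (hl1 i hi).2.2 hxi ?_
      exact Finset.mem_union_right _ (Finset.mem_biUnion.2 ⟨b, Finset.mem_univ _, hx⟩)
    · obtain ⟨-, -, q1, q2, -⟩ := H _ (inrF b)
      rintro ⟨q, -⟩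
      simp only [Finset.mem_insert, Finset.mem_singleton] at hx
      rcases hx with rfl | rfl
      · exact q1 q
      · exact q2 q
  have hne : ∀ b : Bool, ∀ i, s i ≠ p (Sum.inr b) ∧ s i ≠ z (Sum.inr b) ∧ t i ≠ p (Sum.inr b) ∧
      t i ≠ z (Sum.inr b) := by
    intro b i
    obtain ⟨-, -, q1, q2, -⟩ := H _ (inrF b)
    have := s_mem (s := s) (t := t) i
    have := t_mem (s := s) (t := t) i
    refine ⟨?_, ?_, ?_, ?_⟩ <;> intro hh <;> simp_all
  have hdd := Hd _ (inrF true) _ (inrF false) (by simp)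
  simp only [Finset.disjoint_insert_left, Finset.disjoint_singleton_left, Finset.mem_insert,
    Finset.mem_singleton, not_or] at hdd
  have hR := fam.R_le c
  have T1 := H _ (inrF true)
  have T2 := H _ (inrF false)
  have o1 := ca.own1 _ T1.1
  have o2 := ca.own1 _ T2.1
  have memS : ∀ x, x ∉ RR s t i0 l → x ∈ Finset.univ \ RR s t i0 l := by intro x hx; simp [hx]
  refine longA ca (a1 := p (Sum.inr true)) (a2 := p (Sum.inr false)) (b1 := z (Sum.inr true))
    (b2 := z (Sum.inr false)) ?_ (memS _ (fam.notMem (Or.inl rfl))) (memS _ (fam.notMem (Or.inr rfl)))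
    (c.hst i0) (memS _ (hRW true _ (by simp))) (memS _ (hRW false _ (by simp)))
    (memS _ (hRW true _ (by simp))) (memS _ (hRW false _ (by simp)))
    (hne true i0).1 (hne false i0).1 (hne true i0).2.1 (hne false i0).2.1
    (hne true i0).2.2.1 (hne false i0).2.2.1 (hne true i0).2.2.2 (hne false i0).2.2.2
    hdd.1.1 hdd.2.2 T1.2.1.ne hdd.1.2 (fun hh => hdd.2.1 hh.symm) T2.2.1.ne T1.2.1 T2.2.1
    (by omega) (by omega) (by omega) (by omega)
  have : Finset.univ \ (Finset.univ \ RR s t i0 l) = RR s t i0 l := by ext x; simp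
  rw [this]; omega

lemma caseA (c : Ctx G s t m i0 k e0 h) (h2 : TwoCl G (50 * e0)) : Goal G s t m i0 := by
  obtain ⟨X, Y, hd, hX, hY, hXY⟩ := h2
  have hk := c.hk1
  have hTc := c.T_card
  have hsum := c.hsum
  have he := c.he
  have hn := c.hn
  have kh : h ≤ k * h := Nat.le_mul_of_pos_left h hk
  set Y' := Y.filter (fun y => dg G y X ≤ h) with hY'
  have hYc : (Y \ Y').card ≤ h := by
    have e1 := dbl (G := G) (B := Y \ Y') (X := X) (a := h) (b := 50 * e0) (by
      intro y hy
      simp only [hY', Finset.mem_sdiff, Finset.mem_filter, not_and, not_le] at hy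
      exact (hy.2 hy.1).le) (by
      intro x hx
      exact (dg_mono x Finset.sdiff_subset).trans (hXY x hx))
    have e2 : X.card * (50 * e0) ≤ h * h := by
      refine le_trans ?_ c.hg
      rw [mul_comm]; exact Nat.mul_le_mul_left _ (Finset.card_le_univ _)
    exact Nat.le_of_mul_le_mul_right (e1.trans e2) (by omega)
  have hYY : Y.card ≤ Y'.card + h := by
    have := Finset.card_sdiff_add_card Y Y'
    rw [Finset.union_eq_left.2 (Finset.filter_subset _ _)] at this
    omega
  have fr : Frame G X Y' (TT s t) k h :=
    ⟨hd.mono_right (Finset.filter_subset _ _), by omega, by omega, hk, by omega, hn, c.hdeg⟩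
  have cr1 : ∀ x ∈ X, dg G x Y' ≤ h := fun x hx =>
    ((dg_mono x (Finset.filter_subset _ _)).trans (hXY x hx)).trans (by omega)
  have cr2 : ∀ x ∈ Y', dg G x X ≤ h := fun x hx => (Finset.mem_filter.1 hx).2
  have ca : CA G X Y' (TT s t) k h := by
    refine ⟨fr, ?_, ?_, cr1, cr2⟩
    · intro x hx
      have := fr.dsum x; have := fr.cards; have := fr.h1; have := fr.h2; have := cr1 x hx
      omega
    · intro x hx
      have := fr.dsum x; have := fr.cards; have := fr.h1; have := fr.h2; have := cr2 x hx
      omega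
  set cr := (Finset.univ : Finset ι).filter (fun i => i ≠ i0 ∧
    ((dg G (s i) Y' < 20 * h ∧ dg G (t i) X < 20 * h) ∨ (dg G (s i) X < 20 * h ∧ dg G (t i) Y' < 20 * h)))
    with hcr
  have memcr : ∀ i, i ∈ cr ↔ i ≠ i0 ∧
    ((dg G (s i) Y' < 20 * h ∧ dg G (t i) X < 20 * h) ∨ (dg G (s i) X < 20 * h ∧ dg G (t i) Y' < 20 * h)) := by
    intro i; rw [hcr, Finset.mem_filter]; simp
  have hi1 : ∀ x, dg G x Y' < 20 * h → 20 * h ≤ dg G x X := by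
    intro x hx; have := fr.high (x := x) (by omega); omega
  have hi2 : ∀ x, dg G x X < 20 * h → 20 * h ≤ dg G x Y' := by
    intro x hx; have := fr.symm.high (x := x) (by omega); omega
  have hnc : ∀ i, i ≠ i0 → i ∉ cr → (20 * h ≤ dg G (s i) X ∧ 20 * h ≤ dg G (t i) X) ∨
      (20 * h ≤ dg G (s i) Y' ∧ 20 * h ≤ dg G (t i) Y') := by
    intro i hi hic
    rw [memcr] at hic
    have q1 := hi1 (s i); have q2 := hi2 (s i); have q3 := hi1 (t i); have q4 := hi2 (t i)
    by_cases a1 : dg G (s i) X < 20 * h <;> by_cases a2 : dg G (t i) X < 20 * h <;>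
    by_cases a3 : dg G (s i) Y' < 20 * h <;> by_cases a4 : dg G (t i) Y' < 20 * h <;>
    first
      | exact Or.inl ⟨by omega, by omega⟩
      | exact Or.inr ⟨by omega, by omega⟩
      | (exfalso; tauto)
  set σ1 : ι → V := fun i => if dg G (s i) X < 20 * h then t i else s i with hσ1
  set σ2 : ι → V := fun i => if dg G (s i) X < 20 * h then s i else t i with hσ2
  have hσ1' : ∀ i ∈ cr, dg G (σ1 i) Y' < 20 * h := by
    intro i hi
    have := (memcr i).1 hi
    have := hi1 (s i); have := hi2 (s i)
    simp only [hσ1]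
    split_ifs <;> omega
  have hσ2' : ∀ i ∈ cr, dg G (σ2 i) X < 20 * h := by
    intro i hi
    have := (memcr i).1 hi
    have := hi1 (s i); have := hi2 (s i)
    simp only [hσ2]
    split_ifs <;> omega
  have hcrc : cr.card ≤ k := by rw [← c.hk]; exact Finset.card_le_univ _
  have hgad := fr.gadget (F := cr.disjSum (Finset.univ : Finset Bool))
    (S1 := Sum.elim (fun i => X.filter (G.Adj (σ1 i))) (fun _ => X))
    (S2 := Sum.elim (fun i => Y'.filter (G.Adj (σ2 i))) (fun _ => Y')) (U0 := TT s t) (κ := 1) (by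
      rintro (i | b) hi
      · have := fr.near (hσ1' i (by simpa using hi))
        exact ⟨Finset.filter_subset _ _, this⟩
      · exact ⟨subset_rfl, by simp⟩) (by
      rintro (i | b) hi
      · have := fr.symm.near (hσ2' i (by simpa using hi))
        exact ⟨Finset.filter_subset _ _, this⟩
      · exact ⟨subset_rfl, by simp⟩) subset_rfl (by
      rw [Finset.card_disjSum]; simp; omega) (by
      intro p hp; right; have := cr1 p hp; omega) (by
      right
      refine ⟨rfl, ?_, ?_⟩
      · intro p hp
        rw [Frame.mem_L]
        have := ca.own1 p hp; have := th_le (T := TT s t) (h := h) p; have := fr.h1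
        omega
      · intro p hp
        rw [Frame.mem_L]
        have := ca.own2 p hp; have := th_le (T := TT s t) (h := h) p; have := fr.h2
        omega) (by
      rw [Finset.card_disjSum]
      have hss : TT s t ∩ (Finset.univ \ (Frame.L G X (TT s t) h ∪ Frame.L G Y' (TT s t) h)) ⊆
          (Finset.univ \ cr).image s ∪ (Finset.univ \ cr).image t := by
        intro x hx
        rw [Finset.mem_inter, Finset.mem_sdiff, Finset.mem_union, Frame.mem_L, Frame.mem_L] at hx
        obtain ⟨hxT, -, hx2⟩ := hx
        simp only [th, if_pos hxT, not_or, not_lt] at hx2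
        simp only [TT, Finset.mem_union, Finset.mem_image, Finset.mem_univ, true_and] at hxT
        simp only [Finset.mem_union, Finset.mem_image, Finset.mem_sdiff, Finset.mem_univ, true_and]
        rcases hxT with ⟨i, rfl⟩ | ⟨i, rfl⟩
        · refine Or.inl ⟨i, fun hi => ?_, rfl⟩
          have := (memcr i).1 hi; omega
        · refine Or.inr ⟨i, fun hi => ?_, rfl⟩
          have := (memcr i).1 hi; omega
      have e1 := Finset.card_le_card hss
      have e2 := Finset.card_union_le ((Finset.univ \ cr).image s) ((Finset.univ \ cr).image t)
      have e3 : ((Finset.univ \ cr).image s).card ≤ _ := Finset.card_image_le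
      have e4 : ((Finset.univ \ cr).image t).card ≤ _ := Finset.card_image_le
      have e5 : (Finset.univ \ cr).card + cr.card = k := by
        rw [Finset.card_sdiff_add_card, Finset.union_eq_left.2 (Finset.subset_univ _), Finset.card_univ, c.hk]
      have : (Finset.univ : Finset Bool).card = 2 := by simp
      omega)
  rcases hgad with ⟨p, z, H, Hd⟩ | ⟨p, z, H, Hd⟩
  · refine afterA c ca (cr := cr) (fun i hi => ((memcr i).1 hi).1) hnc (p := p) (z := z) ?_ ?_ Hd
    · rintro (i | b) hi
      · obtain ⟨q1, q2⟩ := H _ hi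
        exact ⟨(Finset.mem_filter.1 q1).1, q2⟩
      · exact H _ hi
    · intro i hi
      have q := (Finset.mem_filter.1 (H (Sum.inl i) (by simpa using hi)).1).2
      have q2 := hσ2' i hi
      simp only [hσ1, hσ2] at q q2
      split_ifs at q q2 with hc
      · exact Or.inr ⟨q, q2⟩
      · exact Or.inl ⟨q, q2⟩
  · refine afterA c ca.symm (cr := cr) (fun i hi => ((memcr i).1 hi).1) (fun i a b => (hnc i a b).symm)
      (p := p) (z := z) ?_ ?_ Hd
    · rintro (i | b) hi
      · obtain ⟨q1, q2⟩ := H _ hi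
        exact ⟨(Finset.mem_filter.1 q1).1, q2⟩
      · exact H _ hi
    · intro i hi
      have q := (Finset.mem_filter.1 (H (Sum.inl i) (by simpa using hi)).1).2
      have q2 := hσ1' i hi
      simp only [hσ1, hσ2] at q q2
      split_ifs at q q2 with hc
      · exact Or.inl ⟨q, q2⟩
      · exact Or.inr ⟨q, q2⟩

end
end HL

namespace HL
variable {V : Type} {G : SimpleGraph V} {ι : Type} [Fintype V] [Fintype ι]

section
variable {s t : ι → V} {m : ι → ℕ} {i0 : ι} {k e0 h : ℕ}

/-- number of ends of path `i` that are not low to `C` -/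
noncomputable def ee (G : SimpleGraph V) (s t : ι → V) (h : ℕ) (C : Finset V) (i : ι) : ℕ :=
  (if dg G (s i) C < 20 * h then 0 else 1) + (if dg G (t i) C < 20 * h then 0 else 1)

lemma goodV (c : Ctx G s t m i0 k e0 h) {l : ι → List V} (f : Fam G s t m i0 l) {C : Finset V}
    (hC : ∀ a ∈ C, ∀ b ∈ C, ¬ G.Adj a b) {ζ : ι → ℤ}
    (hcount : ∀ i, i ≠ i0 → 2 * (((l i).toFinset \ C).card : ℤ) + ee G s t h C i ≤ m i + 2 + ζ i)
    (hζ : ∑ i ∈ Finset.univ.erase i0, ζ i ≤ 1) {x : V} (hx : x ∈ C)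
    (hT : ∀ τ ∈ TT s t, dg G τ C < 20 * h → ¬ G.Adj x τ) :
    (Finset.univ \ RR s t i0 l).card + 1 ≤ 2 * dg G x (Finset.univ \ RR s t i0 l) := by
  have hR := f.R_card
  set R := RR s t i0 l with hRdef
  set T' := TT s t \ {s i0, t i0} with hT'
  have hdeg := c.hdeg x
  have hScard : (Finset.univ \ R).card + R.card = Fintype.card V := by
    rw [Finset.card_sdiff_add_card, Finset.union_eq_left.2 (Finset.subset_univ _), Finset.card_univ]
  have q1 : dg G x Finset.univ ≤ dg G x (Finset.univ \ R) + dg G x R := by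
    refine le_trans (dg_mono x ?_) (dg_union x _ _)
    intro y _; simp
  set Tn := T'.filter (fun τ => ¬ dg G τ C < 20 * h) with hTn
  have q2 : dg G x R ≤ ∑ i ∈ Finset.univ.erase i0, ((l i).toFinset \ C).card + Tn.card := by
    have : R.filter (G.Adj x) ⊆ (Finset.univ.erase i0).biUnion (fun i => (l i).toFinset \ C) ∪ Tn := by
      intro y hy
      rw [Finset.mem_filter] at hy
      obtain ⟨hyR, hxy⟩ := hy
      rw [hRdef, RR, Finset.mem_union] at hyR
      rw [Finset.mem_union]
      rcases hyR with hyR | hyR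
      · left
        rw [Finset.mem_biUnion] at hyR ⊢
        obtain ⟨i, hi, hyi⟩ := hyR
        exact ⟨i, hi, Finset.mem_sdiff.2 ⟨hyi, fun hyC => hC x hx y hyC hxy⟩⟩
      · right
        rw [hTn, Finset.mem_filter]
        exact ⟨hyR, fun hlow => hT y (Finset.mem_sdiff.1 hyR).1 hlow hxy⟩
    refine (Finset.card_le_card this).trans ((Finset.card_union_le _ _).trans ?_)
    exact Nat.add_le_add_right Finset.card_biUnion_le _
  have q3 : Tn.card ≤ ∑ i ∈ Finset.univ.erase i0, ee G s t h C i := by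
    have : Tn ⊆ (Finset.univ.erase i0).biUnion
        (fun i => ({s i, t i} : Finset V).filter (fun τ => ¬ dg G τ C < 20 * h)) := by
      intro y hy
      rw [hTn, Finset.mem_filter, hT', Finset.mem_sdiff] at hy
      obtain ⟨⟨hyT, hy0⟩, hyl⟩ := hy
      simp only [TT, Finset.mem_union, Finset.mem_image, Finset.mem_univ, true_and] at hyT
      simp only [Finset.mem_insert, Finset.mem_singleton, not_or] at hy0
      rw [Finset.mem_biUnion]
      rcases hyT with ⟨i, hi⟩ | ⟨i, hi⟩
      · refine ⟨i, ?_, ?_⟩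
        · rw [Finset.mem_erase]; exact ⟨fun hh => hy0.1 (by rw [← hi, hh]), Finset.mem_univ _⟩
        · rw [Finset.mem_filter]; exact ⟨by simp [hi], hyl⟩
      · refine ⟨i, ?_, ?_⟩
        · rw [Finset.mem_erase]; exact ⟨fun hh => hy0.2 (by rw [← hi, hh]), Finset.mem_univ _⟩
        · rw [Finset.mem_filter]; exact ⟨by simp [hi], hyl⟩
    refine (Finset.card_le_card this).trans (Finset.card_biUnion_le.trans (Finset.sum_le_sum ?_))
    intro i _
    rw [Finset.filter_insert, Finset.filter_singleton, ee]
    split_ifs <;> simp_all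
    exact Finset.card_le_two
  have q4 : Tn.card ≤ T'.card := Finset.card_filter_le _ _
  have q5 : 2 * ((∑ i ∈ Finset.univ.erase i0, ((l i).toFinset \ C).card : ℕ) : ℤ) +
      (∑ i ∈ Finset.univ.erase i0, ee G s t h C i : ℕ) ≤
      (∑ i ∈ Finset.univ.erase i0, m i : ℕ) + 2 * ((k : ℤ) - 1) + ∑ i ∈ Finset.univ.erase i0, ζ i := by
    have hcard : ((Finset.univ.erase i0).card : ℤ) = (k : ℤ) - 1 := by
      rw [Finset.card_erase_of_mem (Finset.mem_univ _), Finset.card_univ, c.hk]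
      have := c.hk1
      omega
    have := Finset.sum_le_sum (s := Finset.univ.erase i0) (fun i hi => hcount i (Finset.ne_of_mem_erase hi))
    simp only [Finset.sum_add_distrib, ← Finset.mul_sum, Finset.sum_const, nsmul_eq_mul, hcard] at this
    push_cast
    linarith
  omega

lemma twoGood (c : Ctx G s t m i0 k e0 h) {l : ι → List V} (f : Fam G s t m i0 l) {C I : Finset V}
    (hC : ∀ a ∈ C, ∀ b ∈ C, ¬ G.Adj a b) {ζ : ι → ℤ}
    (hcount : ∀ i, i ≠ i0 → 2 * (((l i).toFinset \ C).card : ℤ) + ee G s t h C i ≤ m i + 2 + ζ i)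
    (hζ : ∑ i ∈ Finset.univ.erase i0, ζ i ≤ 1)
    (hI : 40 * (k * h) + 2 ≤ (I ∩ C).card)
    (hI2 : ∀ a ∈ I, ∀ b ∈ I, a ≠ b → dg G a (Finset.univ \ RR s t i0 l) + dg G b (Finset.univ \ RR s t i0 l)
        ≤ (Finset.univ \ RR s t i0 l).card) : False := by
  set Bd := ((TT s t).filter (fun τ => dg G τ C < 20 * h)).biUnion (fun τ => C.filter (G.Adj τ)) with hBd
  have hb : Bd.card ≤ 40 * (k * h) := by
    refine (Finset.card_biUnion_le_card_mul _ _ (20 * h) ?_).trans ?_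
    · intro τ hτ; exact (Finset.mem_filter.1 hτ).2.le
    · refine (Nat.mul_le_mul_right (20 * h) ((Finset.card_filter_le _ _).trans c.T_card)).trans ?_
      apply le_of_eq; ring
  have good : ∀ x ∈ C, x ∉ Bd → (Finset.univ \ RR s t i0 l).card + 1 ≤ 2 * dg G x (Finset.univ \ RR s t i0 l) := by
    intro x hx hxB
    refine goodV c f hC hcount hζ hx ?_
    intro τ hτ hlow hadj
    refine hxB (Finset.mem_biUnion.2 ⟨τ, Finset.mem_filter.2 ⟨hτ, hlow⟩, Finset.mem_filter.2 ⟨hx, hadj.symm⟩⟩)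
  obtain ⟨a, ha, haB⟩ := ex_notMem (S := I ∩ C) (F := Bd) (by omega)
  obtain ⟨b, hb', hbB⟩ := ex_notMem (S := I ∩ C) (F := insert a Bd) (by
    have := Finset.card_insert_le a Bd; omega)
  rw [Finset.mem_insert, not_or] at hbB
  rw [Finset.mem_inter] at ha hb'
  have g1 := good a ha.2 haB
  have g2 := good b hb'.2 hbB.2
  have := hI2 a ha.1 b hb'.1 (fun hh => hbB.1 hh.symm)
  omega

lemma finalB (c : Ctx G s t m i0 k e0 h) (hTw : ¬ TwoCl G (50 * e0)) {P Y : Finset V}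
    (hP : Ind G (50 * e0) P) (hPY : Disjoint P Y)
    (hY : Ind G (50 * e0) Y ∨ ¬ ∃ I, Disjoint P I ∧ Ind G (50 * e0) I)
    {l : ι → List V} (f : Fam G s t m i0 l) {ξ : ι → ℤ}
    (h1 : ∀ i, i ≠ i0 → 2 * (((l i).toFinset \ P).card : ℤ) + ee G s t h P i ≤ m i + 2 + ξ i)
    (h2 : ∀ i, i ≠ i0 → 2 * (((l i).toFinset \ Y).card : ℤ) + ee G s t h Y i ≤ m i + 2 - ξ i)
    (hξ0 : 0 ≤ ∑ i ∈ Finset.univ.erase i0, ξ i) (hξ1 : ∑ i ∈ Finset.univ.erase i0, ξ i ≤ 1) :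
    Goal G s t m i0 := by
  refine ⟨l, f, ?_⟩
  rcases c.ham_S f with hh | hh | ⟨I, hIS, hI, hI2⟩
  · exact hh
  · exact absurd hh hTw
  exfalso
  have hk := c.hk1
  have hn := c.hn
  have he := c.he
  have hsum := c.hsum
  have kh : h ≤ k * h := Nat.le_mul_of_pos_left h hk
  have hPc := hP.2
  have hIc := hI.2
  by_cases hIP : Disjoint P I
  · have hYI : Ind G (50 * e0) Y := by
      rcases hY with hY | hY
      · exact hY
      · exact absurd ⟨I, hIP, hI⟩ hY
    refine twoGood c f hYI.1 (ζ := fun i => - ξ i) (I := I) ?_ ?_ ?_ hI2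
    · intro i hi; have := h2 i hi; linarith
    · rw [Finset.sum_neg_distrib]; omega
    · have hYc := hYI.2
      have e1 := Finset.card_union_add_card_inter I Y
      have e2 : (I ∪ Y).card + P.card ≤ Fintype.card V := by
        rw [← Finset.card_union_of_disjoint]
        · exact Finset.card_le_univ _
        · rw [Finset.disjoint_union_left]; exact ⟨hIP.symm, hPY.symm⟩
      omega
  · obtain ⟨x, hxP, hxI⟩ := Finset.not_disjoint_iff.1 hIP
    refine twoGood c f hP.1 h1 hξ1 (I := I) ?_ hI2
    have e1 := Finset.card_union_add_card_inter I P
    have e2 : (I ∪ P).card + dg G x Finset.univ ≤ Fintype.card V := by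
      rw [dg, ← Finset.card_union_of_disjoint]
      · exact Finset.card_le_univ _
      · rw [Finset.disjoint_left]
        intro y hy hy2
        have hxy := (Finset.mem_filter.1 hy2).2
        rcases Finset.mem_union.1 hy with hy | hy
        · exact hI.1 x hxI y hy hxy
        · exact hP.1 x hxP y hy hxy
    have := c.hdeg x
    omega

end
end HL

namespace HL
variable {V : Type} {G : SimpleGraph V} {ι : Type} [Fintype V] [Fintype ι]

section
variable {s t : ι → V} {m : ι → ℕ} {i0 : ι} {k e0 h : ℕ}

lemma ownFillB {C D : Finset V} {σ τ : V} {U : Finset V} {M : ℕ} (hh : 1 ≤ h)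
    (hC : ∀ x ∈ C, D.card ≤ dg G x D + 6 * h) (hD : ∀ x ∈ D, C.card ≤ dg G x C + 6 * h)
    (hC2 : 45 * h ≤ C.card) (hD2 : 45 * h ≤ D.card)
    (hσ : 20 * h ≤ dg G σ C) (hτ : 20 * h ≤ dg G τ (if M % 2 = 1 then C else D))
    (hM : 3 ≤ M) (hU : U.card + M ≤ 3 * h) :
    ∃ l : List V, PI G σ τ l ∧ l.length = M ∧ Disjoint (l.toFinset \ ∅) U ∧
      (l.toFinset \ C).card ≤ M / 2 ∧ (l.toFinset \ D).card ≤ (M + 1) / 2 := by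
  obtain ⟨l, E1, E2, l1, l2, l3, l4, l5, c1, c2, l6⟩ := altfill (G := G) (h := h) hh (M - 1) C D σ τ
    U hC hD (by omega) (by omega) (by omega) (by
      rw [if_neg (by omega)]
      refine ⟨hσ, ?_⟩
      by_cases hM2 : M % 2 = 1
      · rw [if_pos (by omega)]; rwa [if_pos hM2] at hτ
      · rw [if_neg (by omega)]; rwa [if_neg hM2] at hτ)
  refine ⟨l, l1, by omega, by simpa using l6, ?_, ?_⟩
  · have : l.toFinset \ C ⊆ E2 := by
      intro x hx
      rw [l3, Finset.mem_sdiff, Finset.mem_union] at hx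
      have := @l4 x
      tauto
    have := Finset.card_le_card this
    omega
  · have : l.toFinset \ D ⊆ E1 := by
      intro x hx
      rw [l3, Finset.mem_sdiff, Finset.mem_union] at hx
      have := @l5 x
      tauto
    have := Finset.card_le_card this
    omega

/-- gadget path: `σ ~ p ~ z` with `p ∈ D`, then an alternating filler starting and ending in `C` -/
lemma gadFillB {C D : Finset V} {σ τ p z : V} {U : Finset V} {M : ℕ} (hh : 1 ≤ h)
    (hC : ∀ x ∈ C, D.card ≤ dg G x D + 6 * h) (hD : ∀ x ∈ D, C.card ≤ dg G x C + 6 * h)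
    (hC2 : 45 * h ≤ C.card) (hD2 : 45 * h ≤ D.card) (hpD : p ∈ D)
    (h1 : G.Adj σ p) (h2 : G.Adj p z) (hz : 40 * h ≤ dg G z C) (hτ : C.card ≤ dg G τ C + 25 * h)
    (hp : p ∈ U) (hzU : z ∈ U) (hM : 3 ≤ M) (hM2 : M % 2 = 1) (hU : U.card + M ≤ 3 * h) :
    ∃ l : List V, PI G σ τ l ∧ l.length = M ∧ Disjoint (l.toFinset \ {p, z}) U ∧
      2 * (l.toFinset \ C).card ≤ M + 1 ∧ 2 * (l.toFinset \ D).card ≤ M + 1 := by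
  obtain ⟨l, E1, E2, l1, l2, l3, l4, l5, c1, c2, l6⟩ := altfill (G := G) (h := h) hh (M - 3) C D z τ
    U hC hD (by omega) (by omega) (by omega) (by
      split_ifs
      · omega
      · omega
      · omega)
  have hl : ∀ x ∈ l, x ∉ U := fun x hx => Finset.disjoint_left.1 l6 (by simpa using hx)
  have a1 : PI G p τ (z :: l) := l1.cons h2 (fun hx => hl z hx hzU)
  have a2 : PI G σ τ (p :: z :: l) := a1.cons h1 (by
    intro hx
    rcases List.mem_cons.1 hx with hx | hx
    · exact h2.ne hx
    · exact hl p hx hp)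
  refine ⟨_, a2, by simp; omega, ?_, ?_, ?_⟩
  · rw [Finset.disjoint_left]
    intro x hx
    simp only [List.toFinset_cons, Finset.mem_sdiff, Finset.mem_insert, List.mem_toFinset,
      Finset.mem_singleton, not_or] at hx
    exact hl x (by tauto)
  · have : (p :: z :: l).toFinset \ C ⊆ E2 ∪ {p, z} := by
      intro x hx
      rw [List.toFinset_cons, List.toFinset_cons, l3] at hx
      simp only [Finset.mem_sdiff, Finset.mem_insert, Finset.mem_union, Finset.mem_singleton] at hx ⊢
      have := @l4 x
      tauto
    have e1 := Finset.card_le_card this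
    have e2 := Finset.card_union_le E2 {p, z}
    have e3 := Finset.card_le_two (a := p) (b := z)
    omega
  · have : (p :: z :: l).toFinset \ D ⊆ E1 ∪ {z} := by
      intro x hx
      rw [List.toFinset_cons, List.toFinset_cons, l3] at hx
      simp only [Finset.mem_sdiff, Finset.mem_insert, Finset.mem_union, Finset.mem_singleton] at hx ⊢
      have := @l5 x
      rcases hx with ⟨rfl | hx, hx2⟩
      · exact absurd hpD hx2
      · tauto
    have e1 := Finset.card_le_card this
    have e2 := Finset.card_union_le E1 {z}
    have e3 := Finset.card_singleton z
    omega

lemma fillB (c : Ctx G s t m i0 k e0 h) {P Y : Finset V} (fr : Frame G P Y (TT s t) k h)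
    (hPY : ∀ x ∈ P, Y.card ≤ dg G x Y + 6 * h) (hYP : ∀ x ∈ Y, P.card ≤ dg G x P + 6 * h)
    {cr : Finset ι}
    (hnc : ∀ i, i ≠ i0 → i ∉ cr →
      (m i % 2 = 1 ∧ ((20 * h ≤ dg G (s i) P ∧ 20 * h ≤ dg G (t i) P) ∨
        (20 * h ≤ dg G (s i) Y ∧ 20 * h ≤ dg G (t i) Y))) ∨
      (m i % 2 = 0 ∧ ((20 * h ≤ dg G (s i) P ∧ 20 * h ≤ dg G (t i) Y) ∨
        (20 * h ≤ dg G (s i) Y ∧ 20 * h ≤ dg G (t i) P))))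
    (hcX : ∀ i ∈ cr, ¬ (20 * h ≤ dg G (s i) P ∧ 20 * h ≤ dg G (t i) P ∧
        20 * h ≤ dg G (s i) Y ∧ 20 * h ≤ dg G (t i) Y))
    {U2 : Finset V} (hT : TT s t ⊆ U2) (hU2 : U2.card ≤ 8 * k) {gad : ι → Finset V}
    (hg : ∀ i ∈ cr, gad i ⊆ U2 ∧ Disjoint (gad i) (TT s t))
    (hgd : ∀ i ∈ cr, ∀ j ∈ cr, i ≠ j → Disjoint (gad i) (gad j))
    (hstep : ∀ i ∈ cr, i ≠ i0 → ∀ U, U2 ⊆ U → U.card + m i ≤ 3 * h → ∃ l : List V, PI G (s i) (t i) l ∧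
      l.length = m i ∧ Disjoint (l.toFinset \ gad i) U ∧
      2 * (l.toFinset \ P).card + ee G s t h P i ≤ m i + 2 ∧
      2 * (l.toFinset \ Y).card + ee G s t h Y i ≤ m i + 2) :
    ∃ (l : ι → List V) (ξ : ι → ℤ), Fam G s t m i0 l ∧
    (∀ i, i ≠ i0 → 2 * (((l i).toFinset \ P).card : ℤ) + ee G s t h P i ≤ m i + 2 + ξ i) ∧
    (∀ i, i ≠ i0 → 2 * (((l i).toFinset \ Y).card : ℤ) + ee G s t h Y i ≤ m i + 2 - ξ i) ∧
    (0 ≤ ∑ i ∈ Finset.univ.erase i0, ξ i) ∧ (∑ i ∈ Finset.univ.erase i0, ξ i ≤ 1) := by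
  have hk := fr.hk
  have hkh := fr.hkh
  have hn := fr.hn
  have kh := fr.kh
  have f1 := fr.h1
  have f2 := fr.h2
  have hsum := c.hsum
  have he := c.he
  set O := (Finset.univ.erase i0).filter (fun i => m i % 2 = 1 ∧ 20 * h ≤ dg G (s i) P ∧
    20 * h ≤ dg G (t i) P ∧ 20 * h ≤ dg G (s i) Y ∧ 20 * h ≤ dg G (t i) Y) with hO
  have memO : ∀ i, i ∈ O ↔ i ≠ i0 ∧ (m i % 2 = 1 ∧ 20 * h ≤ dg G (s i) P ∧
    20 * h ≤ dg G (t i) P ∧ 20 * h ≤ dg G (s i) Y ∧ 20 * h ≤ dg G (t i) Y) := by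
    intro i; rw [hO, Finset.mem_filter]; simp
  obtain ⟨O', hO', hO'c⟩ := Finset.exists_subset_card_eq (s := O) (n := O.card / 2) (by omega)
  set ξ : ι → ℤ := fun i => if i ∈ O then (if i ∈ O' then -1 else 1) else 0 with hξ
  have hξsum : ∑ i ∈ Finset.univ.erase i0, ξ i = (O.card : ℤ) - 2 * (O.card / 2 : ℕ) := by
    have e1 : ∑ i ∈ Finset.univ.erase i0, ξ i = ∑ i ∈ O, ξ i := by
      symm
      refine Finset.sum_subset (Finset.filter_subset _ _) ?_
      intro i _ hi
      simp [hξ, hi]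
    have e2 : ∑ i ∈ O, ξ i = ∑ i ∈ O, (if i ∈ O' then (-1 : ℤ) else 1) := by
      refine Finset.sum_congr rfl fun i hi => ?_
      simp [hξ, hi]
    have e3 : O.filter (fun i => i ∈ O') = O' := by
      ext i; rw [Finset.mem_filter]; exact ⟨fun h => h.2, fun h => ⟨hO' h, h⟩⟩
    have e4 := Finset.card_filter_add_card_filter_not (s := O) (fun i => i ∈ O')
    rw [e1, e2, Finset.sum_ite, e3]
    rw [e3] at e4
    simp only [Finset.sum_const, nsmul_eq_mul]
    omega
  obtain ⟨l, hl1, hl2⟩ := fillFam (F := Finset.univ.erase i0) (W := TT s t) (U0 := U2)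
    (gad := fun i => if i ∈ cr then gad i else ∅) (m := m) (B := 3 * h)
    (fun i l => PI G (s i) (t i) l ∧
      2 * ((l.toFinset \ P).card : ℤ) + ee G s t h P i ≤ m i + 2 + ξ i ∧
      2 * ((l.toFinset \ Y).card : ℤ) + ee G s t h Y i ≤ m i + 2 - ξ i) hT (by
      intro i hi
      split_ifs with hic
      · exact hg i hic
      · simp) (by
      intro i hi j hj hij
      split_ifs with h1 h2
      · exact hgd i h1 j h2 hij
      · simp
      · simp
      · simp) (by omega) (by
      intro i hi U hU hUc
      have hi0 : i ≠ i0 := Finset.ne_of_mem_erase hi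
      have hm := c.hm i hi0
      split_ifs with hic
      · obtain ⟨l, y1, y2, y3, y4, y5⟩ := hstep i hic hi0 U hU hUc
        have hiO : i ∉ O := fun hh => hcX i hic ((memO i).1 hh).2.2
        refine ⟨l, ⟨y1, ?_, ?_⟩, y2, y3⟩
        · simp only [hξ, if_neg hiO]; omega
        · simp only [hξ, if_neg hiO]; omega
      · have startP : 20 * h ≤ dg G (s i) P → 20 * h ≤ dg G (t i) (if m i % 2 = 1 then P else Y) → _ :=
          fun a b => ownFillB (by omega) hPY hYP (by omega) (by omega) a b hm hUc
        have startY : 20 * h ≤ dg G (s i) Y → 20 * h ≤ dg G (t i) (if m i % 2 = 1 then Y else P) → _ :=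
          fun a b => ownFillB (by omega) hYP hPY (by omega) (by omega) a b hm hUc
        rcases hnc i hi0 hic with ⟨hodd, hh⟩ | ⟨hev, hh⟩
        · rw [if_pos hodd] at startP startY
          by_cases hiO : i ∈ O
          · obtain ⟨-, -, x1, x2, x3, x4⟩ := (memO i).1 hiO
            have e1 : ee G s t h P i = 2 := by simp only [ee]; split_ifs <;> omega
            have e2 : ee G s t h Y i = 2 := by simp only [ee]; split_ifs <;> omega
            by_cases hiO' : i ∈ O'
            · obtain ⟨l, y1, y2, y3, y4, y5⟩ := startP x1 x2
              refine ⟨l, ⟨y1, ?_, ?_⟩, y2, y3⟩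
              · simp only [hξ, if_pos hiO, if_pos hiO']; omega
              · simp only [hξ, if_pos hiO, if_pos hiO']; omega
            · obtain ⟨l, y1, y2, y3, y4, y5⟩ := startY x3 x4
              refine ⟨l, ⟨y1, ?_, ?_⟩, y2, y3⟩
              · simp only [hξ, if_pos hiO, if_neg hiO']; omega
              · simp only [hξ, if_pos hiO, if_neg hiO']; omega
          · have hO2 : ¬ (20 * h ≤ dg G (s i) P ∧ 20 * h ≤ dg G (t i) P ∧
              20 * h ≤ dg G (s i) Y ∧ 20 * h ≤ dg G (t i) Y) := fun hh => hiO ((memO i).2 ⟨hi0, hodd, hh⟩)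
            rcases hh with ⟨w1, w2⟩ | ⟨w1, w2⟩
            · obtain ⟨l, y1, y2, y3, y4, y5⟩ := startP w1 w2
              have e1 : ee G s t h P i = 2 := by simp only [ee]; split_ifs <;> omega
              have e2 : ee G s t h Y i ≤ 1 := by simp only [ee]; split_ifs <;> omega
              refine ⟨l, ⟨y1, ?_, ?_⟩, y2, y3⟩
              · simp only [hξ, if_neg hiO]; omega
              · simp only [hξ, if_neg hiO]; omega
            · obtain ⟨l, y1, y2, y3, y4, y5⟩ := startY w1 w2
              have e1 : ee G s t h P i ≤ 1 := by simp only [ee]; split_ifs <;> omega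
              have e2 : ee G s t h Y i = 2 := by simp only [ee]; split_ifs <;> omega
              refine ⟨l, ⟨y1, ?_, ?_⟩, y2, y3⟩
              · simp only [hξ, if_neg hiO]; omega
              · simp only [hξ, if_neg hiO]; omega
        · have hnot : ¬ m i % 2 = 1 := by omega
          have hiO : i ∉ O := fun hh => hnot ((memO i).1 hh).2.1
          rw [if_neg hnot] at startP startY
          have e1 : ee G s t h P i ≤ 2 := by simp only [ee]; split_ifs <;> omega
          have e2 : ee G s t h Y i ≤ 2 := by simp only [ee]; split_ifs <;> omega
          rcases hh with ⟨w1, w2⟩ | ⟨w1, w2⟩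
          · obtain ⟨l, y1, y2, y3, y4, y5⟩ := startP w1 w2
            refine ⟨l, ⟨y1, ?_, ?_⟩, y2, y3⟩
            · simp only [hξ, if_neg hiO]; omega
            · simp only [hξ, if_neg hiO]; omega
          · obtain ⟨l, y1, y2, y3, y4, y5⟩ := startY w1 w2
            refine ⟨l, ⟨y1, ?_, ?_⟩, y2, y3⟩
            · simp only [hξ, if_neg hiO]; omega
            · simp only [hξ, if_neg hiO]; omega)
  refine ⟨l, ξ, ⟨fun i hi => ?_, fun i j hi hj hij => ?_⟩, fun i hi => ?_, fun i hi => ?_, ?_, ?_⟩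
  · obtain ⟨q1, q2, q3⟩ := hl1 i (by simp [hi])
    exact ⟨q1.1, q2, q3⟩
  · exact hl2 i (by simp [hi]) j (by simp [hj]) hij
  · exact (hl1 i (by simp [hi])).1.2.1
  · exact (hl1 i (by simp [hi])).1.2.2
  · rw [hξsum]; omega
  · rw [hξsum]; omega

end
end HL

namespace HL
variable {V : Type} {G : SimpleGraph V} {ι : Type} [Fintype V] [Fintype ι]

section
variable {s t : ι → V} {m : ι → ℕ} {i0 : ι} {k e0 h : ℕ}

lemma PI.snoc {a c b : V} {l : List V} (h : PI G a c l) (hs : G.Adj c b) (hc : c ∉ l) :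
    PI G a b (l ++ [c]) := by
  have := (h.reverse.cons hs.symm (by simpa using hc)).reverse
  simpa using this

lemma snoc_sdiff (L : List V) (w : V) (P : Finset V) :
    ((L ++ [w]).toFinset \ P) ⊆ (L.toFinset \ P) ∪ ({w} \ P) := by
  intro x hx
  simp only [List.toFinset_append, Finset.mem_sdiff, Finset.mem_union, List.mem_toFinset,
    List.mem_singleton, Finset.mem_singleton] at hx ⊢
  tauto

lemma snoc_sdiff2 (L : List V) (w : V) (P : Finset V) :
    ((L ++ [w]).toFinset \ (P ∪ {w})) ⊆ L.toFinset \ P := by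
  intro x hx
  simp only [List.toFinset_append, Finset.mem_sdiff, Finset.mem_union, List.mem_toFinset,
    List.mem_singleton, Finset.mem_singleton] at hx ⊢
  tauto

set_option maxHeartbeats 4000000 in
lemma famB (c : Ctx G s t m i0 k e0 h) {P Y : Finset V} (fr : Frame G P Y (TT s t) k h)
    (hPY : ∀ x ∈ P, Y.card ≤ dg G x Y + 6 * h) (hYP : ∀ x ∈ Y, P.card ≤ dg G x P + 6 * h)
    (hlow : ∀ p ∈ P, dg G p P < 40 * h ∨ dg G p Y < 40 * h) :
    ∃ (l : ι → List V) (ξ : ι → ℤ), Fam G s t m i0 l ∧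
    (∀ i, i ≠ i0 → 2 * (((l i).toFinset \ P).card : ℤ) + ee G s t h P i ≤ m i + 2 + ξ i) ∧
    (∀ i, i ≠ i0 → 2 * (((l i).toFinset \ Y).card : ℤ) + ee G s t h Y i ≤ m i + 2 - ξ i) ∧
    (0 ≤ ∑ i ∈ Finset.univ.erase i0, ξ i) ∧ (∑ i ∈ Finset.univ.erase i0, ξ i ≤ 1) := by
  have hk := fr.hk
  have hkh := fr.hkh
  have hn := fr.hn
  have kh := fr.kh
  have f1 := fr.h1
  have f2 := fr.h2
  have hsum := c.hsum
  have he := c.he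
  have hTc := c.T_card
  have hi1 : ∀ x, dg G x Y < 20 * h → 20 * h ≤ dg G x P := by
    intro x hx; have := fr.high (x := x) (by omega); omega
  have hi2 : ∀ x, dg G x P < 20 * h → 20 * h ≤ dg G x Y := by
    intro x hx; have := fr.symm.high (x := x) (by omega); omega
  set cr := (Finset.univ : Finset ι).filter (fun i => i ≠ i0 ∧
    ((m i % 2 = 1 ∧ ((dg G (s i) P < 20 * h ∧ dg G (t i) Y < 20 * h) ∨
      (dg G (s i) Y < 20 * h ∧ dg G (t i) P < 20 * h))) ∨
    (m i % 2 = 0 ∧ ((dg G (s i) P < 20 * h ∧ dg G (t i) P < 20 * h) ∨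
      (dg G (s i) Y < 20 * h ∧ dg G (t i) Y < 20 * h))))) with hcr
  have memcr : ∀ i, i ∈ cr ↔ i ≠ i0 ∧
    ((m i % 2 = 1 ∧ ((dg G (s i) P < 20 * h ∧ dg G (t i) Y < 20 * h) ∨
      (dg G (s i) Y < 20 * h ∧ dg G (t i) P < 20 * h))) ∨
    (m i % 2 = 0 ∧ ((dg G (s i) P < 20 * h ∧ dg G (t i) P < 20 * h) ∨
      (dg G (s i) Y < 20 * h ∧ dg G (t i) Y < 20 * h)))) := by
    intro i; rw [hcr, Finset.mem_filter]; simp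
  have hcrc : cr.card ≤ k := by rw [← c.hk]; exact Finset.card_le_univ _
  -- stage 0
  haveI : Inhabited V := ⟨s i0⟩
  obtain ⟨w, hw1, hw2⟩ := greedy (cr.filter (fun i => m i % 2 = 0)) (fun _ (x : V) => {x})
    (fun i x => G.Adj (t i) x ∧ (dg G (s i) P < 20 * h → x ∈ Y) ∧ (¬ dg G (s i) P < 20 * h → x ∈ P))
    (TT s t) (fun J U => U.card ≤ 2 * k + J.card) (by simpa using hTc) (by
      intro i hi J hJ hiJ U hU hUc
      rw [Finset.mem_filter, memcr] at hi
      have hJc : J.card ≤ k := (Finset.card_le_card hJ).trans ((Finset.card_filter_le _ _).trans hcrc)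
      have hx : ∃ x, (G.Adj (t i) x ∧ (dg G (s i) P < 20 * h → x ∈ Y) ∧ (¬ dg G (s i) P < 20 * h → x ∈ P)) ∧
          x ∉ U := by
        by_cases ha : dg G (s i) P < 20 * h
        · have := hi2 (s i) ha
          have htl : dg G (t i) P < 20 * h := by omega
          have := fr.symm.near htl
          obtain ⟨x, x1, x2, x3⟩ := ex_nbr (G := G) (p := t i) (C := Y) (F := U) (by omega)
          exact ⟨x, ⟨x3, fun _ => x1, fun hh => absurd ha hh⟩, x2⟩
        · have htl : dg G (t i) Y < 20 * h := by omega
          have := fr.near htl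
          obtain ⟨x, x1, x2, x3⟩ := ex_nbr (G := G) (p := t i) (C := P) (F := U) (by omega)
          exact ⟨x, ⟨x3, fun hh => absurd hh ha, fun _ => x1⟩, x2⟩
      obtain ⟨x, hx, hxU⟩ := hx
      refine ⟨x, hx, by simpa using hxU, ?_⟩
      rw [Finset.card_insert_of_notMem hiJ]
      have := Finset.card_union_le U {x}
      rw [Finset.card_singleton] at this
      exact this.trans (by omega))
  set ww : ι → Finset V := fun i => if m i % 2 = 0 then {w i} else ∅ with hww
  have wwT : ∀ i ∈ cr, Disjoint (ww i) (TT s t) := by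
    intro i hi
    simp only [hww]
    split_ifs with hm
    · exact (hw1 i (Finset.mem_filter.2 ⟨hi, hm⟩)).2
    · simp
  have wwd : ∀ i ∈ cr, ∀ j ∈ cr, i ≠ j → Disjoint (ww i) (ww j) := by
    intro i hi j hj hij
    simp only [hww]
    split_ifs with h1 h2
    · exact hw2 i (Finset.mem_filter.2 ⟨hi, h1⟩) j (Finset.mem_filter.2 ⟨hj, h2⟩) hij
    · simp
    · simp
    · simp
  have wwc : (cr.biUnion ww).card ≤ cr.card * 1 := Finset.card_biUnion_le_card_mul _ _ _ (by
    intro i _; simp only [hww]; split_ifs <;> simp)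
  set U1 := TT s t ∪ cr.biUnion ww with hU1
  have hU1c : U1.card ≤ 3 * k := by
    have := Finset.card_union_le (TT s t) (cr.biUnion ww)
    rw [← hU1] at this; omega
  have wwU : ∀ i ∈ cr, ww i ⊆ U1 := fun i hi =>
    (Finset.subset_biUnion_of_mem ww hi).trans Finset.subset_union_right
  set v0 : ι → V := fun i => if m i % 2 = 0 then w i else t i with hv0
  set σ1 : ι → V := fun i => if dg G (s i) P < 20 * h then v0 i else s i with hσ1
  set σ2 : ι → V := fun i => if dg G (s i) P < 20 * h then s i else v0 i with hσ2
  have near1 : ∀ i ∈ cr, P.card ≤ dg G (σ1 i) P + 25 * h := by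
    intro i hi
    have hi' := (memcr i).1 hi
    have u1 := hi1 (s i)
    have u2 := hi2 (s i)
    simp only [hσ1, hv0]
    split_ifs with q1 q2
    · have := hYP _ ((hw1 i (Finset.mem_filter.2 ⟨hi, q2⟩)).1.2.1 q1)
      omega
    · exact fr.near (by omega)
    · exact fr.near (by omega)
  have near2 : ∀ i ∈ cr, Y.card ≤ dg G (σ2 i) Y + 25 * h := by
    intro i hi
    have hi' := (memcr i).1 hi
    have u1 := hi1 (s i)
    have u2 := hi2 (s i)
    simp only [hσ2, hv0]
    split_ifs with q1 q2
    · exact fr.symm.near (by omega)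
    · have := hPY _ ((hw1 i (Finset.mem_filter.2 ⟨hi, q2⟩)).1.2.2 q1)
      omega
    · exact fr.symm.near (by omega)
  have hgad := fr.gadget (F := cr) (S1 := fun i => P.filter (G.Adj (σ1 i)))
    (S2 := fun i => Y.filter (G.Adj (σ2 i))) (U0 := U1) (κ := 0)
    (fun i hi => ⟨Finset.filter_subset _ _, near1 i hi⟩)
    (fun i hi => ⟨Finset.filter_subset _ _, near2 i hi⟩) Finset.subset_union_left (by omega)
    hlow (Or.inl rfl) (by
      set X := Finset.univ \ (Frame.L G P (TT s t) h ∪ Frame.L G Y (TT s t) h) with hX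
      have hss : U1 ∩ X ⊆
          ((Finset.univ \ cr).image s ∪ (Finset.univ \ cr).image t) ∪ cr.biUnion ww := by
        intro x hx
        rw [Finset.mem_inter, hU1, Finset.mem_union] at hx
        obtain ⟨hx1 | hx1, hx2⟩ := hx
        swap
        · exact Finset.mem_union_right _ hx1
        refine Finset.mem_union_left _ ?_
        rw [hX, Finset.mem_sdiff, Finset.mem_union, Frame.mem_L, Frame.mem_L] at hx2
        replace hx2 := hx2.2
        simp only [th, if_pos hx1, not_or, not_lt] at hx2
        simp only [TT, Finset.mem_union, Finset.mem_image, Finset.mem_univ, true_and] at hx1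
        simp only [Finset.mem_union, Finset.mem_image, Finset.mem_sdiff, Finset.mem_univ, true_and]
        rcases hx1 with ⟨i, hi⟩ | ⟨i, hi⟩
        · refine Or.inl ⟨i, fun hic => ?_, hi⟩
          subst hi
          have := (memcr i).1 hic; omega
        · refine Or.inr ⟨i, fun hic => ?_, hi⟩
          subst hi
          have := (memcr i).1 hic; omega
      have e1 := Finset.card_le_card hss
      have e2 := Finset.card_union_le ((Finset.univ \ cr).image s) ((Finset.univ \ cr).image t)
      have e2' := Finset.card_union_le ((Finset.univ \ cr).image s ∪ (Finset.univ \ cr).image t) (cr.biUnion ww)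
      have e3 : ((Finset.univ \ cr).image s).card ≤ _ := Finset.card_image_le
      have e4 : ((Finset.univ \ cr).image t).card ≤ _ := Finset.card_image_le
      have e5 : (Finset.univ \ cr).card + cr.card = k := by
        rw [Finset.card_sdiff_add_card, Finset.union_eq_left.2 (Finset.subset_univ _), Finset.card_univ, c.hk]
      omega)
  -- common form of the gadget paths
  have hcore : ∃ p z : ι → V, (∀ i ∈ cr, p i ∉ U1 ∧ z i ∉ U1) ∧
      (∀ i ∈ cr, ∀ j ∈ cr, i ≠ j → Disjoint ({p i, z i} : Finset V) {p j, z j}) ∧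
      ∀ i ∈ cr, ∀ U, p i ∈ U → z i ∈ U → ∀ M, 3 ≤ M → M % 2 = 1 → U.card + M ≤ 3 * h →
      ∃ L : List V, PI G (s i) (v0 i) L ∧ L.length = M ∧ Disjoint (L.toFinset \ {p i, z i}) U ∧
        2 * (L.toFinset \ P).card ≤ M + 1 ∧ 2 * (L.toFinset \ Y).card ≤ M + 1 := by
    rcases hgad with ⟨p, z, H, Hd⟩ | ⟨p, z, H, Hd⟩
    · refine ⟨p, z, fun i hi => ⟨(H i hi).2.2.1, (H i hi).2.2.2.1⟩, Hd, ?_⟩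
      intro i hi U hp hz M hM hM2 hU
      obtain ⟨q1, q2, -, -, q3⟩ := H i hi
      rw [Finset.mem_filter] at q1
      obtain ⟨L, L1, L2, L3, L4, L5⟩ := gadFillB (by omega) hYP hPY (by omega) (by omega) q1.1 q1.2 q2 q3
        (near2 i hi) hp hz hM hM2 hU
      simp only [hσ1, hσ2] at L1
      split_ifs at L1
      · exact ⟨L.reverse, L1.reverse, by simpa using L2, by simpa using L3, by simpa using L5,
          by simpa using L4⟩
      · exact ⟨L, L1, L2, L3, L5, L4⟩
    · refine ⟨p, z, fun i hi => ⟨(H i hi).2.2.1, (H i hi).2.2.2.1⟩, Hd, ?_⟩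
      intro i hi U hp hz M hM hM2 hU
      obtain ⟨q1, q2, -, -, q3⟩ := H i hi
      rw [Finset.mem_filter] at q1
      obtain ⟨L, L1, L2, L3, L4, L5⟩ := gadFillB (by omega) hPY hYP (by omega) (by omega) q1.1 q1.2 q2 q3
        (near1 i hi) hp hz hM hM2 hU
      simp only [hσ1, hσ2] at L1
      split_ifs at L1
      · exact ⟨L, L1, L2, L3, L4, L5⟩
      · exact ⟨L.reverse, L1.reverse, by simpa using L2, by simpa using L3, by simpa using L4,
          by simpa using L5⟩
  obtain ⟨p, z, hpz, hpzd, core⟩ := hcore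
  set U2 := U1 ∪ cr.biUnion (fun i => {p i, z i}) with hU2
  have hU2c : U2.card ≤ 8 * k := by
    have e1 := Finset.card_union_le U1 (cr.biUnion (fun i => {p i, z i}))
    have e2 := Finset.card_biUnion_le_card_mul cr (fun i => ({p i, z i} : Finset V)) 2
      (fun i _ => Finset.card_le_two)
    rw [← hU2] at e1
    omega
  have pzU : ∀ i ∈ cr, ({p i, z i} : Finset V) ⊆ U2 := fun i hi =>
    (Finset.subset_biUnion_of_mem (fun i => ({p i, z i} : Finset V)) hi).trans Finset.subset_union_right
  have pzU1 : ∀ i ∈ cr, Disjoint ({p i, z i} : Finset V) U1 := by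
    intro i hi
    simp [hpz i hi]
  refine fillB c fr hPY hYP (cr := cr) ?_ ?_ (U2 := U2) (Finset.subset_union_left.trans Finset.subset_union_left)
    hU2c (gad := fun i => {p i, z i} ∪ ww i) ?_ ?_ ?_
  · intro i hi hic
    rw [memcr] at hic
    have u1 := hi1 (s i); have u2 := hi2 (s i); have u3 := hi1 (t i); have u4 := hi2 (t i)
    have hic2 := (not_and.1 hic) hi
    rcases Nat.mod_two_eq_zero_or_one (m i) with hm | hm
    · right
      refine ⟨hm, ?_⟩
      omega
    · left
      refine ⟨hm, ?_⟩
      omega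
  · intro i hi
    have := (memcr i).1 hi
    omega
  · intro i hi
    refine ⟨Finset.union_subset (pzU i hi) ((wwU i hi).trans Finset.subset_union_left), ?_⟩
    rw [Finset.disjoint_union_left]
    exact ⟨(pzU1 i hi).mono_right Finset.subset_union_left, wwT i hi⟩
  · intro i hi j hj hij
    rw [Finset.disjoint_union_left, Finset.disjoint_union_right, Finset.disjoint_union_right]
    exact ⟨⟨hpzd i hi j hj hij, (pzU1 i hi).mono_right (wwU j hj)⟩,
      ((pzU1 j hj).mono_right (wwU i hi)).symm, wwd i hi j hj hij⟩
  · intro i hi hi0 U hU hUc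
    have hm3 := c.hm i hi0
    have hpU : p i ∈ U := hU (pzU i hi (by simp))
    have hzU : z i ∈ U := hU (pzU i hi (by simp))
    have hi' := (memcr i).1 hi
    have u1 := hi1 (s i); have u2 := hi2 (s i); have u3 := hi1 (t i); have u4 := hi2 (t i)
    by_cases hm : m i % 2 = 0
    · obtain ⟨L, L1, L2, L3, L4, L5⟩ := core i hi U hpU hzU (m i - 1) (by omega) (by omega) (by omega)
      obtain ⟨⟨w1, w2, w3⟩, -⟩ := hw1 i (Finset.mem_filter.2 ⟨hi, hm⟩)
      have hwi : ww i = {w i} := by simp only [hww, if_pos hm]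
      have hwU1 : w i ∈ U1 := wwU i hi (by simp [hwi])
      have hwU : w i ∈ U := hU (Finset.mem_union_left _ hwU1)
      have hwpz : w i ∉ ({p i, z i} : Finset V) := fun hh => Finset.disjoint_left.1 (pzU1 i hi) hh hwU1
      have hwL : w i ∉ L := by
        intro hh
        exact Finset.disjoint_left.1 L3 (Finset.mem_sdiff.2 ⟨by simpa using hh, hwpz⟩) hwU
      simp only [hv0, if_pos hm] at L1
      refine ⟨L ++ [w i], L1.snoc w1.symm hwL, by simp; omega, ?_, ?_, ?_⟩
      · refine L3.mono_left ?_
        rw [hwi]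
        exact snoc_sdiff2 _ _ _
      · have ew : ((L ++ [w i]).toFinset \ P) ⊆ (L.toFinset \ P) ∪ ({w i} \ P) := snoc_sdiff _ _ _
        have e1 := (Finset.card_le_card ew).trans (Finset.card_union_le _ _)
        by_cases ha : dg G (s i) P < 20 * h
        · have e2 : (({w i} : Finset V) \ P).card ≤ 1 :=
            (Finset.card_le_card Finset.sdiff_subset).trans (by simp)
          have e3 : ee G s t h P i = 0 := by simp only [ee]; split_ifs <;> omega
          omega
        · have e2 : (({w i} : Finset V) \ P).card = 0 := by simp [w3 ha]
          have e3 : ee G s t h P i ≤ 2 := by simp only [ee]; split_ifs <;> omega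
          omega
      · have ew : ((L ++ [w i]).toFinset \ Y) ⊆ (L.toFinset \ Y) ∪ ({w i} \ Y) := snoc_sdiff _ _ _
        have e1 := (Finset.card_le_card ew).trans (Finset.card_union_le _ _)
        by_cases ha : dg G (s i) P < 20 * h
        · have e2 : (({w i} : Finset V) \ Y).card = 0 := by simp [w2 ha]
          have e3 : ee G s t h Y i ≤ 2 := by simp only [ee]; split_ifs <;> omega
          omega
        · have e2 : (({w i} : Finset V) \ Y).card ≤ 1 :=
            (Finset.card_le_card Finset.sdiff_subset).trans (by simp)
          have e3 : ee G s t h Y i = 0 := by simp only [ee]; split_ifs <;> omega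
          omega
    · obtain ⟨L, L1, L2, L3, L4, L5⟩ := core i hi U hpU hzU (m i) (by omega) (by omega) (by omega)
      simp only [hv0, if_neg hm] at L1
      refine ⟨L, L1, L2, L3.mono_left (Finset.sdiff_subset_sdiff subset_rfl Finset.subset_union_left), ?_, ?_⟩
      · have e3 : ee G s t h P i ≤ 1 := by simp only [ee]; split_ifs <;> omega
        omega
      · have e3 : ee G s t h Y i ≤ 1 := by simp only [ee]; split_ifs <;> omega
        omega

end
end HL

namespace HL
variable {V : Type} {G : SimpleGraph V} {ι : Type} [Fintype V] [Fintype ι]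

section
variable {s t : ι → V} {m : ι → ℕ} {i0 : ι} {k e0 h : ℕ}

lemma dg_compl {x : V} {S : Finset V} (hx : x ∉ S) : dg G x S + dg Gᶜ x S = S.card := by
  have h1 := Finset.card_filter_add_card_filter_not (s := S) (fun y => G.Adj x y)
  have h2 : dg Gᶜ x S = (S.filter (fun y => ¬ G.Adj x y)).card := by
    rw [dg]; congr 1; ext y
    simp only [Finset.mem_filter, SimpleGraph.compl_adj]
    exact ⟨fun h => ⟨h.1, h.2.2⟩, fun h => ⟨h.1, fun hh => hx (hh ▸ h.1), h.2⟩⟩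
  rw [h2]; exact h1

lemma frameB (c : Ctx G s t m i0 k e0 h) {P Y : Finset V} (hP : Ind G (50 * e0) P)
    (hPY : Disjoint P Y) (h2 : Fintype.card V ≤ 2 * Y.card + 3 * h) :
    Frame G P Y (TT s t) k h := by
  have := c.he
  have := c.hsum
  have := hP.2
  exact ⟨hPY, by omega, h2, c.hk1, by omega, c.hn, c.hdeg⟩

lemma missB {P Y T : Finset V} (fr : Frame G P Y T k h) {x : V} (hx : dg G x P = 0) :
    Y.card ≤ dg G x Y + 6 * h := by
  have := fr.dsum x
  have := fr.cards
  have := fr.h1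
  have := fr.h2
  omega

lemma caseB (c : Ctx G s t m i0 k e0 h) (hTw : ¬ TwoCl G (50 * e0)) {P : Finset V}
    (hP : Ind G (50 * e0) P) : Goal G s t m i0 := by
  have hk1 := c.hk1
  have he := c.he
  have hsum := c.hsum
  have hn := c.hn
  have kh : h ≤ k * h := Nat.le_mul_of_pos_left h hk1
  have hPc := hP.2
  have hP0 : ∀ p ∈ P, dg G p P = 0 := fun p hp => dg_disj (fun z hz => hP.1 p hp z hz)
  have key : ∃ Y, Disjoint P Y ∧ (Ind G (50 * e0) Y ∨ ¬ ∃ I, Disjoint P I ∧ Ind G (50 * e0) I) ∧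
      Fintype.card V ≤ 2 * Y.card + 3 * h ∧
      (Frame G P Y (TT s t) k h → ∀ x ∈ Y, P.card ≤ dg G x P + 6 * h) := by
    by_cases hI : ∃ I, Disjoint P I ∧ Ind G (50 * e0) I
    · obtain ⟨Y, hd, hY⟩ := hI
      refine ⟨Y, hd, Or.inl hY, ?_, ?_⟩
      · have := hY.2; omega
      · intro fr x hx
        exact missB fr.symm (dg_disj (fun z hz => hY.1 x hx z hz))
    · set Y := (Finset.univ \ P).filter (fun y => P.card ≤ dg G y P + h) with hY
      have hd : Disjoint P Y := by
        rw [Finset.disjoint_left]; intro x hx hxY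
        exact (Finset.mem_sdiff.1 (Finset.mem_filter.1 hxY).1).2 hx
      refine ⟨Y, hd, Or.inr hI, ?_, ?_⟩
      · set B := (Finset.univ \ P).filter (fun y => ¬ P.card ≤ dg G y P + h) with hB
        have hYB : Y.card + B.card = (Finset.univ \ P).card :=
          Finset.card_filter_add_card_filter_not _
        have hPV : (Finset.univ \ P).card + P.card = Fintype.card V := by
          rw [Finset.card_sdiff_add_card, Finset.union_eq_left.2 (Finset.subset_univ _), Finset.card_univ]
        have hdout : ∀ p ∈ P, Fintype.card V + 2 * k ≤ 2 * dg G p (Finset.univ \ P) := by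
          intro p hp
          have h1 := c.hdeg p
          have h2 : dg G p Finset.univ ≤ dg G p (Finset.univ \ P) + dg G p P := by
            refine le_trans (dg_mono p ?_) (dg_union p _ _)
            intro y _; simp
          have := hP0 p hp
          omega
        have hPn : P.Nonempty := by
          rw [← Finset.card_pos]; omega
        have hPle : 2 * P.card ≤ Fintype.card V := by
          obtain ⟨p, hp⟩ := hPn
          have := hdout p hp
          have := dg_le_card (G := G) p (Finset.univ \ P)
          omega
        have hb := dbl (G := Gᶜ) (B := B) (X := P) (a := h) (b := 50 * e0) (by
          intro y hy
          have hy' := Finset.mem_filter.1 hy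
          have := dg_compl (G := G) (x := y) (S := P) (Finset.mem_sdiff.1 hy'.1).2
          have := hy'.2
          omega) (by
          intro x hx
          have h1 := dg_compl (G := G) (x := x) (S := Finset.univ \ P) (by simp [hx])
          have h2 := hdout x hx
          have h3 : dg Gᶜ x B ≤ dg Gᶜ x (Finset.univ \ P) := dg_mono x (Finset.filter_subset _ _)
          omega)
        have hBh : B.card ≤ h := by
          have hg := c.hg
          by_contra hlt
          push Not at hlt
          have a1 : P.card * (50 * e0) ≤ 50 * e0 * Fintype.card V := by
            rw [mul_comm]; exact Nat.mul_le_mul_left _ (by omega)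
          have a2 : h * h < B.card * h := Nat.mul_lt_mul_of_pos_right hlt (by omega)
          omega
        omega
      · intro _ x hx
        have := (Finset.mem_filter.1 hx).2
        omega
  obtain ⟨Y, hd, hY, hYc, hYP⟩ := key
  have fr := frameB c hP hd hYc
  obtain ⟨l, ξ, f, f1, f2, f3, f4⟩ := famB c fr (fun x hx => missB fr (hP0 x hx)) (hYP fr)
    (fun p hp => Or.inl (by rw [hP0 p hp]; omega))
  exact finalB c hTw hP hd hY f f1 f2 f3 f4

theorem main (c : Ctx G s t m i0 k e0 h) : Goal G s t m i0 := by
  by_cases h1 : TwoCl G (50 * e0)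
  · exact caseA c h1
  by_cases h2 : ∃ P, Ind G (50 * e0) P
  · obtain ⟨P, hP⟩ := h2
    exact caseB c h1 hP
  · exact generic c h1 h2

end
end HL

namespace HL
variable {V : Type} {G : SimpleGraph V} [Fintype V]

lemma ne_erase {ι : Type} [Fintype ι] {i i0 : ι} (h : i ∈ (Finset.univ : Finset ι).erase i0) :
    i ≠ i0 := Finset.ne_of_mem_erase h

lemma erase_sum {ι : Type} [Fintype ι] (F : ι → ℕ) (i0 : ι) :
    F i0 + ∑ i ∈ Finset.univ.erase i0, F i = ∑ i, F i :=
  Finset.add_sum_erase Finset.univ F (Finset.mem_univ i0)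

lemma mem_int {L : List V} {x a b : V} (hnd : L.Nodup) (ha : L.head? = some a)
    (hb : L.getLast? = some b) (hx : x ∈ listInterior L) : x ∈ L ∧ x ≠ a ∧ x ≠ b := by
  cases L with
  | nil => simp at ha
  | cons c L =>
    simp only [List.head?_cons, Option.some.injEq] at ha
    subst ha
    simp only [listInterior, List.tail_cons] at hx
    have hxL := List.mem_of_mem_dropLast hx
    rw [List.nodup_cons] at hnd
    refine ⟨List.mem_cons_of_mem _ hxL, fun hh => hnd.1 (hh ▸ hxL), ?_⟩
    rcases List.eq_nil_or_concat' L with rfl | ⟨M, d, rfl⟩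
    · simp at hxL
    · rw [List.dropLast_concat] at hx
      have hb' : d = b := by
        have : (c :: (M ++ [d])).getLast? = some d := by
          rw [← List.cons_append, List.getLast?_append]; simp
        rw [this] at hb; exact Option.some.inj hb
      subst hb'
      intro hh
      subst hh
      have := hnd.2
      rw [List.nodup_append] at this
      exact this.2.2 x hx x (by simp) rfl

lemma assemble {k : ℕ} {s t : Fin k → V} {N : Fin k → ℕ} {i0 : Fin k}
    (hN : ∀ i, 4 ≤ N i) (hst : ∀ i, s i ≠ t i)
    (hs : (∑ i, (N i - 1)) + (TT s t).card = Fintype.card V)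
    (hG : Goal G s t (fun i => N i - 1) i0) :
    ∃ g : Fin k → List V, IsHamSubdivisionGraph G (fun i => (s i, t i)) N g := by
  obtain ⟨l, f, L, L1, L2, L3, L4, L5⟩ := hG
  have memL : ∀ x, x ∈ L ↔ x ∉ RR s t i0 l := by
    intro x; rw [← List.mem_toFinset, L2]; simp
  have lR : ∀ i, i ≠ i0 → ∀ x ∈ l i, x ∈ RR s t i0 l := by
    intro i hi x hx
    rw [RR, Finset.mem_union, Finset.mem_biUnion]
    exact Or.inl ⟨i, by simp [hi], by simpa using hx⟩
  have lT : ∀ i, i ≠ i0 → ∀ x ∈ l i, x ∉ TT s t := by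
    intro i hi x hx
    exact Finset.disjoint_left.1 (f.1 i hi).2.2 (by simpa using hx)
  have TR : ∀ x, x ∈ TT s t → x ≠ s i0 → x ≠ t i0 → x ∈ RR s t i0 l := by
    intro x hx h1 h2
    rw [RR, Finset.mem_union, Finset.mem_sdiff]
    exact Or.inr ⟨hx, by simp [h1, h2]⟩
  have hlen : L.length = N i0 + 1 := by
    have e1 : L.length = (Finset.univ \ RR s t i0 l).card := by
      rw [← L2, List.toFinset_card_of_nodup L1]
    have e2 : (Finset.univ \ RR s t i0 l).card + (RR s t i0 l).card = Fintype.card V := by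
      rw [Finset.card_sdiff_add_card, Finset.union_eq_left.2 (Finset.subset_univ _), Finset.card_univ]
    have e3 := f.R_card
    have e4 : (TT s t \ {s i0, t i0}).card + 2 = (TT s t).card := by
      have : ({s i0, t i0} : Finset V) ⊆ TT s t := by
        intro x hx
        simp only [Finset.mem_insert, Finset.mem_singleton] at hx
        rcases hx with rfl | rfl
        · exact s_mem _
        · exact t_mem _
      have h2 : ({s i0, t i0} : Finset V).card = 2 := Finset.card_pair (hst i0)
      rw [← h2]
      exact Finset.card_sdiff_add_card_eq_card this
    have e5 := erase_sum (fun i => N i - 1) i0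
    have := hN i0
    omega
  set g : Fin k → List V := fun i => if i = i0 then L else s i :: (l i ++ [t i]) with hg
  have g0 : g i0 = L := by simp [hg]
  have g1 : ∀ i, i ≠ i0 → g i = s i :: (l i ++ [t i]) := fun i hi => by simp [hg, hi]
  have mem1 : ∀ i, i ≠ i0 → ∀ x, x ∈ g i → x ∈ l i ∨ x ∈ TT s t := by
    intro i hi x hx
    rw [g1 i hi] at hx
    simp only [List.mem_cons, List.mem_append, List.not_mem_nil, or_false] at hx
    rcases hx with rfl | hx | rfl
    · exact Or.inr (s_mem _)
    · exact Or.inl hx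
    · exact Or.inr (t_mem _)
  have sg : ∀ i, s i ∈ g i := by
    intro i
    by_cases hi : i = i0
    · subst hi; rw [g0, memL]; exact f.notMem (Or.inl rfl)
    · rw [g1 i hi]; simp
  have tg : ∀ i, t i ∈ g i := by
    intro i
    by_cases hi : i = i0
    · subst hi; rw [g0, memL]; exact f.notMem (Or.inr rfl)
    · rw [g1 i hi]; simp
  refine ⟨g, ?_, ?_, ?_⟩
  · intro i
    by_cases hi : i = i0
    · subst hi
      rw [g0]
      exact ⟨⟨L5, L1, L3, L4⟩, hlen⟩
    · rw [g1 i hi]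
      obtain ⟨⟨p1, p2⟩, p3, p4⟩ := f.1 i hi
      refine ⟨⟨p2, ?_, by simp, ?_⟩, ?_⟩
      · have hs' : s i ∉ l i := fun hh => lT i hi _ hh (s_mem _)
        have ht' : t i ∉ l i := fun hh => lT i hi _ hh (t_mem _)
        rw [List.nodup_cons, List.nodup_append]
        refine ⟨by simp [hs', hst i], p1, by simp, ?_⟩
        intro a ha b hb hab
        simp only [List.mem_singleton] at hb
        exact ht' (hb ▸ hab ▸ ha)
      · rw [← List.cons_append, List.getLast?_append]; simp
      · have := hN i
        have p3' : (l i).length = N i - 1 := p3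
        simp only [List.length_cons, List.length_append, List.length_nil]
        omega
  · intro i j hij x hx hxj
    by_cases hi : i = i0
    · subst hi
      rw [g0] at hx
      obtain ⟨x1, x2, x3⟩ := mem_int L1 L3 L4 hx
      rw [memL] at x1
      rcases mem1 j (Ne.symm hij) x hxj with h | h
      · exact x1 (lR j (Ne.symm hij) x h)
      · exact x1 (TR x h x2 x3)
    · rw [g1 i hi] at hx
      have hx' : x ∈ l i := by simpa [listInterior] using hx
      by_cases hj : j = i0
      · subst hj
        rw [g0, memL] at hxj
        exact hxj (lR i hi x hx')
      · rcases mem1 j hj x hxj with h | h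
        · exact Finset.disjoint_left.1 (f.2 i j hi hj hij) (by simpa using hx') (by simpa using h)
        · exact lT i hi x hx' h
  · intro x
    by_cases hx : x ∈ RR s t i0 l
    · rw [RR, Finset.mem_union, Finset.mem_biUnion, Finset.mem_sdiff] at hx
      rcases hx with ⟨i, hi, hxi⟩ | ⟨hx, -⟩
      · refine ⟨i, ?_⟩
        rw [g1 i (ne_erase hi)]
        rw [List.mem_toFinset] at hxi
        simp [hxi]
      · simp only [TT, Finset.mem_union, Finset.mem_image, Finset.mem_univ, true_and] at hx
        rcases hx with ⟨i, rfl⟩ | ⟨i, rfl⟩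
        · exact ⟨i, sg i⟩
        · exact ⟨i, tg i⟩
    · exact ⟨i0, by rw [g0, memL]; exact hx⟩

lemma longIdx {k n : ℕ} {N : Fin k → ℕ} {A : ℝ} {w : ℕ} (hk : 1 ≤ k) (hn : 100 * k ≤ n)
    (hw : w ≤ 2 * k) (hA : A ≤ 1 / 100)
    (hsum : (∑ i, if (N i : ℝ) < 9 / 10 * (n : ℝ) then (N i : ℝ) else 0) ≤ A * n)
    (htot : (∑ i, (N i - 1)) + w = n) :
    ∃ i0, ((∑ i ∈ Finset.univ.erase i0, N i : ℕ) : ℝ) ≤ A * n := by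
  have hn' : (100 : ℝ) * k ≤ n := by exact_mod_cast hn
  have hw' : (w : ℝ) ≤ 2 * k := by exact_mod_cast hw
  have hk' : (1 : ℝ) ≤ k := by exact_mod_cast hk
  have hex : ∃ i0, ¬ ((N i0 : ℝ) < 9 / 10 * (n : ℝ)) := by
    by_contra hcon
    push Not at hcon
    have e1 : (∑ i, (N i : ℝ)) ≤ A * n := by
      refine le_trans (le_of_eq ?_) hsum
      exact Finset.sum_congr rfl fun i _ => by rw [if_pos (hcon i)]
    have e2 : ((∑ i, (N i - 1) : ℕ) : ℝ) ≤ ∑ i, (N i : ℝ) := by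
      rw [← Nat.cast_sum]
      exact_mod_cast Finset.sum_le_sum fun i _ => Nat.sub_le _ _
    have e3 : ((∑ i, (N i - 1) : ℕ) : ℝ) + w = n := by exact_mod_cast htot
    nlinarith
  obtain ⟨i0, hi0⟩ := hex
  refine ⟨i0, ?_⟩
  have hsh : ∀ j, j ≠ i0 → (N j : ℝ) < 9 / 10 * (n : ℝ) := by
    intro j hj
    by_contra hlt
    have e5 := Finset.add_sum_erase Finset.univ (fun i => N i - 1) (Finset.mem_univ i0)
    have e6 : N j - 1 ≤ ∑ i ∈ Finset.univ.erase i0, (N i - 1) :=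
      Finset.single_le_sum (f := fun i => N i - 1) (fun _ _ => Nat.zero_le _)
        (Finset.mem_erase.2 ⟨hj, Finset.mem_univ _⟩)
    have e7 : N i0 + N j ≤ n + 2 := by omega
    have e8 : (N i0 : ℝ) + N j ≤ n + 2 := by exact_mod_cast e7
    push Not at hlt hi0
    nlinarith
  rw [Nat.cast_sum]
  refine le_trans ?_ hsum
  rw [← Finset.add_sum_erase Finset.univ _ (Finset.mem_univ i0), if_neg hi0, zero_add]
  exact Finset.sum_le_sum fun i hi => by rw [if_pos (hsh i (Finset.ne_of_mem_erase hi))]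

lemma dg_ncard (v : V) : {u | G.Adj v u}.ncard = dg G v Finset.univ := by
  rw [dg, ← Set.ncard_coe_finset]
  congr 1; ext; simp

lemma consts {k n e0 : ℕ} (hk : 1 ≤ k) (hn : 1000000 * k ≤ n) (he : 100000000000 * k ^ 2 * e0 ≤ 2 * n) :
    ∃ h, 100 * e0 ≤ h ∧ 50 * e0 * n ≤ h * h ∧ 10000 * (k * h) ≤ n := by
  refine ⟨n / (10000 * k), ?_⟩
  set h := n / (10000 * k) with hh
  have a1 : 10000 * (k * h) ≤ n := by
    rw [← mul_assoc]; exact Nat.mul_div_le _ _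
  have a2 : n < 10000 * k * (h + 1) := Nat.lt_mul_div_succ n (by omega)
  have a3 : n ≤ 20000 * (k * h) := by nlinarith
  refine ⟨?_, ?_, a1⟩
  · have : k * (100000000000 * k * e0) ≤ k * (40000 * h) := by nlinarith
    have b := Nat.le_of_mul_le_mul_left this (by omega)
    have : e0 ≤ k * e0 := Nat.le_mul_of_pos_left _ hk
    nlinarith
  · have hk2 : 0 < 400000000 * k ^ 2 := by positivity
    refine Nat.le_of_mul_le_mul_left ?_ hk2
    have b1 : 20000000000 * k ^ 2 * e0 ≤ n := by nlinarith
    calc 400000000 * k ^ 2 * (50 * e0 * n) = (20000000000 * k ^ 2 * e0) * n := by ring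
      _ ≤ n * n := Nat.mul_le_mul_right _ b1
      _ ≤ (20000 * (k * h)) * (20000 * (k * h)) := Nat.mul_le_mul a3 a3
      _ = _ := by ring

end HL

/-- **Corollary.** Let `H` be a graph with `k` edges and `δ(H) ≥ 1`.  There are a positive
integer `C₀` and constants `α, β ∈ (0,1)` such that every graph `G` on `n ≥ C₀ k` vertices
with minimum degree `δ(G) ≥ n/2 + k` is arbitrary Hamiltonian `H`-linked with
parameters `α, β`. -/
theorem arbitrary_hamiltonian_H_linked_graph
    {W : Type} [Fintype W] {k : ℕ} (e : Fin k → W × W)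
    (hne : ∀ i, (e i).1 ≠ (e i).2)
    (he : Function.Injective fun i => s((e i).1, (e i).2))
    (hδH : ∀ w : W, ∃ i, w = (e i).1 ∨ w = (e i).2) :
    ∃ (C₀ : ℕ) (α β : ℝ), 0 < C₀ ∧ 0 < α ∧ α < 1 ∧ 0 < β ∧ β < 1 ∧
      ∀ (V : Type) [Fintype V] (G : SimpleGraph V),
        C₀ * k ≤ Fintype.card V →
        (∀ v : V, (Fintype.card V : ℝ) / 2 + k ≤ ({u | G.Adj v u}.ncard : ℝ)) →
        ArbHamHLinkedGraph G e α β := by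
  have hpos : (0 : ℝ) < 100000000000 * ((k : ℝ) ^ 2 + 1) := by positivity
  have hα1 : 1 / (100000000000 * ((k : ℝ) ^ 2 + 1)) ≤ 1 / 100 := by
    apply one_div_le_one_div_of_le (by norm_num)
    nlinarith [sq_nonneg (k : ℝ)]
  refine ⟨1000000000000 * (k ^ 2 + 1), 1 / (100000000000 * ((k : ℝ) ^ 2 + 1)), 9 / 10,
    by positivity, by positivity, by linarith, by norm_num, by norm_num, ?_⟩
  intro V _ G hC hdeg f hf N hN hsum htot
  rcases Nat.eq_zero_or_pos k with rfl | hk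
  · have hW : IsEmpty W := ⟨fun w => by obtain ⟨i, -⟩ := hδH w; exact i.elim0⟩
    have hV : IsEmpty V := by
      rw [← Fintype.card_eq_zero_iff, ← htot]
      simp
    exact ⟨fun i => i.elim0, fun i => i.elim0, fun i => i.elim0, fun x => (hV.false x).elim⟩
  set s : Fin k → V := fun i => f (e i).1 with hs
  set t : Fin k → V := fun i => f (e i).2 with ht
  have hT : HL.TT s t = Finset.univ.image f := by
    ext x
    simp only [HL.TT, hs, ht, Finset.mem_union, Finset.mem_image, Finset.mem_univ, true_and]
    constructor
    · rintro (⟨i, rfl⟩ | ⟨i, rfl⟩)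
      · exact ⟨_, rfl⟩
      · exact ⟨_, rfl⟩
    · rintro ⟨w, rfl⟩
      obtain ⟨i, rfl | rfl⟩ := hδH w
      · exact Or.inl ⟨i, rfl⟩
      · exact Or.inr ⟨i, rfl⟩
  have hTc : (HL.TT s t).card = Fintype.card W := by
    rw [hT, Finset.card_image_of_injective _ hf, Finset.card_univ]
  have hTk : (HL.TT s t).card ≤ 2 * k := by
    have h1 := Finset.card_union_le (Finset.univ.image s) (Finset.univ.image t)
    have h2 : (Finset.univ.image s).card ≤ k := Finset.card_image_le.trans (by simp)
    have h3 : (Finset.univ.image t).card ≤ k := Finset.card_image_le.trans (by simp)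
    rw [HL.TT]; omega
  have hst : ∀ i, s i ≠ t i := fun i hh => hne i (hf hh)
  have hC1 : 1000000000000 * k + 1000000000000 * k ^ 2 * k ≤ Fintype.card V := by
    refine le_trans (le_of_eq ?_) hC; ring
  obtain ⟨i0, hi0⟩ := HL.longIdx (n := Fintype.card V) (w := Fintype.card W) hk (by omega) (by omega)
    hα1 hsum htot
  set e0 := 2 * k + ∑ i ∈ Finset.univ.erase i0, (N i - 1) with he0
  have hM : 100000000000 * k ^ 2 * (∑ i ∈ Finset.univ.erase i0, N i) ≤ Fintype.card V := by
    rw [one_div, inv_mul_eq_div, le_div_iff₀ hpos] at hi0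
    have h0 : (0 : ℝ) ≤ ((∑ i ∈ Finset.univ.erase i0, N i : ℕ) : ℝ) := Nat.cast_nonneg _
    have : (100000000000 : ℝ) * (k : ℝ) ^ 2 * ((∑ i ∈ Finset.univ.erase i0, N i : ℕ) : ℝ) ≤
        Fintype.card V := by nlinarith
    exact_mod_cast this
  have hle : ∑ i ∈ Finset.univ.erase i0, (N i - 1) ≤ ∑ i ∈ Finset.univ.erase i0, N i :=
    Finset.sum_le_sum fun i _ => Nat.sub_le _ _
  obtain ⟨h, h1, h2, h3⟩ := HL.consts (k := k) (n := Fintype.card V) (e0 := e0) hk (by omega) (by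
    have := Nat.mul_le_mul_left (100000000000 * k ^ 2) hle
    have e2 : 100000000000 * k ^ 2 * (2 * k) ≤ Fintype.card V := by
      have : 100000000000 * k ^ 2 * (2 * k) = 200000000000 * (k ^ 2 * k) := by ring
      have : 1000000000000 * k ^ 2 * k = 1000000000000 * (k ^ 2 * k) := by ring
      omega
    rw [he0, mul_add]
    omega)
  have c : HL.Ctx G s t (fun i => N i - 1) i0 k e0 h := by
    refine ⟨by simp, hst, fun i _ => ?_, le_of_eq (by rw [he0]; congr 2; ext; simp), h1, h2, h3, fun x => ?_⟩
    · have := hN i; show 3 ≤ N i - 1; omega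
    · have := hdeg x
      rw [HL.dg_ncard] at this
      have h4 : (Fintype.card V : ℝ) + 2 * k ≤ 2 * (HL.dg G x Finset.univ : ℝ) := by linarith
      exact_mod_cast h4
  exact HL.assemble hN hst (by rw [hTc]; exact htot) (HL.main c)
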